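/- Let n ≥ 2, fix signs ε_1,…,ε_n ∈ {1,−1}, and let p satisfy p ≥ 2 if n ≥ 3 and p ≥ 3 if n = 2. There is a constant C > 0 such that for every F ∈ 𝒮(ℝ×ℝⁿ), every j ∈ ℤ, and every unit vector e' ∈ S^{n−1}, the solution u(t) = −i∫_0^t W_±(t−s)F(s)ds of (i∂_t + Δ_±)u = F, u(0) = 0, satisfies 2^{−(n/2−1/p)j} ‖P_j u‖_{L^{p,∞}_{e'}} ≤ C 2^{−j/2} sup_{e∈S^{n−1}} ‖P_j F‖_{L^{1,2}_e}. -/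

import Mathlib

open MeasureTheory Complex Filter
open scoped FourierTransform RealInnerProductSpace ENNReal NNReal Topology

noncomputable section

namespace DNLS

/-- Euclidean space ℝⁿ. -/
abbrev Eucl (n : ℕ) := EuclideanSpace ℝ (Fin n)

/-- The quadratic symbol `|ξ|²_± = Σ εᵢ ξᵢ²`. -/
def quadSym {n : ℕ} (ε : Fin n → ℝ) (ξ : Eucl n) : ℝ := ∑ i, ε i * (ξ i) ^ 2

/-- The signed vector `e_± = (ε₁e₁, …, εₙeₙ)`. -/
def epm {n : ℕ} (ε : Fin n → ℝ) (e : Eucl n) : Eucl n := WithLp.toLp 2 (fun i => ε i * e i)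

/-- Fourier multiplier operator with symbol `m`. -/
def mulOp {n : ℕ} (m : Eucl n → ℂ) (f : Eucl n → ℂ) : Eucl n → ℂ :=
  𝓕⁻ (fun ξ => m ξ * 𝓕 f ξ)

/-- The propagator `W_±(t)`, with `(W_±(t)φ)^(ξ) = e^{-it|ξ|²_±} φ̂(ξ)`. -/
def prop {n : ℕ} (ε : Fin n → ℝ) (t : ℝ) (φ : Eucl n → ℂ) : Eucl n → ℂ :=
  mulOp (fun ξ => Complex.exp (-Complex.I * t * quadSym ε ξ)) φ

/-- Fourier multiplier operator acting in the space variable of a space-time function. -/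
def mulOpT {n : ℕ} (m : Eucl n → ℂ) (u : ℝ × Eucl n → ℂ) : ℝ × Eucl n → ℂ :=
  fun p => mulOp m (fun y => u (p.1, y)) p.2

/-- Hypotheses on the bump function χ : even, smooth, compactly supported in (-2,2),
equal to one on [-1,1]. -/
structure IsBump (χ : ℝ → ℝ) : Prop where
  smooth : ∀ k : ℕ, ContDiff ℝ k χ
  even : ∀ s, χ (-s) = χ s
  supp : ∀ s, 2 ≤ |s| → χ s = 0
  one : ∀ s, |s| ≤ 1 → χ s = 1

/-- `ψ(s) = χ(|s|) - χ(2|s|)`. -/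
def psiR (χ : ℝ → ℝ) (s : ℝ) : ℝ := χ |s| - χ (2 * |s|)

/-- `ψ_{≥k}(s) = Σ_{m ≥ k} ψ(2^{-m} s)`. -/
def psiGe (χ : ℝ → ℝ) (k : ℤ) (s : ℝ) : ℝ :=
  ∑' m : ℤ, if k ≤ m then psiR χ ((2 : ℝ) ^ (-m) * s) else 0

/-- Littlewood–Paley projection `P_j`. -/
def proj {n : ℕ} (χ : ℝ → ℝ) (j : ℤ) (f : Eucl n → ℂ) : Eucl n → ℂ :=
  mulOp (fun ξ => (psiR χ ((2 : ℝ) ^ (-j) * ‖ξ‖) : ℂ)) f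

/-- Low-frequency projection `P_{≤0} = I - Σ_{j≥1} P_j`. -/
def lowProj {n : ℕ} (χ : ℝ → ℝ) (f : Eucl n → ℂ) : Eucl n → ℂ :=
  mulOp (fun ξ => ((1 - psiGe χ 1 ‖ξ‖ : ℝ) : ℂ)) f

/-- Directional frequency cutoff `Q^{e}_{j,l}` with symbol `ψ_{≥ j-l}(ξ·e)`. -/
def qproj {n : ℕ} (χ : ℝ → ℝ) (e : Eucl n) (j l : ℤ) (f : Eucl n → ℂ) : Eucl n → ℂ :=
  mulOp (fun ξ => ((psiGe χ (j - l) (inner ℝ ξ e : ℝ) : ℝ) : ℂ)) f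

/-- `P_j` acting in the space variable of a space-time function. -/
def projT {n : ℕ} (χ : ℝ → ℝ) (j : ℤ) (u : ℝ × Eucl n → ℂ) : ℝ × Eucl n → ℂ :=
  fun p => proj χ j (fun y => u (p.1, y)) p.2

/-- `P_{≤0}` acting in the space variable of a space-time function. -/
def lowProjT {n : ℕ} (χ : ℝ → ℝ) (u : ℝ × Eucl n → ℂ) : ℝ × Eucl n → ℂ :=
  fun p => lowProj χ (fun y => u (p.1, y)) p.2

/-- `Q^{e}_{j,l}` acting in the space variable of a space-time function. -/
def qprojT {n : ℕ} (χ : ℝ → ℝ) (e : Eucl n) (j l : ℤ) (u : ℝ × Eucl n → ℂ) :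
    ℝ × Eucl n → ℂ :=
  fun p => qproj χ e j l (fun y => u (p.1, y)) p.2

/-- The hyperplane `P_e = {ξ : ξ·e = 0}`. -/
def hyperplane {n : ℕ} (e : Eucl n) : Submodule ℝ (Eucl n) := (ℝ ∙ e)ᗮ

/-- Inner part of the anisotropic norm: the `L^q` norm over `P_e × ℝ` of
`(t,v) ↦ u(t, re + v)`. -/
def innerQ {n : ℕ} (q : ℝ≥0∞) (e : Eucl n) (u : ℝ × Eucl n → ℂ) (r : ℝ) : ℝ≥0∞ :=
  eLpNorm (fun tv : ℝ × (hyperplane e) => u (tv.1, r • e + (tv.2 : Eucl n))) q volume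

/-- The anisotropic norm `‖u‖_{L^{p,q}_e}`. -/
def aniNorm {n : ℕ} (p q : ℝ≥0∞) (e : Eucl n) (u : ℝ × Eucl n → ℂ) : ℝ≥0∞ :=
  if p = ∞ then essSup (innerQ q e u) volume
  else (∫⁻ r : ℝ, innerQ q e u r ^ p.toReal) ^ (1 / p.toReal)

/-- The mixed space-time norm `‖u‖_{L^q_t L^r_x}`. -/
def mixNorm {n : ℕ} (q r : ℝ≥0∞) (u : ℝ × Eucl n → ℂ) : ℝ≥0∞ :=
  if q = ∞ then essSup (fun t => eLpNorm (fun x => u (t, x)) r volume) volume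
  else (∫⁻ t : ℝ, eLpNorm (fun x => u (t, x)) r volume ^ q.toReal) ^ (1 / q.toReal)

/-- `2^a` as an extended nonnegative real. -/
def tp (a : ℝ) : ℝ≥0∞ := ENNReal.ofReal ((2 : ℝ) ^ a)

/-- Homogeneous Besov norm `‖φ‖_{Ḃ^s_{2,1}}`. -/
def homBesov {n : ℕ} (χ : ℝ → ℝ) (s : ℝ) (φ : Eucl n → ℂ) : ℝ≥0∞ :=
  ∑' j : ℤ, tp (s * j) * eLpNorm (proj χ j φ) 2 volume

/-- Inhomogeneous Besov norm `‖φ‖_{B^s_{2,1}}`. -/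
def besov {n : ℕ} (χ : ℝ → ℝ) (s : ℝ) (φ : Eucl n → ℂ) : ℝ≥0∞ :=
  eLpNorm (lowProj χ φ) 2 volume
    + ∑' j : ℕ, tp (s * (j + 1)) * eLpNorm (proj χ (j + 1) φ) 2 volume

/-- The supremum over unit vectors, auxiliary notation. -/
def sphSup {n : ℕ} (g : Eucl n → ℝ≥0∞) : ℝ≥0∞ := ⨆ (e : Eucl n) (_ : ‖e‖ = 1), g e

/-- `‖P_j u‖_{M^m_j} = 2^{-(n/2-1/(m-1))j} sup_e ‖P_j u‖_{L^{m-1,∞}_e}`. -/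
def MmJ {n : ℕ} (χ : ℝ → ℝ) (m : ℕ) (j : ℤ) (u : ℝ × Eucl n → ℂ) : ℝ≥0∞ :=
  tp (-((n : ℝ) / 2 - 1 / ((m : ℝ) - 1)) * j)
    * sphSup (fun e => aniNorm ((m : ℝ≥0∞) - 1) ∞ e (projT χ j u))

/-- `‖P_j u‖_{S_j} = 2^{j/2} sup_e ‖P_j Q^{e_±}_{j,20} u‖_{L^{∞,2}_e}`. -/
def SJ {n : ℕ} (ε : Fin n → ℝ) (χ : ℝ → ℝ) (j : ℤ) (u : ℝ × Eucl n → ℂ) : ℝ≥0∞ :=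
  tp ((j : ℝ) / 2)
    * sphSup (fun e => aniNorm ∞ 2 e (projT χ j (qprojT χ (epm ε e) j 20 u)))

/-- `‖P_j u‖_{T_j} = ‖P_j u‖_{L^∞_t L²_x}`. -/
def TJ {n : ℕ} (χ : ℝ → ℝ) (j : ℤ) (u : ℝ × Eucl n → ℂ) : ℝ≥0∞ :=
  mixNorm ∞ 2 (projT χ j u)

/-- `‖P_j u‖_{Y^m_j}`. -/
def YmJ {n : ℕ} (ε : Fin n → ℝ) (χ : ℝ → ℝ) (m : ℕ) (j : ℤ) (u : ℝ × Eucl n → ℂ) : ℝ≥0∞ :=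
  MmJ χ m j u + SJ ε χ j u + TJ χ j u

/-- The homogeneous resolution norm `‖u‖_{Ż^σ_{2,1}}`. -/
def Zhom {n : ℕ} (ε : Fin n → ℝ) (χ : ℝ → ℝ) (m : ℕ) (σ : ℝ) (u : ℝ × Eucl n → ℂ) : ℝ≥0∞ :=
  ∑' j : ℤ, tp (σ * j) * YmJ ε χ m j u

/-- `N_j`-norm of a function: `2^{-j/2} sup_e ‖f‖_{L^{1,2}_e}`. -/
def NJraw {n : ℕ} (j : ℤ) (f : ℝ × Eucl n → ℂ) : ℝ≥0∞ :=
  tp (-(j : ℝ) / 2) * sphSup (fun e => aniNorm 1 2 e f)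

/-- `‖P_j u‖_{N_j}`. -/
def NJ {n : ℕ} (χ : ℝ → ℝ) (j : ℤ) (u : ℝ × Eucl n → ℂ) : ℝ≥0∞ :=
  NJraw j (projT χ j u)

/-- The homogeneous nonlinear norm `‖F‖_{Ṅ^σ_{2,1}}`. -/
def Nhom {n : ℕ} (χ : ℝ → ℝ) (σ : ℝ) (F : ℝ × Eucl n → ℂ) : ℝ≥0∞ :=
  ∑' j : ℤ, tp (σ * j) * NJ χ j F

/-- `‖P_j u‖_{T̃_j} = ‖P_j u‖_{L^∞_t L²_x} + ‖P_j u‖_{L^{2+4/n}_{t,x}}`. -/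
def TtilJ {n : ℕ} (χ : ℝ → ℝ) (j : ℤ) (u : ℝ × Eucl n → ℂ) : ℝ≥0∞ :=
  mixNorm ∞ 2 (projT χ j u)
    + eLpNorm (projT χ j u) (ENNReal.ofReal (2 + 4 / (n : ℝ))) volume

/-- `‖P_j u‖_{M̃_j} = sup_{p ∈ ℤ, p ≥ 2, np ≥ 6} sup_e 2^{(n/2-1/p)j}‖P_j u‖_{L^{p,∞}_e}`. -/
def MtilJ {n : ℕ} (χ : ℝ → ℝ) (j : ℤ) (u : ℝ × Eucl n → ℂ) : ℝ≥0∞ :=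
  ⨆ (p : ℕ) (_ : 2 ≤ p ∧ 6 ≤ n * p),
    sphSup (fun e => tp (((n : ℝ) / 2 - 1 / (p : ℝ)) * j) * aniNorm (p : ℝ≥0∞) ∞ e (projT χ j u))

/-- `‖P_j u‖_{Ỹ_j}`. -/
def YtilJ {n : ℕ} (ε : Fin n → ℝ) (χ : ℝ → ℝ) (j : ℤ) (u : ℝ × Eucl n → ℂ) : ℝ≥0∞ :=
  MtilJ χ j u + SJ ε χ j u + TtilJ χ j u

/-- The inhomogeneous resolution norm `‖u‖_{Z̃^σ_{2,1}}`. -/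
def Ztil {n : ℕ} (ε : Fin n → ℝ) (χ : ℝ → ℝ) (σ : ℝ) (u : ℝ × Eucl n → ℂ) : ℝ≥0∞ :=
  (∑' j : ℤ, if j ≤ 0 then YtilJ ε χ j u ^ 2 else 0) ^ ((1 : ℝ) / 2)
    + ∑' j : ℤ, if 1 ≤ j then tp (σ * j) * YtilJ ε χ j u else 0

/-- `‖f‖_{Ñ_j}`: infimum over decompositions `f = v + w`. -/
def NtilJraw {n : ℕ} (j : ℤ) (f : ℝ × Eucl n → ℂ) : ℝ≥0∞ :=
  ⨅ (vw : (ℝ × Eucl n → ℂ) × (ℝ × Eucl n → ℂ)) (_ : f = vw.1 + vw.2),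
    NJraw j vw.1 + eLpNorm vw.2 (ENNReal.ofReal ((2 * (n : ℝ) + 4) / ((n : ℝ) + 4))) volume

/-- The inhomogeneous nonlinear norm `‖F‖_{Ñ^σ_{2,1}}`. -/
def Ntil {n : ℕ} (χ : ℝ → ℝ) (σ : ℝ) (F : ℝ × Eucl n → ℂ) : ℝ≥0∞ :=
  (∑' j : ℤ, if j ≤ 0 then NtilJraw j (projT χ j F) ^ 2 else 0) ^ ((1 : ℝ) / 2)
    + ∑' j : ℤ, if 1 ≤ j then tp (σ * j) * NtilJraw j (projT χ j F) else 0

/-- `k`-th spatial partial derivative of a space-time function. -/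
def pd {n : ℕ} (k : ℕ) (u : ℝ × Eucl n → ℂ) (p : ℝ × Eucl n) : ℂ :=
  if h : k < n then fderiv ℝ (fun y => u (p.1, y)) p.2 (EuclideanSpace.single ⟨k, h⟩ (1 : ℝ))
  else 0

/-- The retarded Duhamel integral `∫_0^t W_±(t-s) G(s) ds`. -/
def duhamel {n : ℕ} (ε : Fin n → ℝ) (G : ℝ × Eucl n → ℂ) (p : ℝ × Eucl n) : ℂ :=
  ∫ s in (0 : ℝ)..p.1, prop ε (p.1 - s) (fun y => G (s, y)) p.2

/-- Admissible Strichartz pair: `2/q = n(1/2 - 1/r)`, `q, r ≥ 2`, and `q ≠ 2` when `n = 2`. -/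
def Admissible (n : ℕ) (q r : ℝ) : Prop :=
  2 / q = (n : ℝ) * (1 / 2 - 1 / r) ∧ 2 ≤ q ∧ 2 ≤ r ∧ (n = 2 → q ≠ 2)

/-- Value of a power series with coefficients `c` at `z`. -/
def polyVal {d : ℕ} (c : (Fin d →₀ ℕ) → ℂ) (z : Fin d → ℂ) : ℂ :=
  ∑' β : Fin d →₀ ℕ, c β * ∏ i, z i ^ β i

/-- The argument vector `(u, ū, ∇u, ∇ū)` of the general nonlinearity. -/
def nlArg {n : ℕ} (u : ℝ × Eucl n → ℂ) (p : ℝ × Eucl n) (i : Fin (2 * n + 2)) : ℂ :=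
  if (i : ℕ) = 0 then u p
  else if (i : ℕ) = 1 then starRingEnd ℂ (u p)
  else if (i : ℕ) < n + 2 then pd ((i : ℕ) - 2) u p
  else pd ((i : ℕ) - (n + 2)) (fun q => starRingEnd ℂ (u q)) p

/-- The argument vector `(∇u, ∇ū)` of a nonlinearity in `2n` variables. -/
def gradArg {n : ℕ} (u : ℝ × Eucl n → ℂ) (p : ℝ × Eucl n) (i : Fin (2 * n)) : ℂ :=
  if (i : ℕ) < n then pd (i : ℕ) u p
  else pd ((i : ℕ) - n) (fun q => starRingEnd ℂ (u q)) p

end DNLS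
open DNLS

namespace DNLS

/-- Smooth real functions of one variable. -/
abbrev Smooth (m : ℝ → ℝ) : Prop := ContDiff ℝ ((⊤ : ℕ∞) : WithTop ℕ∞) m

/-- The one dimensional oscillatory integral `∫ e^{i(xξ - tξ²)} m(ξ) dξ`. -/
def osc (m : ℝ → ℝ) (t x : ℝ) : ℂ :=
  ∫ ξ : ℝ, cexp (I * ((x * ξ - t * ξ ^ 2 : ℝ) : ℂ)) * (m ξ : ℂ)

lemma norm_cexp_I_mul_ofReal (a : ℝ) : ‖cexp (I * (a : ℂ))‖ = 1 := by
  rw [mul_comm, Complex.norm_exp_ofReal_mul_I]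

lemma norm_osc_le (m : ℝ → ℝ) (t x : ℝ) : ‖osc m t x‖ ≤ ∫ ξ, |m ξ| := by
  refine (norm_integral_le_integral_norm _).trans (le_of_eq ?_)
  congr 1
  ext ξ
  rw [norm_mul, norm_cexp_I_mul_ofReal, one_mul, Complex.norm_real, Real.norm_eq_abs]

/-- Repeated integration by parts when the phase derivative is bounded below on the support. -/
lemma norm_nonstationary_le (N : ℕ) : ∀ (m : ℝ → ℝ), Smooth m → HasCompactSupport m →
    ∀ (k : ℕ) (δ : ℝ), 0 < δ → ∃ C : ℝ, 0 ≤ C ∧ ∀ t x Λ : ℝ, 0 < Λ → |t| ≤ Λ →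
      (∀ ξ ∈ tsupport m, δ * Λ ≤ |x - 2 * t * ξ|) →
      ‖∫ ξ : ℝ, cexp (I * ((x * ξ - t * ξ ^ 2 : ℝ) : ℂ)) * ((m ξ * ((x - 2 * t * ξ) ^ k)⁻¹ : ℝ) : ℂ)‖
        ≤ C * (Λ⁻¹) ^ (N + k) := by
  induction N with
  | zero =>
    intro m hm hc k δ hδ
    refine ⟨(∫ ξ, |m ξ|) * (δ⁻¹) ^ k, by positivity, fun t x Λ hΛ _ hl => ?_⟩
    have hIntg : Integrable (fun ξ => |m ξ|) := (hm.continuous.integrable_of_hasCompactSupport hc).abs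
    have : ∀ ξ, ‖cexp (I * ((x * ξ - t * ξ ^ 2 : ℝ) : ℂ)) * ((m ξ * ((x - 2 * t * ξ) ^ k)⁻¹ : ℝ) : ℂ)‖
        ≤ |m ξ| * ((δ⁻¹) ^ k * Λ⁻¹ ^ k) := by
      intro ξ
      rw [norm_mul, norm_cexp_I_mul_ofReal, one_mul, Complex.norm_real, Real.norm_eq_abs, abs_mul]
      by_cases h : m ξ = 0
      · simp [h]
      · have := hl ξ (subset_tsupport _ h)
        gcongr
        rw [abs_inv, abs_pow, ← mul_pow, ← mul_inv, inv_pow]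
        gcongr
    refine (norm_integral_le_of_norm_le (hIntg.mul_const _) (ae_of_all _ this)).trans (le_of_eq ?_)
    rw [integral_mul_const, zero_add, mul_assoc]
  | succ N ih =>
    intro m hm hc k δ hδ
    have hdm : Smooth (deriv m) := by
      have := contDiff_infty_iff_deriv.1 hm
      exact this.2
    obtain ⟨C₁, hC₁, h₁⟩ := ih (deriv m) hdm hc.deriv (k + 1) δ hδ
    obtain ⟨C₂, hC₂, h₂⟩ := ih m hm hc (k + 2) δ hδ
    refine ⟨C₁ + 2 * (k + 1) * C₂, by positivity, fun t x Λ hΛ ht hl => ?_⟩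
    have hsub : tsupport (deriv m) ⊆ tsupport m := tsupport_deriv_subset ..
    specialize h₁ t x Λ hΛ ht (fun ξ hξ => hl ξ (hsub hξ))
    specialize h₂ t x Λ hΛ ht hl
    set e : ℝ → ℂ := fun ξ => cexp (I * ((x * ξ - t * ξ ^ 2 : ℝ) : ℂ)) with he
    set d : ℝ → ℝ := fun ξ => x - 2 * t * ξ with hd
    have hne : ∀ ξ ∈ tsupport m, d ξ ≠ 0 := fun ξ hξ h0 => by
      have := hl ξ hξ
      simp only [hd] at h0
      rw [h0, abs_zero] at this
      nlinarith [mul_pos hδ hΛ]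
    have hcont : ∀ (g : ℝ → ℝ) (l : ℕ), Continuous g → tsupport g ⊆ tsupport m →
        Continuous (fun ξ => g ξ * (d ξ ^ l)⁻¹) := by
      intro g l hg hs
      have : Continuous d := by simp only [hd]; fun_prop
      rw [continuous_iff_continuousAt]
      intro ξ
      by_cases h : ξ ∈ tsupport m
      · exact hg.continuousAt.mul (((this.continuousAt).pow l).inv₀ (pow_ne_zero _ (hne ξ h)))
      · have : (fun ξ => g ξ * (d ξ ^ l)⁻¹) =ᶠ[𝓝 ξ] fun _ => 0 := by
          have := notMem_tsupport_iff_eventuallyEq.1 (fun h' => h (hs h'))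
          filter_upwards [this] with y hy
          simp [hy]
        exact continuousAt_const.congr this.symm
    have hecont : Continuous e := by simp only [he]; fun_prop
    have hIntg : ∀ (g : ℝ → ℝ) (l : ℕ), Continuous g → tsupport g ⊆ tsupport m →
        Integrable (fun ξ => e ξ * ((g ξ * (d ξ ^ l)⁻¹ : ℝ) : ℂ)) := by
      intro g l hg hs
      have hgc : HasCompactSupport g := hc.mono' ((subset_tsupport g).trans hs)
      refine Continuous.integrable_of_hasCompactSupport
        (hecont.mul (Complex.continuous_ofReal.comp (hcont g l hg hs))) ?_
      refine hgc.mono ?_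
      intro ξ hξ h0
      exact hξ (by simp [h0])
    have hderiv : ∀ ξ, HasDerivAt (fun ξ => e ξ * ((m ξ * (d ξ ^ (k + 1))⁻¹ : ℝ) : ℂ))
        (I * (e ξ * ((m ξ * (d ξ ^ k)⁻¹ : ℝ) : ℂ)) + e ξ * ((deriv m ξ * (d ξ ^ (k + 1))⁻¹ : ℝ) : ℂ)
          + (2 * t * (k + 1) : ℝ) * (e ξ * ((m ξ * (d ξ ^ (k + 2))⁻¹ : ℝ) : ℂ))) ξ := by
      intro ξ
      have hde : HasDerivAt e (e ξ * (I * (d ξ : ℂ))) ξ := by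
        have h0 : HasDerivAt (fun ξ : ℝ => x * ξ - t * ξ ^ 2) (d ξ) ξ := by
          have := ((hasDerivAt_id ξ).const_mul x).sub (((hasDerivAt_id ξ).pow 2).const_mul t)
          refine this.congr_deriv ?_
          simp [hd]; ring
        exact (h0.ofReal_comp.const_mul I).cexp
      by_cases h : ξ ∈ tsupport m
      · have hm' : HasDerivAt m (deriv m ξ) ξ := (hm.differentiable (by simp) ξ).hasDerivAt
        have hdd : HasDerivAt d (-(2 * t)) ξ := by
          have := ((hasDerivAt_id ξ).const_mul (2 * t)).const_sub x
          simpa using this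
        have hin := (hm'.mul ((hdd.pow (k + 1)).inv (pow_ne_zero _ (hne ξ h)))).ofReal_comp
        refine (hde.mul hin).congr_deriv ?_
        have := hne ξ h
        have : (d ξ : ℂ) ≠ 0 := by exact_mod_cast this
        simp
        field_simp
        ring
      · have h0 := notMem_tsupport_iff_eventuallyEq.1 h
        have h1 := notMem_tsupport_iff_eventuallyEq.1 (fun h' => h (hsub h'))
        have : (fun ξ => e ξ * ((m ξ * (d ξ ^ (k + 1))⁻¹ : ℝ) : ℂ)) =ᶠ[𝓝 ξ] fun _ => 0 := by
          filter_upwards [h0] with y hy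
          simp [hy]
        refine ((hasDerivAt_const ξ (0 : ℂ)).congr_of_eventuallyEq this).congr_deriv ?_
        simp [h0.self_of_nhds, h1.self_of_nhds]
    have i0 := hIntg m k hm.continuous le_rfl
    have i1 := hIntg (deriv m) (k + 1) hdm.continuous hsub
    have i2 := hIntg m (k + 2) hm.continuous le_rfl
    have key := integral_eq_zero_of_hasDerivAt_of_integrable hderiv
      (((i0.const_mul I).add i1).add (i2.const_mul _)) (hIntg m (k + 1) hm.continuous le_rfl)
    have hadd := integral_add ((i0.const_mul I).add i1) (i2.const_mul ((2 * t * (k + 1) : ℝ) : ℂ))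
    simp only [Pi.add_apply] at hadd
    rw [hadd, integral_add (i0.const_mul I) i1, integral_const_mul, integral_const_mul] at key
    have hn : ‖∫ ξ, e ξ * ((m ξ * (d ξ ^ k)⁻¹ : ℝ) : ℂ)‖ ≤
        ‖∫ ξ, e ξ * ((deriv m ξ * (d ξ ^ (k + 1))⁻¹ : ℝ) : ℂ)‖ +
        |2 * t * (k + 1)| * ‖∫ ξ, e ξ * ((m ξ * (d ξ ^ (k + 2))⁻¹ : ℝ) : ℂ)‖ := by
      have : I * (∫ ξ, e ξ * ((m ξ * (d ξ ^ k)⁻¹ : ℝ) : ℂ)) =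
          -(∫ ξ, e ξ * ((deriv m ξ * (d ξ ^ (k + 1))⁻¹ : ℝ) : ℂ)) -
          (2 * t * (k + 1) : ℝ) * ∫ ξ, e ξ * ((m ξ * (d ξ ^ (k + 2))⁻¹ : ℝ) : ℂ) := by
        linear_combination key
      have h2 := congrArg norm this
      rw [norm_mul, norm_I, one_mul] at h2
      rw [h2]
      refine (norm_sub_le _ _).trans ?_
      rw [norm_neg, norm_mul, Complex.norm_real, Real.norm_eq_abs]
    refine hn.trans ?_
    have habs : |2 * t * (k + 1)| ≤ 2 * (k + 1) * Λ := by
      rw [abs_mul, abs_mul, abs_of_pos (by norm_num : (0 : ℝ) < 2),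
        abs_of_pos (by positivity : (0 : ℝ) < (k : ℝ) + 1)]
      nlinarith [abs_nonneg t, (by positivity : (0 : ℝ) < (k : ℝ) + 1)]
    calc _ ≤ C₁ * Λ⁻¹ ^ (N + (k + 1)) + (2 * (k + 1) * Λ) * (C₂ * Λ⁻¹ ^ (N + (k + 2))) := by
          gcongr
      _ = _ := by
          have : Λ * Λ⁻¹ ^ (N + (k + 2)) = Λ⁻¹ ^ (N + 1 + k) := by
            rw [show N + (k + 2) = (N + 1 + k) + 1 by ring, pow_succ]
            field_simp
          rw [show N + (k + 1) = N + 1 + k by ring]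
          linear_combination (2 * (k + 1) * C₂) * this

lemma norm_osc_nonstationary_le (N : ℕ) (m : ℝ → ℝ) (hm : Smooth m) (hc : HasCompactSupport m)
    (δ : ℝ) (hδ : 0 < δ) : ∃ C : ℝ, 0 ≤ C ∧ ∀ t x Λ : ℝ, 0 ≤ Λ → |t| ≤ Λ →
      (∀ ξ ∈ tsupport m, δ * Λ ≤ |x - 2 * t * ξ|) → ‖osc m t x‖ ≤ C * ((1 + Λ) ^ N)⁻¹ := by
  obtain ⟨C, hC, h⟩ := norm_nonstationary_le N m hm hc 0 δ hδ
  refine ⟨C * 2 ^ N + (∫ ξ, |m ξ|) * 2 ^ N, by positivity, fun t x Λ hΛ ht hl => ?_⟩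
  rcases le_total Λ 1 with h1 | h1
  · refine (norm_osc_le m t x).trans ?_
    have : (1 : ℝ) ≤ 2 ^ N * ((1 + Λ) ^ N)⁻¹ := by
      rw [← div_eq_mul_inv, one_le_div (by positivity)]
      gcongr; linarith
    have h0 : 0 ≤ ∫ ξ, |m ξ| := by positivity
    have h3 : 0 ≤ C * 2 ^ N * ((1 + Λ) ^ N)⁻¹ := by positivity
    nlinarith
  · have := h t x Λ (by linarith) ht hl
    have h2 : Λ⁻¹ ^ N ≤ 2 ^ N * ((1 + Λ) ^ N)⁻¹ := by
      rw [← inv_pow, ← mul_pow]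
      gcongr
      rw [← div_eq_mul_inv, inv_le_comm₀ (by linarith) (by positivity), inv_div]
      linarith
    have h0 : 0 ≤ (∫ ξ, |m ξ|) * 2 ^ N * ((1 + Λ) ^ N)⁻¹ := by positivity
    simp only [pow_zero, inv_one, mul_one, add_zero] at this
    calc _ ≤ C * Λ⁻¹ ^ N := this
      _ ≤ C * (2 ^ N * ((1 + Λ) ^ N)⁻¹) := by gcongr
      _ ≤ _ := by linarith

/-- Dispersive decay of the one dimensional oscillatory integral. -/
lemma norm_osc_dispersive_le (m : ℝ → ℝ) (hm : Smooth m) (hc : HasCompactSupport m) :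
    ∃ C : ℝ, 0 ≤ C ∧ ∀ t x : ℝ, ‖osc m t x‖ ≤ C * (1 + |t|) ^ (-(1 / 2) : ℝ) := by
  set mc : ℝ → ℂ := fun ξ => (m ξ : ℂ) with hmc
  have hmcs : ContDiff ℝ ((⊤ : ℕ∞) : WithTop ℕ∞) mc := Complex.ofRealCLM.contDiff.comp hm
  have hmcc : HasCompactSupport mc := hc.comp_left (g := fun x : ℝ => (x : ℂ)) (by simp)
  set φ : SchwartzMap ℝ ℂ := hmcc.toSchwartzMap hmcs with hφ
  set M : SchwartzMap ℝ ℂ := 𝓕 φ with hM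
  have hMi : Integrable M := M.integrable
  have hinv : ∀ ξ : ℝ, (m ξ : ℂ) = ∫ y : ℝ, cexp (I * ((2 * Real.pi * y * ξ : ℝ) : ℂ)) * M y := by
    intro ξ
    have h1 : 𝓕⁻ M = φ := by simp [hM]
    have h2 : (𝓕⁻ M) ξ = (m ξ : ℂ) := by rw [h1]; rfl
    rw [← h2, SchwartzMap.fourierInv_coe, Real.fourierInv_eq']
    congr 1
    ext y
    simp only [smul_eq_mul]
    congr 2
    simp; ring
  have hgauss : ∀ η t x : ℝ, 0 < η → t ≠ 0 →
      ‖∫ ξ : ℝ, cexp (I * (x * ξ : ℝ)) * cexp (-((η : ℂ) + I * t) * (ξ : ℂ) ^ 2) * (m ξ : ℂ)‖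
        ≤ (∫ y, ‖M y‖) * (Real.pi / |t|) ^ (1 / 2 : ℝ) := by
    intro η t x hη ht
    set b : ℂ := (η : ℂ) + I * t with hb
    have hbre : 0 < b.re := by simp [hb, hη]
    have hb0 : b ≠ 0 := fun h => by simp [h] at hbre
    have hG : Integrable (fun ξ : ℝ => cexp (I * (x * ξ : ℝ)) * cexp (-b * (ξ : ℂ) ^ 2)) := by
      refine (integrable_cexp_neg_mul_sq hbre).bdd_mul (c := 1)
        (by fun_prop) (ae_of_all _ fun ξ => (norm_cexp_I_mul_ofReal _).le)
    have hF : Integrable (Function.uncurry fun (ξ y : ℝ) =>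
        (cexp (I * (x * ξ : ℝ)) * cexp (-b * (ξ : ℂ) ^ 2)) *
          (cexp (I * ((2 * Real.pi * y * ξ : ℝ) : ℂ)) * M y)) (volume.prod volume) := by
      have h0 : Integrable (fun z : ℝ × ℝ =>
          (cexp (I * (x * z.1 : ℝ)) * cexp (-b * (z.1 : ℂ) ^ 2)) * M z.2) (volume.prod volume) :=
        hG.mul_prod hMi
      have := h0.bdd_mul (c := 1) (f := fun z : ℝ × ℝ => cexp (I * ((2 * Real.pi * z.2 * z.1 : ℝ) : ℂ)))
        (by fun_prop) (ae_of_all _ fun ξ => (norm_cexp_I_mul_ofReal _).le)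
      refine this.congr (ae_of_all _ fun z => ?_)
      simp only [Function.uncurry]
      ring
    have hcalc : ∫ ξ : ℝ, cexp (I * (x * ξ : ℝ)) * cexp (-b * (ξ : ℂ) ^ 2) * (m ξ : ℂ) =
        ∫ y : ℝ, M y * ((Real.pi / b) ^ (1 / 2 : ℂ) * cexp (-((x + 2 * Real.pi * y : ℝ) : ℂ) ^ 2 / (4 * b))) := by
      calc _ = ∫ ξ : ℝ, ∫ y : ℝ, (cexp (I * (x * ξ : ℝ)) * cexp (-b * (ξ : ℂ) ^ 2)) *
          (cexp (I * ((2 * Real.pi * y * ξ : ℝ) : ℂ)) * M y) := by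
            congr 1; ext ξ
            rw [integral_const_mul, hinv ξ]
        _ = ∫ y : ℝ, ∫ ξ : ℝ, (cexp (I * (x * ξ : ℝ)) * cexp (-b * (ξ : ℂ) ^ 2)) *
          (cexp (I * ((2 * Real.pi * y * ξ : ℝ) : ℂ)) * M y) := integral_integral_swap hF
        _ = _ := by
            congr 1; ext y
            rw [← fourierIntegral_gaussian hbre, ← integral_const_mul]
            congr 1; ext ξ
            have : cexp (I * ((x + 2 * Real.pi * y : ℝ) : ℂ) * ξ) =
                cexp (I * (x * ξ : ℝ)) * cexp (I * ((2 * Real.pi * y * ξ : ℝ) : ℂ)) := by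
              rw [← Complex.exp_add]; congr 1; push_cast; ring
            rw [this]; ring
    rw [hcalc, ← integral_mul_const]
    refine norm_integral_le_of_norm_le (hMi.norm.mul_const _) (ae_of_all _ fun y => ?_)
    rw [norm_mul, norm_mul]
    have e1 : ‖((Real.pi : ℂ) / b) ^ (1 / 2 : ℂ)‖ ≤ (Real.pi / |t|) ^ (1 / 2 : ℝ) := by
      have : ((1 / 2 : ℂ)) = ((1 / 2 : ℝ) : ℂ) := by push_cast; rfl
      rw [this, Complex.norm_cpow_real, norm_div, Complex.norm_real, Real.norm_eq_abs,
        abs_of_pos Real.pi_pos]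
      refine Real.rpow_le_rpow (by positivity) ?_ (by norm_num)
      refine div_le_div_of_nonneg_left Real.pi_pos.le (abs_pos.2 ht) ?_
      have := Complex.abs_im_le_norm b
      simpa [hb] using this
    have e2 : ‖cexp (-((x + 2 * Real.pi * y : ℝ) : ℂ) ^ 2 / (4 * b))‖ ≤ 1 := by
      rw [Complex.norm_exp, Real.exp_le_one_iff]
      have : (-((x + 2 * Real.pi * y : ℝ) : ℂ) ^ 2 / (4 * b)) =
          ((-((x + 2 * Real.pi * y) ^ 2) / 4 : ℝ) : ℂ) * b⁻¹ := by
        push_cast; field_simp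
      rw [this, Complex.re_ofReal_mul, Complex.inv_re]
      have : 0 ≤ b.re / normSq b := div_nonneg hbre.le (normSq_nonneg _)
      nlinarith [sq_nonneg (x + 2 * Real.pi * y)]
    calc _ ≤ ‖M y‖ * ((Real.pi / |t|) ^ (1 / 2 : ℝ) * 1) := by gcongr
      _ = _ := by rw [mul_one]
  have hosc : ∀ t x : ℝ, t ≠ 0 → ‖osc m t x‖ ≤ (∫ y, ‖M y‖) * (Real.pi / |t|) ^ (1 / 2 : ℝ) := by
    intro t x ht
    have hlim : Tendsto (fun η : ℝ => ∫ ξ : ℝ, cexp (I * (x * ξ : ℝ)) *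
        cexp (-((η : ℂ) + I * t) * (ξ : ℂ) ^ 2) * (m ξ : ℂ)) (𝓝[>] 0) (𝓝 (osc m t x)) := by
      refine tendsto_integral_filter_of_dominated_convergence (fun ξ => |m ξ|) ?_ ?_ ?_ ?_
      · refine Eventually.of_forall fun η => ?_
        have := hm.continuous
        exact Continuous.aestronglyMeasurable (by fun_prop)
      · filter_upwards [self_mem_nhdsWithin] with η (hη : 0 < η)
        refine ae_of_all _ fun ξ => ?_
        rw [norm_mul, norm_mul, norm_cexp_I_mul_ofReal, one_mul, Complex.norm_real,
          Real.norm_eq_abs]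
        refine mul_le_of_le_one_left (abs_nonneg _) ?_
        rw [Complex.norm_exp, Real.exp_le_one_iff]
        have : (-((η : ℂ) + I * t) * (ξ : ℂ) ^ 2).re = - η * ξ ^ 2 := by
          rw [← Complex.ofReal_pow, mul_comm, Complex.re_ofReal_mul]; simp; ring
        rw [this]
        nlinarith [sq_nonneg ξ]
      · exact (hm.continuous.integrable_of_hasCompactSupport hc).abs
      · refine ae_of_all _ fun ξ => ?_
        have h1 : cexp (I * ((x * ξ - t * ξ ^ 2 : ℝ) : ℂ)) * (m ξ : ℂ) =
            cexp (I * (x * ξ : ℝ)) * cexp (-(((0 : ℝ) : ℂ) + I * t) * (ξ : ℂ) ^ 2) * (m ξ : ℂ) := by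
          rw [← Complex.exp_add]
          congr 2; push_cast; ring
        rw [h1]
        refine Tendsto.mono_left ?_ nhdsWithin_le_nhds
        have : Continuous fun η : ℝ =>
          cexp (I * (x * ξ : ℝ)) * cexp (-((η : ℂ) + I * t) * (ξ : ℂ) ^ 2) * (m ξ : ℂ) := by fun_prop
        exact this.tendsto 0
    refine le_of_tendsto hlim.norm ?_
    filter_upwards [self_mem_nhdsWithin] with η hη using hgauss η t x hη ht
  have hA : 0 ≤ ∫ y, ‖M y‖ := by positivity
  have hB : 0 ≤ ∫ ξ, |m ξ| := by positivity
  refine ⟨(∫ ξ, |m ξ|) * 2 + (∫ y, ‖M y‖) * (2 * Real.pi) ^ (1 / 2 : ℝ), by positivity, fun t x => ?_⟩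
  have h5 : (0 : ℝ) ≤ (1 + |t|) ^ (-(1 / 2) : ℝ) := by positivity
  rw [add_mul]
  rcases le_total |t| 1 with h1 | h1
  · have : (1 / 2 : ℝ) ≤ (1 + |t|) ^ (-(1 / 2) : ℝ) := by
      calc (1 / 2 : ℝ) = (2 : ℝ) ^ (-1 : ℝ) := by rw [Real.rpow_neg_one]; norm_num
        _ ≤ (2 : ℝ) ^ (-(1 / 2) : ℝ) := Real.rpow_le_rpow_of_exponent_le (by norm_num) (by norm_num)
        _ ≤ _ := Real.rpow_le_rpow_of_nonpos (by positivity) (by linarith) (by norm_num)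
    have h2 := norm_osc_le m t x
    have h3 : 0 ≤ (∫ y, ‖M y‖) * (2 * Real.pi) ^ (1 / 2 : ℝ) * (1 + |t|) ^ (-(1 / 2) : ℝ) := by positivity
    nlinarith
  · have ht : t ≠ 0 := fun h => by simp [h] at h1; linarith
    have h2 := hosc t x ht
    have h4 : (Real.pi / |t|) ^ (1 / 2 : ℝ) ≤ (2 * Real.pi) ^ (1 / 2 : ℝ) * (1 + |t|) ^ (-(1 / 2) : ℝ) := by
      rw [Real.rpow_neg (by positivity), ← Real.inv_rpow (by positivity),
        ← Real.mul_rpow (by positivity) (by positivity)]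
      refine Real.rpow_le_rpow (by positivity) ?_ (by norm_num)
      rw [← div_eq_mul_inv, div_le_div_iff₀ (by linarith) (by positivity)]
      nlinarith [Real.pi_pos]
    have h3 : 0 ≤ (∫ ξ, |m ξ|) * 2 * (1 + |t|) ^ (-(1 / 2) : ℝ) := by positivity
    calc _ ≤ (∫ y, ‖M y‖) * ((2 * Real.pi) ^ (1 / 2 : ℝ) * (1 + |t|) ^ (-(1 / 2) : ℝ)) :=
          h2.trans (by gcongr)
      _ ≤ _ := by linarith

lemma exists_norm_osc_far_le (N : ℕ) (m : ℝ → ℝ) (hm : Smooth m) (hc : HasCompactSupport m) :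
    ∃ A C : ℝ, 1 ≤ A ∧ 0 ≤ C ∧ ∀ t x : ℝ, A * |t| ≤ |x| → ‖osc m t x‖ ≤ C * ((1 + |x|) ^ N)⁻¹ := by
  obtain ⟨B, hB0, hB⟩ := hc.isCompact.isBounded.exists_pos_norm_le
  obtain ⟨C, hC, h⟩ := norm_osc_nonstationary_le N m hm hc (1 / 2) (by norm_num)
  refine ⟨4 * B + 1, C, by linarith, hC, fun t x htx => h t x |x| (abs_nonneg _) ?_ ?_⟩
  · nlinarith [abs_nonneg t]
  · intro ξ hξ
    have h1 : |2 * t * ξ| ≤ 2 * |t| * B := by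
      rw [abs_mul, abs_mul, abs_two]
      have := hB ξ hξ
      rw [Real.norm_eq_abs] at this
      gcongr
    have h2 := abs_sub_abs_le_abs_sub x (2 * t * ξ)
    nlinarith [abs_nonneg t]

lemma exists_norm_osc_wrongSign_le (N : ℕ) (m : ℝ → ℝ) (hm : Smooth m) (hc : HasCompactSupport m)
    (s c : ℝ) (hcpos : 0 < c) (hs : s = 1 ∨ s = -1) (hsupp : ∀ ξ ∈ tsupport m, c ≤ s * ξ) :
    ∃ C : ℝ, 0 ≤ C ∧ ∀ t x : ℝ, s * t * x ≤ 0 →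
      ‖osc m t x‖ ≤ C * ((1 + |t| + |x|) ^ N)⁻¹ := by
  obtain ⟨C, hC, h⟩ := norm_osc_nonstationary_le N m hm hc (min 1 (2 * c)) (by positivity)
  refine ⟨C, hC, fun t x htx => ?_⟩
  rw [add_assoc]
  refine h t x (|t| + |x|) (by positivity) (by linarith [abs_nonneg x]) fun ξ hξ => ?_
  have h1 := hsupp ξ hξ
  have key : |x - 2 * t * ξ| = |x| + 2 * |t| * (s * ξ) := by
    rcases hs with rfl | rfl
    · rcases abs_cases t with ⟨h2, h3⟩ | ⟨h2, h3⟩ <;> rcases abs_cases x with ⟨h4, h5⟩ | ⟨h4, h5⟩ <;>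
        rcases abs_cases (x - 2 * t * ξ) with ⟨h6, h7⟩ | ⟨h6, h7⟩ <;> rw [h2, h4, h6] <;> nlinarith
    · rcases abs_cases t with ⟨h2, h3⟩ | ⟨h2, h3⟩ <;> rcases abs_cases x with ⟨h4, h5⟩ | ⟨h4, h5⟩ <;>
        rcases abs_cases (x - 2 * t * ξ) with ⟨h6, h7⟩ | ⟨h6, h7⟩ <;> rw [h2, h4, h6] <;> nlinarith
  rw [key]
  have e1 : min 1 (2 * c) ≤ 1 := min_le_left _ _
  have e2 : min 1 (2 * c) ≤ 2 * c := min_le_right _ _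
  nlinarith [abs_nonneg t, abs_nonneg x, mul_le_mul_of_nonneg_left h1 (abs_nonneg t),
    mul_le_mul_of_nonneg_right e1 (abs_nonneg x), mul_le_mul_of_nonneg_right e2 (abs_nonneg t)]

/-- The kernel of the propagator with tensor product frequency cutoff. -/
def ker {n : ℕ} (ε : Fin n → ℝ) (m : Fin n → ℝ → ℝ) (t : ℝ) (x : Eucl n) : ℂ :=
  ∫ ξ : Eucl n, cexp (I * ((2 * Real.pi * inner ℝ x ξ - t * quadSym ε ξ : ℝ) : ℂ)) *
    ((∏ k, m k (ξ k) : ℝ) : ℂ)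

lemma ker_eq_prod {n : ℕ} (ε : Fin n → ℝ) (m : Fin n → ℝ → ℝ) (t : ℝ) (x : Eucl n) :
    ker ε m t x = ∏ k, osc (m k) (t * ε k) (2 * Real.pi * x k) := by
  rw [ker, ← (PiLp.volume_preserving_toLp (Fin n)).integral_comp
    (MeasurableEquiv.toLp 2 (Fin n → ℝ)).measurableEmbedding]
  unfold osc
  rw [← integral_fintype_prod_volume_eq_prod]
  congr 1
  ext ξ
  rw [Finset.prod_mul_distrib, ← Complex.exp_sum]
  congr 2
  · rw [← Finset.mul_sum, ← Complex.ofReal_sum]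
    congr 2
    simp only [PiLp.inner_apply, quadSym]
    rw [Finset.sum_sub_distrib, Finset.mul_sum, Finset.mul_sum]
    congr 1
    · refine Finset.sum_congr rfl fun k _ => ?_
      simp; ring
    · refine Finset.sum_congr rfl fun k _ => ?_
      ring
  · push_cast; rfl

lemma exists_abs_coord_max {n : ℕ} (hn : 0 < n) (x : Eucl n) :
    ∃ k, ‖x‖ ≤ n * |x k| := by
  have : Nonempty (Fin n) := ⟨⟨0, hn⟩⟩
  obtain ⟨k, hk⟩ := Finite.exists_max (fun k => |x k|)
  refine ⟨k, ?_⟩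
  rw [EuclideanSpace.norm_eq]
  refine Real.sqrt_le_iff.2 ⟨by positivity, ?_⟩
  calc ∑ i, ‖x i‖ ^ 2 ≤ ∑ _i : Fin n, |x k| ^ 2 := by
        refine Finset.sum_le_sum fun i _ => ?_
        rw [Real.norm_eq_abs]
        exact pow_le_pow_left₀ (abs_nonneg _) (hk i) 2
    _ = n * |x k| ^ 2 := by simp
    _ ≤ (n * |x k|) ^ 2 := by
        rw [mul_pow]
        gcongr
        have : (1 : ℝ) ≤ n := by exact_mod_cast hn
        nlinarith

lemma exists_uniform_osc_bounds {n : ℕ} (N : ℕ) (m : Fin n → ℝ → ℝ) (hm : ∀ k, Smooth (m k))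
    (hc : ∀ k, HasCompactSupport (m k)) :
    ∃ A C : ℝ, 1 ≤ A ∧ 1 ≤ C ∧ ∀ k, ∀ t x : ℝ,
      ‖osc (m k) t x‖ ≤ C * (1 + |t|) ^ (-(1 / 2) : ℝ) ∧
      (A * |t| ≤ |x| → ‖osc (m k) t x‖ ≤ C * ((1 + |x|) ^ N)⁻¹) := by
  choose A C hA hC h using fun k => exists_norm_osc_far_le N (m k) (hm k) (hc k)
  choose D hD h' using fun k => norm_osc_dispersive_le (m k) (hm k) (hc k)
  have hAk : ∀ k, A k ≤ 1 + ∑ k, A k := fun k => by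
    have := Finset.single_le_sum (f := A) (fun i _ => by linarith [hA i]) (Finset.mem_univ k)
    linarith
  have hA0 : 0 ≤ ∑ k, A k := Finset.sum_nonneg fun i _ => by linarith [hA i]
  have hCk : ∀ k, C k ≤ ∑ k, C k := fun k =>
    Finset.single_le_sum (f := C) (fun i _ => hC i) (Finset.mem_univ k)
  have hDk : ∀ k, D k ≤ ∑ k, D k := fun k =>
    Finset.single_le_sum (f := D) (fun i _ => hD i) (Finset.mem_univ k)
  have hC0 : 0 ≤ ∑ k, C k := Finset.sum_nonneg fun i _ => hC i
  have hD0 : 0 ≤ ∑ k, D k := Finset.sum_nonneg fun i _ => hD i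
  refine ⟨1 + ∑ k, A k, 1 + ∑ k, C k + ∑ k, D k, by linarith, by linarith, fun k t x => ⟨?_, ?_⟩⟩
  · refine (h' k t x).trans ?_
    gcongr
    linarith [hDk k]
  · intro hx
    refine (h k t x (le_trans ?_ hx)).trans ?_
    · gcongr; exact hAk k
    · gcongr; linarith [hCk k]

lemma prod_norm_le_mul {n : ℕ} (f : Fin n → ℂ) (C : ℝ) (hC : 1 ≤ C) (h : ∀ k, ‖f k‖ ≤ C) (i : Fin n) :
    ‖∏ k, f k‖ ≤ ‖f i‖ * C ^ n := by
  rw [norm_prod, ← Finset.mul_prod_erase _ _ (Finset.mem_univ i)]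
  gcongr
  calc _ ≤ ∏ _k ∈ Finset.univ.erase i, C := Finset.prod_le_prod (fun _ _ => norm_nonneg _) fun k _ => h k
    _ ≤ C ^ n := by
      rw [Finset.prod_const]
      refine pow_le_pow_right₀ hC ?_
      calc _ ≤ (Finset.univ : Finset (Fin n)).card := Finset.card_le_card (Finset.erase_subset _ _)
        _ = n := by simp

lemma abs_mul_sign {a b : ℝ} (hb : b = 1 ∨ b = -1) : |a * b| = |a| := by
  rcases hb with rfl | rfl <;> simp

lemma norm_osc_le_of_uniform {C t a : ℝ} (hC : 1 ≤ C) (h : a ≤ C * (1 + |t|) ^ (-(1 / 2) : ℝ)) :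
    a ≤ C := by
  refine h.trans (mul_le_of_le_one_right (by linarith) ?_)
  exact Real.rpow_le_one_of_one_le_of_nonpos (by linarith [abs_nonneg t]) (by norm_num)

/-- Dispersive decay of the kernel in the space variable, uniformly in time. -/
lemma exists_norm_ker_le {n : ℕ} (hn : 0 < n) (ε : Fin n → ℝ) (hε : ∀ i, ε i = 1 ∨ ε i = -1)
    (m : Fin n → ℝ → ℝ) (hm : ∀ k, Smooth (m k)) (hc : ∀ k, HasCompactSupport (m k)) :
    ∃ C : ℝ, 0 ≤ C ∧ ∀ t x, ‖ker ε m t x‖ ≤ C * (1 + ‖x‖) ^ (-((n : ℝ) / 2)) := by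
  obtain ⟨A, C, hA, hC, h⟩ := exists_uniform_osc_bounds n m hm hc
  have hn1 : (1 : ℝ) ≤ n := by exact_mod_cast hn
  refine ⟨C ^ n * (n * A) ^ ((n : ℝ) / 2) + C * n ^ n * C ^ n, by positivity, fun t x => ?_⟩
  obtain ⟨k, hk⟩ := exists_abs_coord_max hn x
  rw [ker_eq_prod, add_mul]
  have hpos : (0 : ℝ) ≤ (1 + ‖x‖) ^ (-((n : ℝ) / 2)) := by positivity
  have hbase : ∀ l, ‖osc (m l) (t * ε l) (2 * Real.pi * x l)‖ ≤ C := fun l =>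
    norm_osc_le_of_uniform hC (h l _ _).1
  rcases le_total (A * |t * ε k|) |2 * Real.pi * x k| with hcase | hcase
  · have h1 := (h k _ _).2 hcase
    have h2 := prod_norm_le_mul _ C hC hbase k
    have h3 : ((1 + |2 * Real.pi * x k|) ^ n)⁻¹ ≤ n ^ n * (1 + ‖x‖) ^ (-((n : ℝ) / 2)) := by
      have e1 : (1 + ‖x‖) / n ≤ 1 + |2 * Real.pi * x k| := by
        rw [div_le_iff₀ (by positivity), abs_mul, abs_of_pos (by positivity : 0 < 2 * Real.pi)]
        have : |x k| ≤ 2 * Real.pi * |x k| := by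
          nlinarith [Real.pi_gt_three, abs_nonneg (x k)]
        nlinarith [abs_nonneg (x k)]
      calc _ ≤ (((1 + ‖x‖) / n) ^ n)⁻¹ := by gcongr
        _ = n ^ n * ((1 + ‖x‖) ^ n)⁻¹ := by rw [div_pow, inv_div, div_eq_mul_inv]
        _ ≤ _ := by
          gcongr
          rw [← Real.rpow_natCast, ← Real.rpow_neg (by positivity)]
          refine Real.rpow_le_rpow_of_exponent_le (by linarith [norm_nonneg x]) ?_
          linarith
    calc _ ≤ (C * ((1 + |2 * Real.pi * x k|) ^ n)⁻¹) * C ^ n := h2.trans (by gcongr)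
      _ ≤ (C * (n ^ n * (1 + ‖x‖) ^ (-((n : ℝ) / 2)))) * C ^ n := by gcongr
      _ ≤ _ := by
        have : 0 ≤ C ^ n * (n * A) ^ ((n : ℝ) / 2) * (1 + ‖x‖) ^ (-((n : ℝ) / 2)) := by positivity
        linarith
  · rw [abs_mul_sign (hε k)] at hcase
    have h1 : ‖∏ k, osc (m k) (t * ε k) (2 * Real.pi * x k)‖ ≤
        C ^ n * (1 + |t|) ^ (-((n : ℝ) / 2)) := by
      rw [norm_prod]
      calc _ ≤ ∏ _k : Fin n, C * (1 + |t|) ^ (-(1 / 2) : ℝ) := by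
            refine Finset.prod_le_prod (fun _ _ => norm_nonneg _) fun l _ => ?_
            have := (h l (t * ε l) (2 * Real.pi * x l)).1
            rwa [abs_mul_sign (hε l)] at this
        _ = _ := by
            rw [Finset.prod_const, Finset.card_univ, Fintype.card_fin, mul_pow, ← Real.rpow_natCast
              ((1 + |t|) ^ (-(1 / 2) : ℝ)), ← Real.rpow_mul (by positivity)]
            congr 2; ring
    have h2 : (1 + |t|) ^ (-((n : ℝ) / 2)) ≤
        (n * A) ^ ((n : ℝ) / 2) * (1 + ‖x‖) ^ (-((n : ℝ) / 2)) := by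
      have e1 : (1 + ‖x‖) / (n * A) ≤ 1 + |t| := by
        rw [div_le_iff₀ (by positivity)]
        rw [abs_mul, abs_of_pos (by positivity : 0 < 2 * Real.pi)] at hcase
        have : |x k| ≤ 2 * Real.pi * |x k| := by
          nlinarith [Real.pi_gt_three, abs_nonneg (x k)]
        have hx : ‖x‖ ≤ n * (A * |t|) := hk.trans (by gcongr; linarith)
        have : 1 ≤ n * A := by nlinarith
        linarith
      calc _ ≤ ((1 + ‖x‖) / (n * A)) ^ (-((n : ℝ) / 2)) :=
            Real.rpow_le_rpow_of_nonpos (by positivity) e1 (by linarith)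
        _ = _ := by
            rw [Real.div_rpow (by positivity) (by positivity), div_eq_mul_inv,
              ← Real.rpow_neg (by positivity), neg_neg, mul_comm]
    calc _ ≤ C ^ n * ((n * A) ^ ((n : ℝ) / 2) * (1 + ‖x‖) ^ (-((n : ℝ) / 2))) := h1.trans (by gcongr)
      _ ≤ _ := by
        have : 0 ≤ C * n ^ n * C ^ n * (1 + ‖x‖) ^ (-((n : ℝ) / 2)) := by positivity
        linarith

/-- Rapid decay of the kernel where its group velocity points away from the evaluation point. -/
lemma exists_norm_ker_wrongSign_le {n : ℕ} (N : ℕ) (ε : Fin n → ℝ) (hε : ∀ i, ε i = 1 ∨ ε i = -1)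
    (m : Fin n → ℝ → ℝ) (hm : ∀ k, Smooth (m k)) (hc : ∀ k, HasCompactSupport (m k))
    (i : Fin n) (s c : ℝ) (hcpos : 0 < c) (hs : s = 1 ∨ s = -1)
    (hsupp : ∀ ξ ∈ tsupport (m i), c ≤ s * ξ) :
    ∃ C : ℝ, 0 ≤ C ∧ ∀ t (x : Eucl n), s * ε i * t * x i ≤ 0 →
      ‖ker ε m t x‖ ≤ C * ((1 + |t| + ‖x‖) ^ N)⁻¹ := by
  have hn : 0 < n := i.pos
  obtain ⟨A, C, hA, hC, h⟩ := exists_uniform_osc_bounds N m hm hc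
  obtain ⟨D, hD, h'⟩ := exists_norm_osc_wrongSign_le N (m i) (hm i) (hc i) s c hcpos hs hsupp
  have hn1 : (1 : ℝ) ≤ n := by exact_mod_cast hn
  refine ⟨C * (n + 1) ^ N * C ^ n + D * (1 + n * A) ^ N * C ^ n, by positivity, fun t x htx => ?_⟩
  obtain ⟨k, hk⟩ := exists_abs_coord_max hn x
  rw [ker_eq_prod, add_mul]
  have hbase : ∀ l, ‖osc (m l) (t * ε l) (2 * Real.pi * x l)‖ ≤ C := fun l =>
    norm_osc_le_of_uniform hC (h l _ _).1
  have hxk : |x k| ≤ |2 * Real.pi * x k| := by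
    rw [abs_mul, abs_of_pos (by positivity : 0 < 2 * Real.pi)]
    nlinarith [Real.pi_gt_three, abs_nonneg (x k)]
  have hinv : ∀ a b : ℝ, 0 < a → 0 < b → (1 + |t| + ‖x‖) ≤ b * a →
      (a ^ N)⁻¹ ≤ b ^ N * ((1 + |t| + ‖x‖) ^ N)⁻¹ := by
    intro a b ha hb hab
    rw [← inv_pow, ← inv_pow, ← mul_pow]
    gcongr
    rw [← div_eq_mul_inv, inv_le_comm₀ ha (by positivity), inv_div, div_le_iff₀ hb]
    linarith
  rcases le_total (A * |t * ε k|) |2 * Real.pi * x k| with hcase | hcase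
  · have h1 := (h k _ _).2 hcase
    have h2 := prod_norm_le_mul _ C hC hbase k
    rw [abs_mul_sign (hε k)] at hcase
    have h3 := hinv (1 + |2 * Real.pi * x k|) (n + 1) (by positivity) (by positivity) (by
      have : |t| ≤ A * |t| := by nlinarith [abs_nonneg t]
      have : ‖x‖ ≤ n * |2 * Real.pi * x k| := hk.trans (by gcongr)
      nlinarith)
    calc _ ≤ (C * ((n + 1) ^ N * ((1 + |t| + ‖x‖) ^ N)⁻¹)) * C ^ n :=
          h2.trans (by gcongr; exact h1.trans (by gcongr))
      _ ≤ _ := by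
        have : 0 ≤ D * (1 + n * A) ^ N * C ^ n * ((1 + |t| + ‖x‖) ^ N)⁻¹ := by positivity
        linarith
  · rw [abs_mul_sign (hε k)] at hcase
    have h1 := h' (t * ε i) (2 * Real.pi * x i) (by nlinarith [Real.pi_pos])
    have h2 := prod_norm_le_mul _ C hC hbase i
    rw [abs_mul_sign (hε i)] at h1
    have h3 := hinv (1 + |t|) (1 + n * A) (by positivity) (by positivity) (by
      have : ‖x‖ ≤ n * (A * |t|) := hk.trans (by gcongr; linarith)
      nlinarith [abs_nonneg t, (by positivity : 0 ≤ n * A)])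
    have h4 : ((1 + |t| + |2 * Real.pi * x i|) ^ N)⁻¹ ≤ ((1 + |t|) ^ N)⁻¹ := by
      exact inv_anti₀ (by positivity)
        (pow_le_pow_left₀ (by positivity) (by linarith [abs_nonneg (2 * Real.pi * x i)]) N)
    calc _ ≤ (D * ((1 + n * A) ^ N * ((1 + |t| + ‖x‖) ^ N)⁻¹)) * C ^ n :=
          h2.trans (by gcongr; exact h1.trans (by gcongr; exact h4.trans h3))
      _ ≤ _ := by
        have : 0 ≤ C * (n + 1) ^ N * C ^ n * ((1 + |t| + ‖x‖) ^ N)⁻¹ := by positivity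
        linarith

/-- A Young-type inequality for the bilinear form with kernel `w (ρ - ρ')`. -/
lemma lintegral_lintegral_mul_mul_le {p : ℝ} (hp : 2 ≤ p) {g w : ℝ → ℝ≥0∞}
    (hg : Measurable g) (hw : Measurable w) :
    ∫⁻ z : ℝ × ℝ, g z.1 * g z.2 * w (z.1 - z.2) ≤
      (∫⁻ r, w r ^ (p / 2)) ^ (2 / p) * (∫⁻ r, g r ^ (p / (p - 1))) ^ (2 - 2 / p) := by
  have hp0 : 0 < p := by linarith
  have hp1 : 0 < p - 1 := by linarith
  set q := p / (p - 1) with hq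
  have hq0 : 0 ≤ q := by positivity
  set H := ∫⁻ r, g r ^ q with hH
  set W := ∫⁻ r, w r ^ (p / 2) with hW
  let f : Fin 3 → ℝ × ℝ → ℝ≥0∞ := ![fun z => g z.1 ^ q * g z.2 ^ q,
    fun z => g z.1 ^ q * w (z.1 - z.2) ^ (p / 2), fun z => g z.2 ^ q * w (z.1 - z.2) ^ (p / 2)]
  let c : Fin 3 → ℝ := ![1 - 2 / p, 1 / p, 1 / p]
  have h2p : 2 / p ≤ 1 := by rw [div_le_one hp0]; exact hp
  have hc : ∀ i ∈ Finset.univ, 0 ≤ c i := by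
    intro i _
    fin_cases i
    · simpa [c] using h2p
    · simp [c, hp0.le]
    · simp [c, hp0.le]
  have hf : ∀ i ∈ Finset.univ, AEMeasurable (f i) (volume : Measure (ℝ × ℝ)) := by
    intro i _
    fin_cases i <;> (refine Measurable.aemeasurable ?_; simp [f]; fun_prop)
  have hsum : ∑ i, c i = 1 := by simp [Fin.sum_univ_three, c]; ring
  have key := ENNReal.lintegral_prod_norm_pow_le Finset.univ hf hsum hc
  simp only [Fin.prod_univ_three] at key
  have e0 : ∫⁻ z, f 0 z = H * H := by
    simp only [f, Matrix.cons_val_zero]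
    rw [Measure.volume_eq_prod, lintegral_prod_mul (f := fun r => g r ^ q) (g := fun r => g r ^ q)
      (by fun_prop) (by fun_prop)]
  have e1 : ∫⁻ z, f 1 z = H * W := by
    change ∫⁻ z : ℝ × ℝ, g z.1 ^ q * w (z.1 - z.2) ^ (p / 2) = _
    rw [Measure.volume_eq_prod, lintegral_prod _ (by fun_prop)]
    simp only
    rw [hH, ← lintegral_mul_const _ (by fun_prop)]
    refine lintegral_congr fun r => ?_
    rw [lintegral_const_mul _ (by fun_prop)]
    congr 1
    exact lintegral_sub_left_eq_self (fun x => w x ^ (p / 2)) r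
  have e2 : ∫⁻ z, f 2 z = H * W := by
    change ∫⁻ z : ℝ × ℝ, g z.2 ^ q * w (z.1 - z.2) ^ (p / 2) = _
    rw [Measure.volume_eq_prod, lintegral_prod_symm _ (by fun_prop)]
    simp only
    rw [hH, ← lintegral_mul_const _ (by fun_prop)]
    refine lintegral_congr fun r => ?_
    rw [lintegral_const_mul _ (by fun_prop)]
    congr 1
    exact lintegral_sub_right_eq_self (fun x => w x ^ (p / 2)) r
  rw [e0, e1, e2] at key
  refine le_trans (le_of_eq (lintegral_congr fun z => ?_)) (key.trans (le_of_eq ?_))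
  · simp only [f, c, Matrix.cons_val_zero, Matrix.cons_val_one, Matrix.cons_val_two,
      Matrix.tail_cons, Matrix.head_cons]
    have h1 : 0 ≤ 1 - 2 / p := by linarith
    have h2 : 0 ≤ 1 / p := by positivity
    simp only [ENNReal.mul_rpow_of_nonneg _ _ h1, ENNReal.mul_rpow_of_nonneg _ _ h2,
      ← ENNReal.rpow_mul]
    have e3 : ∀ x : ℝ≥0∞, x = x ^ (q * (1 - 2 / p)) * x ^ (q * (1 / p)) := by
      intro x
      rw [← ENNReal.rpow_add_of_nonneg _ _ (by positivity) (by positivity)]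
      conv_lhs => rw [← ENNReal.rpow_one x]
      congr 1
      rw [hq]; field_simp; ring
    have e4 : ∀ x : ℝ≥0∞, x = x ^ (p / 2 * (1 / p)) * x ^ (p / 2 * (1 / p)) := by
      intro x
      rw [← ENNReal.rpow_add_of_nonneg _ _ (by positivity) (by positivity)]
      conv_lhs => rw [← ENNReal.rpow_one x]
      congr 1
      field_simp; ring
    conv_lhs => rw [e3 (g z.1), e3 (g z.2), e4 (w (z.1 - z.2))]
    ring
  · simp only [c, Matrix.cons_val_zero, Matrix.cons_val_one, Matrix.cons_val_two,
      Matrix.tail_cons, Matrix.head_cons]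
    have h1 : 0 ≤ 1 - 2 / p := by linarith
    have h2 : 0 ≤ 1 / p := by positivity
    simp only [ENNReal.mul_rpow_of_nonneg _ _ h1, ENNReal.mul_rpow_of_nonneg _ _ h2]
    have e3 : H ^ (2 - 2 / p) = H ^ (1 - 2 / p) * H ^ (1 - 2 / p) * H ^ (1 / p) * H ^ (1 / p) := by
      rw [← ENNReal.rpow_add_of_nonneg _ _ h1 h1,
        ← ENNReal.rpow_add_of_nonneg _ _ (by positivity) h2,
        ← ENNReal.rpow_add_of_nonneg _ _ (by positivity) h2]
      congr 1; ring
    have e4 : W ^ (2 / p) = W ^ (1 / p) * W ^ (1 / p) := by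
      rw [← ENNReal.rpow_add_of_nonneg _ _ h2 h2]; congr 1; ring
    rw [e3, e4]; ring

/-- The decay rate of the dispersive kernel. -/
def wt (n : ℕ) (r : ℝ) : ℝ≥0∞ := ENNReal.ofReal ((1 + |r|) ^ (-((n : ℝ) / 2)))

lemma measurable_wt (n : ℕ) : Measurable (wt n) := by unfold wt; fun_prop

lemma exists_lintegral_wt_le {n : ℕ} (hn : 2 ≤ n) {p : ℝ} (hp : 3 ≤ n → 2 ≤ p)
    (hp2 : n = 2 → 3 ≤ p) : ∃ C : ℝ≥0, ∀ g : ℝ → ℝ≥0∞, Measurable g →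
      ∫⁻ z : ℝ × ℝ, g z.1 * g z.2 * wt n (z.1 - z.2) ≤
        (C * (∫⁻ r, g r ^ (p / (p - 1))) ^ (1 - 1 / p)) ^ 2 := by
  have h2p : 2 ≤ p := by
    rcases hn.eq_or_lt with h | h
    · linarith [hp2 h.symm]
    · exact hp h
  have hnp : 1 < (n : ℝ) / 2 * (p / 2) := by
    rcases hn.eq_or_lt with h | h
    · rw [← h]; push_cast; linarith [hp2 h.symm]
    · have : (3 : ℝ) ≤ n := by exact_mod_cast h
      nlinarith
  have hfin : ∫⁻ r, wt n r ^ (p / 2) ≠ ∞ := by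
    have h := (integrable_one_add_norm (E := ℝ) (μ := volume) (r := (n : ℝ) / 2 * (p / 2))
      (by simpa using hnp)).lintegral_lt_top
    refine ne_of_lt (lt_of_eq_of_lt (lintegral_congr fun r => ?_) h)
    rw [wt, ENNReal.ofReal_rpow_of_nonneg (by positivity) (by positivity),
      ← Real.rpow_mul (by positivity), Real.norm_eq_abs, neg_mul]
  have hfin' : ((∫⁻ r, wt n r ^ (p / 2)) ^ (2 / p)) ^ (1 / 2 : ℝ) ≠ ∞ := by
    have := ENNReal.rpow_ne_top_of_nonneg (by positivity : 0 ≤ 2 / p) hfin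
    exact ENNReal.rpow_ne_top_of_nonneg (by positivity) this
  refine ⟨(((∫⁻ r, wt n r ^ (p / 2)) ^ (2 / p)) ^ (1 / 2 : ℝ)).toNNReal, fun g hg => ?_⟩
  refine (lintegral_lintegral_mul_mul_le h2p hg (measurable_wt n)).trans (le_of_eq ?_)
  have e : ∀ (x : ℝ≥0∞) (a b : ℝ), b = a * 2 → x ^ b = (x ^ a) ^ 2 := by
    intro x a b h
    rw [h, ENNReal.rpow_mul, ← ENNReal.rpow_natCast]; norm_num
  rw [ENNReal.coe_toNNReal hfin', mul_pow, ← e _ (1 / 2) 1 (by norm_num), ENNReal.rpow_one,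
    ← e _ (1 - 1 / p) (2 - 2 / p) (by ring)]

/-- The oscillating phase of the propagator. -/
def ph {n : ℕ} (ε : Fin n → ℝ) (t : ℝ) (x ξ : Eucl n) : ℂ :=
  cexp (I * ((2 * Real.pi * inner ℝ x ξ - t * quadSym ε ξ : ℝ) : ℂ))

/-- A tensor product of one-dimensional functions. -/
def tens {n : ℕ} (m : Fin n → ℝ → ℝ) (ξ : Eucl n) : ℝ := ∏ k, m k (ξ k)

lemma ker_eq {n : ℕ} (ε : Fin n → ℝ) (m : Fin n → ℝ → ℝ) (t : ℝ) (x : Eucl n) :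
    ker ε m t x = ∫ ξ, ph ε t x ξ * (tens m ξ : ℂ) := rfl

lemma norm_ph {n : ℕ} (ε : Fin n → ℝ) (t : ℝ) (x ξ : Eucl n) : ‖ph ε t x ξ‖ = 1 :=
  norm_cexp_I_mul_ofReal _

lemma ph_mul_conj {n : ℕ} (ε : Fin n → ℝ) (t t' : ℝ) (x x' ξ : Eucl n) :
    ph ε t x ξ * starRingEnd ℂ (ph ε t' x' ξ) = ph ε (t - t') (x - x') ξ := by
  simp only [ph, ← Complex.exp_conj, ← Complex.exp_add, map_mul, conj_I, conj_ofReal]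
  congr 1
  rw [inner_sub_left]
  push_cast
  ring

@[fun_prop]
lemma continuous_quadSym {n : ℕ} (ε : Fin n → ℝ) : Continuous (quadSym ε) := by
  unfold quadSym; fun_prop

lemma measurable_ph {n : ℕ} (ε : Fin n → ℝ) {α : Type*} [MeasurableSpace α] {T : α → ℝ}
    {x ξ : α → Eucl n} (hT : Measurable T) (hx : Measurable x) (hξ : Measurable ξ) :
    Measurable fun a => ph ε (T a) (x a) (ξ a) := by
  have h1 : Measurable fun a => (inner ℝ (x a) (ξ a) : ℝ) := hx.inner hξ
  have h2 : Measurable fun a => quadSym ε (ξ a) := (continuous_quadSym ε).measurable.comp hξ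
  unfold ph
  fun_prop

lemma continuous_tens {n : ℕ} {m : Fin n → ℝ → ℝ} (hm : ∀ k, Smooth (m k)) :
    Continuous (tens m) := by
  unfold tens
  refine continuous_finsetProd _ fun k _ => (hm k).continuous.comp (by fun_prop)

lemma integrable_tens {n : ℕ} {m : Fin n → ℝ → ℝ} (hm : ∀ k, Smooth (m k))
    (hc : ∀ k, HasCompactSupport (m k)) : Integrable (tens m) := by
  have h : Integrable (fun y : Fin n → ℝ => ∏ k, m k (y k)) :=
    Integrable.fintype_prod (fun k => (hm k).continuous.integrable_of_hasCompactSupport (hc k))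
  exact (PiLp.volume_preserving_ofLp (Fin n)).integrable_comp_of_integrable h

lemma lintegral_ofReal_eq_enorm_integral {α : Type*} [MeasurableSpace α] {μ : Measure α}
    {g : α → ℝ} (hg : Integrable g μ) (h0 : 0 ≤ g) :
    ∫⁻ a, ENNReal.ofReal (g a) ∂μ = ‖∫ a, (g a : ℂ) ∂μ‖ₑ := by
  have h : ∫ a, (g a : ℂ) ∂μ = ((∫ a, g a ∂μ : ℝ) : ℂ) := integral_ofReal
  rw [← ofReal_integral_eq_lintegral_ofReal hg (Eventually.of_forall h0), h,
    ← ofReal_norm, Complex.norm_real, Real.norm_of_nonneg (integral_nonneg h0)]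

/-- `TT*` bound for the extension operator along a curve. -/
lemma exists_lintegral_tens_sq_le {n : ℕ} (hn : 0 < n) (ε : Fin n → ℝ)
    (hε : ∀ i, ε i = 1 ∨ ε i = -1) (m : Fin n → ℝ → ℝ) (hm : ∀ k, Smooth (m k))
    (hc : ∀ k, HasCompactSupport (m k)) :
    ∃ C : ℝ≥0, ∀ (h : ℝ → ℂ) (T : ℝ → ℝ) (x : ℝ → Eucl n), Integrable h → Measurable T →
      Measurable x → (∀ ρ ρ', |ρ - ρ'| ≤ ‖x ρ - x ρ'‖) →
      ∫⁻ ξ, ‖(tens m ξ : ℂ) * ∫ ρ, h ρ * ph ε (T ρ) (x ρ) ξ‖ₑ ^ 2 ≤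
        C * ∫⁻ z : ℝ × ℝ, ‖h z.1‖ₑ * ‖h z.2‖ₑ * wt n (z.1 - z.2) := by
  have hm2 : ∀ k, Smooth (fun r => m k r ^ 2) := fun k => (hm k).pow 2
  have hc2 : ∀ k, HasCompactSupport (fun r => m k r ^ 2) := fun k =>
    (hc k).comp_left (g := fun r => r ^ 2) (by norm_num)
  obtain ⟨C, hC, hK⟩ := exists_norm_ker_le hn ε hε (fun k r => m k r ^ 2) hm2 hc2
  have htens : ∀ ξ, tens (fun k r => m k r ^ 2) ξ = tens m ξ ^ 2 := fun ξ => by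
    simp [tens, Finset.prod_pow]
  refine ⟨C.toNNReal, fun h T x hh hT hx hd => ?_⟩
  set A : Eucl n → ℂ := fun ξ => ∫ ρ, h ρ * ph ε (T ρ) (x ρ) ξ with hA
  let Φ : Eucl n × (ℝ × ℝ) → ℂ := fun z => (tens m z.1 ^ 2 : ℝ) *
    ((h z.2.1 * ph ε (T z.2.1) (x z.2.1) z.1) *
      starRingEnd ℂ (h z.2.2 * ph ε (T z.2.2) (x z.2.2) z.1))
  have hM : Integrable (fun ξ => tens m ξ ^ 2) := by
    simpa only [← htens] using integrable_tens hm2 hc2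
  have hΦ : Integrable Φ := by
    have h1 : Integrable (fun z : Eucl n × (ℝ × ℝ) => ((tens m z.1 ^ 2 : ℝ) : ℂ) *
        (h z.2.1 * h z.2.2)) (volume.prod (volume.prod volume)) :=
      (hM.ofReal (𝕜 := ℂ)).mul_prod (hh.mul_prod hh)
    refine h1.mono ?_ (Eventually.of_forall fun z => ?_)
    · have ha : AEStronglyMeasurable (fun z : Eucl n × (ℝ × ℝ) => ((tens m z.1 ^ 2 : ℝ) : ℂ))
          (volume.prod (volume.prod volume)) :=
        (hM.ofReal (𝕜 := ℂ)).1.comp_fst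
      have hb : AEStronglyMeasurable (fun z : Eucl n × (ℝ × ℝ) => h z.2.1)
          (volume.prod (volume.prod volume)) := hh.1.comp_fst.comp_snd
      have hb' : AEStronglyMeasurable (fun z : Eucl n × (ℝ × ℝ) => h z.2.2)
          (volume.prod (volume.prod volume)) := hh.1.comp_snd.comp_snd
      have hp : Measurable (fun z : Eucl n × (ℝ × ℝ) => ph ε (T z.2.1) (x z.2.1) z.1) :=
        measurable_ph ε (by fun_prop) (by fun_prop) (by fun_prop)
      have hp' : Measurable (fun z : Eucl n × (ℝ × ℝ) => ph ε (T z.2.2) (x z.2.2) z.1) :=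
        measurable_ph ε (by fun_prop) (by fun_prop) (by fun_prop)
      exact ha.mul ((hb.mul hp.aestronglyMeasurable).mul
        (Complex.continuous_conj.comp_aestronglyMeasurable (hb'.mul hp'.aestronglyMeasurable)))
    · simp only [Φ, norm_mul, RCLike.norm_conj, norm_ph, mul_one]; rfl
  have hswap := integral_integral_swap (f := fun ξ z => Φ (ξ, z)) hΦ
  have hin : ∀ ξ, ∫ z : ℝ × ℝ, Φ (ξ, z) = ((tens m ξ ^ 2 * ‖A ξ‖ ^ 2 : ℝ) : ℂ) := by
    intro ξ
    simp only [Φ]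
    rw [integral_const_mul, Measure.volume_eq_prod,
      integral_prod_mul (fun ρ => h ρ * ph ε (T ρ) (x ρ) ξ)
        (fun ρ => starRingEnd ℂ (h ρ * ph ε (T ρ) (x ρ) ξ)), integral_conj, Complex.mul_conj,
      Complex.normSq_eq_norm_sq]
    push_cast
    rfl
  have hout : ∀ z : ℝ × ℝ, ∫ ξ, Φ (ξ, z) = h z.1 * starRingEnd ℂ (h z.2) *
      ker ε (fun k r => m k r ^ 2) (T z.1 - T z.2) (x z.1 - x z.2) := by
    intro z
    rw [ker_eq, ← integral_const_mul]
    refine integral_congr_ae (Eventually.of_forall fun ξ => ?_)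
    simp only [Φ, map_mul, ← ph_mul_conj, htens]
    ring
  simp only [hin, hout] at hswap
  have hIntg : Integrable (fun ξ => tens m ξ ^ 2 * ‖A ξ‖ ^ 2) := by
    have := hΦ.integral_prod_left
    simp only [hin] at this
    exact this.re
  calc ∫⁻ ξ, ‖(tens m ξ : ℂ) * A ξ‖ₑ ^ 2
      = ∫⁻ ξ, ENNReal.ofReal (tens m ξ ^ 2 * ‖A ξ‖ ^ 2) := by
        refine lintegral_congr fun ξ => ?_
        rw [← ofReal_norm, ← ENNReal.ofReal_pow (norm_nonneg _), norm_mul, mul_pow,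
          Complex.norm_real, Real.norm_eq_abs, sq_abs]
    _ = ‖∫ z : ℝ × ℝ, h z.1 * starRingEnd ℂ (h z.2) *
          ker ε (fun k r => m k r ^ 2) (T z.1 - T z.2) (x z.1 - x z.2)‖ₑ := by
        rw [lintegral_ofReal_eq_enorm_integral hIntg (fun ξ => by positivity), hswap]
    _ ≤ ∫⁻ z : ℝ × ℝ, ‖h z.1 * starRingEnd ℂ (h z.2) *
          ker ε (fun k r => m k r ^ 2) (T z.1 - T z.2) (x z.1 - x z.2)‖ₑ :=
        enorm_integral_le_lintegral_enorm _
    _ ≤ ∫⁻ z : ℝ × ℝ, C.toNNReal * (‖h z.1‖ₑ * ‖h z.2‖ₑ * wt n (z.1 - z.2)) := by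
        refine lintegral_mono fun z => ?_
        have h1 : ‖ker ε (fun k r => m k r ^ 2) (T z.1 - T z.2) (x z.1 - x z.2)‖ₑ ≤
            C.toNNReal * wt n (z.1 - z.2) := by
          rw [← ofReal_norm, wt, ← ENNReal.ofReal, ← ENNReal.ofReal_mul hC]
          refine ENNReal.ofReal_le_ofReal ((hK _ _).trans ?_)
          refine mul_le_mul_of_nonneg_left ?_ hC
          exact Real.rpow_le_rpow_of_nonpos (by positivity) (by linarith [hd z.1 z.2])
            (by linarith [(Nat.cast_nonneg n : (0 : ℝ) ≤ n)])
        rw [enorm_mul, enorm_mul, RCLike.enorm_conj]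
        calc _ ≤ ‖h z.1‖ₑ * ‖h z.2‖ₑ * (C.toNNReal * wt n (z.1 - z.2)) := by gcongr
          _ = _ := by ring
    _ = _ := lintegral_const_mul' _ _ ENNReal.coe_ne_top

/-- Plancherel's identity for functions in `L¹ ∩ L²`. -/
lemma lintegral_enorm_fourier_sq {E : Type*} [NormedAddCommGroup E] [InnerProductSpace ℝ E]
    [FiniteDimensional ℝ E] [MeasurableSpace E] [BorelSpace E] {f : E → ℂ} (hf : Integrable f)
    (hf2 : MemLp f 2) : ∫⁻ ξ, ‖𝓕 f ξ‖ₑ ^ 2 = ∫⁻ x, ‖f x‖ₑ ^ 2 := by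
  set u : Lp ℂ 2 (volume : Measure E) := hf2.toLp f with hu
  have hcont : Continuous (𝓕 f) := by
    exact VectorFourier.fourierIntegral_continuous Real.continuous_fourierChar
      (by exact continuous_inner) hf
  have hae : ∀ᵐ ξ, 𝓕 f ξ = (𝓕 u : Lp ℂ 2 (volume : Measure E)) ξ := by
    refine ae_eq_of_integral_contDiff_smul_eq hcont.locallyIntegrable
      ((Lp.memLp _).locallyIntegrable (by norm_num)) fun g hg hgc => ?_
    set φ : SchwartzMap E ℂ := HasCompactSupport.toSchwartzMap (f := fun x => (g x : ℂ))
      (hgc.comp_left (g := fun r : ℝ => (r : ℂ)) (by simp))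
      (Complex.ofRealCLM.contDiff.comp hg) with hφ
    have hφa : ∀ x, φ x = (g x : ℂ) := fun x => rfl
    have h1 := congrArg (fun T => T φ) (Lp.fourier_toTemperedDistribution_eq u)
    simp only [TemperedDistribution.fourier_apply, Lp.toTemperedDistribution_apply] at h1
    have h2 : ∫ x, 𝓕 φ x • f x = ∫ x, φ x • 𝓕 f x := by
      have := VectorFourier.integral_fourierIntegral_smul_eq_flip (μ := volume) (ν := volume)
        (L := innerₗ E) Real.continuous_fourierChar (by exact continuous_inner)
        φ.integrable hf
      rw [flip_innerₗ] at this
      exact this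
    have h3 : ∫ x, 𝓕 φ x • u x = ∫ x, 𝓕 φ x • f x :=
      integral_congr_ae (by filter_upwards [hf2.coeFn_toLp] with x hx; rw [hu, hx])
    rw [← h3, h1] at h2
    simpa [hφa] using h2.symm
  have h := Lp.norm_fourier_eq u
  have h' : eLpNorm (𝓕 f) 2 volume = eLpNorm f 2 volume := by
    rw [eLpNorm_congr_ae hae, ← eLpNorm_congr_ae hf2.coeFn_toLp, ← Lp.enorm_def, ← Lp.enorm_def,
      ← ofReal_norm, ← ofReal_norm, h]
  have e : ∀ v : E → ℂ, eLpNorm v 2 volume ^ 2 = ∫⁻ x, ‖v x‖ₑ ^ 2 := by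
    intro v
    rw [eLpNorm_eq_lintegral_rpow_enorm_toReal (by norm_num) (by norm_num), ← ENNReal.rpow_natCast,
      ← ENNReal.rpow_mul]
    norm_num
  rw [← e, ← e, h']

/-- Orthogonal coordinates `(r, v) ↦ r e + v`. -/
def slab {n : ℕ} (e : Eucl n) (z : ℝ × hyperplane e) : Eucl n := z.1 • e + z.2

lemma inner_hyperplane {n : ℕ} {e : Eucl n} (v : hyperplane e) : inner ℝ e (v : Eucl n) = 0 :=
  Submodule.mem_orthogonal_singleton_iff_inner_right.1 v.2

lemma continuous_slab {n : ℕ} (e : Eucl n) : Continuous (slab e) := by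
  unfold slab; fun_prop

lemma measurePreserving_slab {n : ℕ} {e : Eucl n} (he : ‖e‖ = 1) :
    MeasurePreserving (slab e) := by
  let L : WithLp 2 (ℝ × hyperplane e) ≃ₗᵢ[ℝ] Eucl n :=
    (LinearIsometryEquiv.withLpProdCongr 2 (LinearIsometryEquiv.toSpanUnitSingleton (𝕜 := ℝ) e he)
      (LinearIsometryEquiv.refl ℝ _)).trans (Submodule.orthogonalDecomposition (ℝ ∙ e)).symm
  have h := L.measurePreserving.comp (WithLp.volume_preserving_toLp ℝ (hyperplane e))
  exact h

/-- The inverse of `slab e`. -/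
def unslab {n : ℕ} (e y : Eucl n) : ℝ × hyperplane e :=
  (inner ℝ e y, (hyperplane e).orthogonalProjectionOnto y)

lemma unslab_slab {n : ℕ} {e : Eucl n} (he : ‖e‖ = 1) (z : ℝ × hyperplane e) :
    unslab e (slab e z) = z := by
  unfold unslab slab
  ext1
  · simp [inner_add_right, inner_smul_right, inner_hyperplane, he]
  · have : (hyperplane e).orthogonalProjectionOnto e = 0 := by
      rw [Submodule.orthogonalProjectionOnto_eq_zero_iff]
      exact Submodule.le_orthogonal_orthogonal _ (Submodule.mem_span_singleton_self e)
    simp [this]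

lemma coord_eq_inner {n : ℕ} (i : Fin n) (x : Eucl n) :
    inner ℝ (EuclideanSpace.single i (1 : ℝ)) x = x i := by
  simp [EuclideanSpace.inner_single_left]

lemma quadSym_slab {n : ℕ} (ε : Fin n → ℝ) (i : Fin n) {e : Eucl n}
    (he : e = EuclideanSpace.single i (1 : ℝ)) (z : ℝ × hyperplane e) :
    quadSym ε (slab e z) = ε i * z.1 ^ 2 + quadSym ε z.2 := by
  subst he
  have h0 : (z.2 : Eucl n) i = 0 := by rw [← coord_eq_inner, inner_hyperplane]
  unfold quadSym slab
  have e : ∀ k, ε k * ((z.1 • EuclideanSpace.single i (1 : ℝ) + (z.2 : Eucl n)) k) ^ 2 =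
      (if k = i then ε i * z.1 ^ 2 else 0) + ε k * (z.2 : Eucl n) k ^ 2 := by
    intro k
    by_cases hk : k = i
    · subst hk; simp [h0]
    · simp [hk]
  simp only [e, Finset.sum_add_distrib, Finset.sum_ite_eq', Finset.mem_univ, if_true]

/-- Change of variables for the map `ω ↦ a - b ω²`, on a half-line away from its critical point. -/
lemma lintegral_halfLine_comp_quadratic_le {s c : ℝ} (hs : s = 1 ∨ s = -1) (hc : 0 < c) {b : ℝ}
    (hb : |b| = 1 / (2 * Real.pi)) (a : ℝ) (g : ℝ → ℝ≥0∞) :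
    ∫⁻ ω in {ω | c ≤ s * ω}, g (a - b * ω ^ 2) ≤ ENNReal.ofReal (Real.pi / c) * ∫⁻ τ, g τ := by
  have hS : MeasurableSet {ω : ℝ | c ≤ s * ω} := measurableSet_le (by fun_prop) (by fun_prop)
  have hb0 : b ≠ 0 := by
    rintro rfl
    have : (0 : ℝ) < 1 / (2 * Real.pi) := by positivity
    simp at hb
  have hder : ∀ ω ∈ {ω : ℝ | c ≤ s * ω}, HasDerivWithinAt (fun ω => a - b * ω ^ 2)
      (-(2 * b * ω)) {ω : ℝ | c ≤ s * ω} ω := by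
    intro ω _
    have := (((hasDerivAt_pow 2 ω).const_mul b).const_sub a).hasDerivWithinAt
      (s := {ω : ℝ | c ≤ s * ω})
    exact this.congr_deriv (by push_cast; ring)
  have hinj : Set.InjOn (fun ω => a - b * ω ^ 2) {ω : ℝ | c ≤ s * ω} := by
    intro x hx y hy hxy
    replace hx : c ≤ s * x := hx
    replace hy : c ≤ s * y := hy
    have h1 : x ^ 2 = y ^ 2 := by
      have : b * x ^ 2 = b * y ^ 2 := by simpa using hxy
      exact mul_left_cancel₀ hb0 this
    rcases sq_eq_sq_iff_eq_or_eq_neg.1 h1 with h | h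
    · exact h
    · exfalso; rw [h] at hx; nlinarith
  have key := lintegral_image_eq_lintegral_abs_deriv_mul hS hder hinj g
  calc ∫⁻ ω in {ω | c ≤ s * ω}, g (a - b * ω ^ 2)
      ≤ ∫⁻ ω in {ω | c ≤ s * ω}, ENNReal.ofReal (Real.pi / c) *
          (ENNReal.ofReal |-(2 * b * ω)| * g (a - b * ω ^ 2)) := by
        refine setLIntegral_mono' hS fun ω hω => ?_
        rw [← mul_assoc, ← ENNReal.ofReal_mul (by positivity)]
        refine le_mul_of_one_le_left (by simp) ?_
        rw [ENNReal.one_le_ofReal, abs_neg, abs_mul, abs_mul, hb]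
        have : c ≤ |ω| := by
          replace hω : c ≤ s * ω := hω
          rcases hs with rfl | rfl
          · exact (by linarith : c ≤ ω).trans (le_abs_self _)
          · exact (by linarith : c ≤ -ω).trans (neg_le_abs _)
        rw [abs_of_pos (by norm_num : (0 : ℝ) < 2)]
        have hpi := Real.pi_pos
        rw [show Real.pi / c * (2 * (1 / (2 * Real.pi)) * |ω|) = |ω| / c by field_simp]
        rwa [one_le_div hc]
    _ = ENNReal.ofReal (Real.pi / c) * ∫⁻ τ in (fun ω => a - b * ω ^ 2) '' {ω : ℝ | c ≤ s * ω},
          g τ := by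
        rw [key, lintegral_const_mul' _ _ ENNReal.ofReal_ne_top]
    _ ≤ _ := by gcongr; exact Measure.restrict_le_self

/-- Dual form of the local smoothing estimate in the direction of a coordinate axis. -/
lemma lintegral_dual_smoothing_le {n : ℕ} (ε : Fin n → ℝ) (hε : ∀ i, ε i = 1 ∨ ε i = -1)
    (i : Fin n) {e : Eucl n} (he : e = EuclideanSpace.single i (1 : ℝ)) {s c : ℝ}
    (hs : s = 1 ∨ s = -1) (hc : 0 < c) (r : ℝ) (f : ℝ × hyperplane e → ℂ) (hf : Integrable f)
    (hf2 : MemLp f 2) :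
    ∫⁻ ξ in {ξ : Eucl n | c ≤ s * ξ i},
      ‖∫ z, f z * starRingEnd ℂ (ph ε z.1 (slab e (r, z.2)) ξ)‖ₑ ^ 2 ≤
        ENNReal.ofReal (Real.pi / c) * ∫⁻ z, ‖f z‖ₑ ^ 2 := by
  have he1 : ‖e‖ = 1 := by simp [he]
  have hΘ := measurePreserving_slab he1
  set F : Eucl n → ℂ := fun y => f (unslab e y) with hF
  have hFΘ : F ∘ slab e = f := by ext1 z; simp [hF, unslab_slab he1]
  have hemb : MeasurableEmbedding (slab e) :=
    (continuous_slab e).measurableEmbedding (Function.LeftInverse.injective (unslab_slab he1))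
  have hFi : Integrable F := (hΘ.integrable_comp_emb hemb).1 (by rw [hFΘ]; exact hf)
  have hF2 : MemLp F 2 := by
    rw [← hΘ.map_eq, hemb.memLp_map_measure_iff, hFΘ]; exact hf2
  have hB : ∀ ω v, ‖∫ z, f z * starRingEnd ℂ (ph ε z.1 (slab e (r, z.2)) (slab e (ω, v)))‖ₑ =
      ‖𝓕 F (slab e (-(quadSym ε v / (2 * Real.pi)) - ε i / (2 * Real.pi) * ω ^ 2, v))‖ₑ := by
    intro ω v
    have h1 : 𝓕 F (slab e (-(quadSym ε v / (2 * Real.pi)) - ε i / (2 * Real.pi) * ω ^ 2, v)) =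
        cexp (I * ((2 * Real.pi * (r * ω) : ℝ) : ℂ)) *
        ∫ z, f z * starRingEnd ℂ (ph ε z.1 (slab e (r, z.2)) (slab e (ω, v))) := by
      rw [Real.fourier_eq', ← hΘ.integral_comp hemb, ← integral_const_mul]
      refine integral_congr_ae (Eventually.of_forall fun z => ?_)
      have h2 : F (slab e z) = f z := congrFun hFΘ z
      have hee : inner ℝ e e = (1 : ℝ) := by rw [real_inner_self_eq_norm_sq, he1]; norm_num
      have hve : ∀ v : hyperplane e, inner ℝ (v : Eucl n) e = 0 := fun v => by
        rw [real_inner_comm, inner_hyperplane]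
      simp only [h2, smul_eq_mul]
      rw [mul_comm (f z), ← mul_assoc]
      congr 1
      rw [ph, ← Complex.exp_conj, ← Complex.exp_add, map_mul, conj_I, conj_ofReal,
        quadSym_slab ε i he]
      congr 1
      simp only [slab, inner_add_left, inner_add_right, inner_smul_left, inner_smul_right,
        inner_hyperplane, hve, hee]
      have hpi : (Real.pi : ℂ) ≠ 0 := by exact_mod_cast Real.pi_ne_zero
      push_cast
      simp only [conj_trivial]
      field_simp
      ring
    rw [h1, enorm_mul, ← ofReal_norm (cexp _), norm_cexp_I_mul_ofReal]
    simp
  have hb : |ε i / (2 * Real.pi)| = 1 / (2 * Real.pi) := by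
    rw [abs_div, abs_of_pos Real.two_pi_pos]
    rcases hε i with h | h <;> rw [h] <;> norm_num
  have hcontF : Continuous (𝓕 F) :=
    VectorFourier.fourierIntegral_continuous Real.continuous_fourierChar
      (by exact continuous_inner) hFi
  have hS : MeasurableSet {ξ : Eucl n | c ≤ s * ξ i} :=
    measurableSet_le (by fun_prop) (by fun_prop)
  have hcoord : ∀ ω v, (slab e (ω, v)) i = ω := by
    intro ω v
    have h0 : (v : Eucl n) i = 0 := by rw [← coord_eq_inner, ← he, inner_hyperplane]
    have h1 : e i = 1 := by simp [he]
    simp [slab, h0, h1]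
  have hmeasB : Measurable fun z : ℝ × hyperplane e =>
      ‖𝓕 F (slab e (-(quadSym ε z.2 / (2 * Real.pi)) - ε i / (2 * Real.pi) * z.1 ^ 2, z.2))‖ₑ ^ 2 := by
    have h3 := continuous_slab e
    have h4 := continuous_quadSym ε
    refine Measurable.pow_const (Measurable.enorm (Continuous.measurable ?_)) _
    fun_prop
  have hpre : MeasurableSet {z : ℝ × hyperplane e | c ≤ s * z.1} :=
    measurableSet_le (by fun_prop) (by fun_prop)
  calc ∫⁻ ξ in {ξ : Eucl n | c ≤ s * ξ i},
        ‖∫ z, f z * starRingEnd ℂ (ph ε z.1 (slab e (r, z.2)) ξ)‖ₑ ^ 2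
      = ∫⁻ z : ℝ × hyperplane e in {z | c ≤ s * z.1},
        ‖𝓕 F (slab e (-(quadSym ε z.2 / (2 * Real.pi)) - ε i / (2 * Real.pi) * z.1 ^ 2,
          z.2))‖ₑ ^ 2 := by
        rw [← hΘ.setLIntegral_comp_preimage_emb hemb]
        have : slab e ⁻¹' {ξ : Eucl n | c ≤ s * ξ i} = {z | c ≤ s * z.1} := by
          ext z; simp [hcoord z.1 z.2]
        rw [this]
        refine lintegral_congr fun z => ?_
        rw [← hB]
    _ = ∫⁻ v : hyperplane e, ∫⁻ ω in {ω | c ≤ s * ω}, ‖𝓕 F (slab e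
          (-(quadSym ε v / (2 * Real.pi)) - ε i / (2 * Real.pi) * ω ^ 2, v))‖ₑ ^ 2 := by
        rw [show {z : ℝ × hyperplane e | c ≤ s * z.1} = {ω | c ≤ s * ω} ×ˢ Set.univ by
          ext z; simp, Measure.volume_eq_prod, ← Measure.prod_restrict, Measure.restrict_univ,
          lintegral_prod_symm _ hmeasB.aemeasurable]
    _ ≤ ∫⁻ v : hyperplane e, ENNReal.ofReal (Real.pi / c) * ∫⁻ τ, ‖𝓕 F (slab e (τ, v))‖ₑ ^ 2 := by
        refine lintegral_mono fun v => ?_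
        exact lintegral_halfLine_comp_quadratic_le hs hc hb _ (fun τ => ‖𝓕 F (slab e (τ, v))‖ₑ ^ 2)
    _ = ENNReal.ofReal (Real.pi / c) * ∫⁻ z, ‖𝓕 F (slab e z)‖ₑ ^ 2 := by
        rw [lintegral_const_mul' _ _ ENNReal.ofReal_ne_top, Measure.volume_eq_prod,
          lintegral_prod_symm]
        have h3 := continuous_slab e
        exact (Measurable.pow_const (Measurable.enorm (Continuous.measurable
          (hcontF.comp h3))) _).aemeasurable
    _ = ENNReal.ofReal (Real.pi / c) * ∫⁻ ξ, ‖𝓕 F ξ‖ₑ ^ 2 := by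
        rw [hΘ.lintegral_comp_emb hemb (fun ξ => ‖𝓕 F ξ‖ₑ ^ 2)]
    _ = _ := by
        rw [lintegral_enorm_fourier_sq hFi hF2, ← hΘ.lintegral_comp_emb hemb (fun ξ => ‖F ξ‖ₑ ^ 2)]
        congr 1
        exact lintegral_congr fun z => by rw [← congrFun hFΘ z, Function.comp]

/-- The dual norm `‖h‖_{L^{p'}}`. -/
def dnorm (p : ℝ) (h : ℝ → ℂ) : ℝ≥0∞ := (∫⁻ r, ‖h r‖ₑ ^ (p / (p - 1))) ^ (1 - 1 / p)

lemma dnorm_mono {p : ℝ} (hp : 1 < p) {h h' : ℝ → ℂ} (hle : ∀ r, ‖h r‖ₑ ≤ ‖h' r‖ₑ) :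
    dnorm p h ≤ dnorm p h' := by
  have h1 : 0 ≤ p / (p - 1) := div_nonneg (by linarith) (by linarith)
  have h2 : 0 ≤ 1 - 1 / p := by
    rw [sub_nonneg, div_le_one (by linarith)]; linarith
  unfold dnorm
  gcongr with r
  exact hle r

/-- The coordinates of a linearized maximal function: times and positions along a curve whose
parameter is dominated by the distance. -/
structure IsCurve {n : ℕ} (T : ℝ → ℝ) (x : ℝ → Eucl n) : Prop where
  measT : Measurable T
  measx : Measurable x
  sep : ∀ ρ ρ', |ρ - ρ'| ≤ ‖x ρ - x ρ'‖

lemma lintegral_mul_le_sqrt {α : Type*} [MeasurableSpace α] {μ : Measure α} {f g : α → ℝ≥0∞}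
    (hf : AEMeasurable f μ) (hg : AEMeasurable g μ) :
    ∫⁻ a, f a * g a ∂μ ≤ (∫⁻ a, f a ^ 2 ∂μ) ^ (1 / 2 : ℝ) * (∫⁻ a, g a ^ 2 ∂μ) ^ (1 / 2 : ℝ) := by
  have := ENNReal.lintegral_mul_le_Lp_mul_Lq μ Real.HolderConjugate.two_two hf hg
  simpa using this

lemma rpow_half_le_of_le_sq {a b : ℝ≥0∞} (h : a ≤ b ^ 2) : a ^ (1 / 2 : ℝ) ≤ b := by
  calc a ^ (1 / 2 : ℝ) ≤ (b ^ 2) ^ (1 / 2 : ℝ) := by gcongr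
    _ = b := by rw [← ENNReal.rpow_natCast, ← ENNReal.rpow_mul]; norm_num

/-- The non-retarded part of the linearized bilinear estimate on a hyperplane slice. -/
lemma exists_enorm_integral_ker_slice_le {n : ℕ} (hn : 2 ≤ n) {p : ℝ} (hp : 3 ≤ n → 2 ≤ p)
    (hp2 : n = 2 → 3 ≤ p) (ε : Fin n → ℝ) (hε : ∀ i, ε i = 1 ∨ ε i = -1)
    (m : Fin n → ℝ → ℝ) (hm : ∀ k, Smooth (m k)) (hc : ∀ k, HasCompactSupport (m k))
    (i : Fin n) {e : Eucl n} (he : e = EuclideanSpace.single i (1 : ℝ)) {s c : ℝ}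
    (hs : s = 1 ∨ s = -1) (hc0 : 0 < c) (hsupp : ∀ ξ ∈ tsupport (m i), c ≤ s * ξ) :
    ∃ C : ℝ≥0, ∀ (h : ℝ → ℂ) (T : ℝ → ℝ) (x : ℝ → Eucl n), Measurable h → Integrable h →
      IsCurve T x → ∀ (r : ℝ) (f : ℝ × hyperplane e → ℂ), Integrable f → MemLp f 2 →
      ‖∫ w : ℝ × (ℝ × hyperplane e), h w.1 * f w.2 *
        ker ε m (T w.1 - w.2.1) (x w.1 - slab e (r, w.2.2))‖ₑ ≤
        C * dnorm p h * (∫⁻ z, ‖f z‖ₑ ^ 2) ^ (1 / 2 : ℝ) := by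
  obtain ⟨C₁, hC₁⟩ := exists_lintegral_tens_sq_le (by omega) ε hε m hm hc
  obtain ⟨C₂, hC₂⟩ := exists_lintegral_wt_le hn hp hp2
  refine ⟨NNReal.sqrt C₁ * C₂ * NNReal.sqrt (Real.pi / c).toNNReal, ?_⟩
  intro h T x hh hhi hTx r f hf hf2
  have hsl := continuous_slab e
  let A : Eucl n → ℂ := fun ξ => ∫ ρ, h ρ * ph ε (T ρ) (x ρ) ξ
  let B : Eucl n → ℂ := fun ξ => ∫ z, f z * starRingEnd ℂ (ph ε z.1 (slab e (r, z.2)) ξ)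
  let Φ : (ℝ × (ℝ × hyperplane e)) × Eucl n → ℂ := fun w => (tens m w.2 : ℂ) *
    ((h w.1.1 * ph ε (T w.1.1) (x w.1.1) w.2) *
      (f w.1.2 * starRingEnd ℂ (ph ε w.1.2.1 (slab e (r, w.1.2.2)) w.2)))
  have hTm := hTx.measT
  have hxm := hTx.measx
  have hΦ : Integrable Φ (volume.prod volume) := by
    have h1 : Integrable (fun w : (ℝ × (ℝ × hyperplane e)) × Eucl n =>
        (h w.1.1 * f w.1.2) * (tens m w.2 : ℂ)) (volume.prod volume) :=
      (hhi.mul_prod hf).mul_prod (integrable_tens hm hc).ofReal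
    refine h1.mono ?_ (Eventually.of_forall fun w => ?_)
    · have ha : AEStronglyMeasurable (fun w : (ℝ × (ℝ × hyperplane e)) × Eucl n =>
          (tens m w.2 : ℂ)) (volume.prod volume) :=
        (integrable_tens hm hc).ofReal.1.comp_snd
      have hb : AEStronglyMeasurable (fun w : (ℝ × (ℝ × hyperplane e)) × Eucl n =>
          h w.1.1) (volume.prod volume) := hhi.1.comp_fst.comp_fst
      have hb' : AEStronglyMeasurable (fun w : (ℝ × (ℝ × hyperplane e)) × Eucl n =>
          f w.1.2) (volume.prod volume) := hf.1.comp_snd.comp_fst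
      have hp : Measurable (fun w : (ℝ × (ℝ × hyperplane e)) × Eucl n =>
          ph ε (T w.1.1) (x w.1.1) w.2) :=
        measurable_ph ε (by fun_prop) (by fun_prop) (by fun_prop)
      have hp' : Measurable (fun w : (ℝ × (ℝ × hyperplane e)) × Eucl n =>
          ph ε w.1.2.1 (slab e (r, w.1.2.2)) w.2) :=
        measurable_ph ε (by fun_prop) (hsl.measurable.comp (by fun_prop)) (by fun_prop)
      exact ha.mul ((hb.mul hp.aestronglyMeasurable).mul (hb'.mul
        (Complex.continuous_conj.comp_aestronglyMeasurable hp'.aestronglyMeasurable)))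
    · simp only [Φ, norm_mul, RCLike.norm_conj, norm_ph, mul_one]
      rw [mul_comm]
  have hin : ∀ w : ℝ × (ℝ × hyperplane e), ∫ ξ, Φ (w, ξ) = h w.1 * f w.2 *
      ker ε m (T w.1 - w.2.1) (x w.1 - slab e (r, w.2.2)) := by
    intro w
    rw [ker_eq, ← integral_const_mul]
    refine integral_congr_ae (Eventually.of_forall fun ξ => ?_)
    simp only [Φ, ← ph_mul_conj]
    ring
  have hout : ∀ ξ, ∫ w, Φ (w, ξ) = (tens m ξ : ℂ) * A ξ * B ξ := by
    intro ξ
    simp only [Φ]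
    rw [integral_const_mul, Measure.volume_eq_prod, integral_prod_mul
      (fun ρ => h ρ * ph ε (T ρ) (x ρ) ξ)
      (fun z => f z * starRingEnd ℂ (ph ε z.1 (slab e (r, z.2)) ξ)), mul_assoc]
  have hswap := integral_integral_swap (f := fun w ξ => Φ (w, ξ)) hΦ
  simp only [hin, hout] at hswap
  have hAm : AEStronglyMeasurable A := by
    have hp : Measurable (fun w : Eucl n × ℝ => h w.2 * ph ε (T w.2) (x w.2) w.1) :=
      (hh.comp measurable_snd).mul (measurable_ph ε (by fun_prop) (by fun_prop) (by fun_prop))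
    exact hp.stronglyMeasurable.integral_prod_right'.aestronglyMeasurable
  have hBm : AEStronglyMeasurable B := by
    have hp' : Measurable (fun w : Eucl n × (ℝ × hyperplane e) =>
        ph ε w.2.1 (slab e (r, w.2.2)) w.1) :=
      measurable_ph ε (by fun_prop) (hsl.measurable.comp (by fun_prop)) (by fun_prop)
    have : AEStronglyMeasurable (fun w : Eucl n × (ℝ × hyperplane e) =>
        f w.2 * starRingEnd ℂ (ph ε w.2.1 (slab e (r, w.2.2)) w.1)) (volume.prod volume) :=
      hf.1.comp_snd.mul
        (Complex.continuous_conj.comp_aestronglyMeasurable hp'.aestronglyMeasurable)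
    exact this.integral_prod_right'
  set S : Set (Eucl n) := {ξ | c ≤ s * ξ i} with hS
  have hSm : MeasurableSet S := measurableSet_le (by fun_prop) (by fun_prop)
  have hzero : ∀ ξ, ξ ∉ S → (tens m ξ : ℂ) = 0 := by
    intro ξ hξ
    have h0 : m i (ξ i) = 0 := by
      by_contra hne
      exact hξ (hsupp _ (subset_tsupport _ hne))
    rw [Complex.ofReal_eq_zero]
    exact Finset.prod_eq_zero (Finset.mem_univ i) h0
  have hA2 := (hC₁ h T x hhi hTm hxm hTx.sep).trans
    (mul_le_mul_right (hC₂ (fun ρ => ‖h ρ‖ₑ) hh.enorm) (C₁ : ℝ≥0∞))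
  have hB2 := lintegral_dual_smoothing_le ε hε i he hs hc0 r f hf hf2
  calc ‖∫ w : ℝ × (ℝ × hyperplane e), h w.1 * f w.2 *
        ker ε m (T w.1 - w.2.1) (x w.1 - slab e (r, w.2.2))‖ₑ
      = ‖∫ ξ, (tens m ξ : ℂ) * A ξ * B ξ‖ₑ := by rw [← hswap]
    _ = ‖∫ ξ in S, (tens m ξ : ℂ) * A ξ * B ξ‖ₑ := by
        rw [setIntegral_eq_integral_of_forall_compl_eq_zero]
        intro ξ hξ
        rw [hzero ξ hξ, zero_mul, zero_mul]
    _ ≤ ∫⁻ ξ in S, ‖(tens m ξ : ℂ) * A ξ‖ₑ * ‖B ξ‖ₑ := by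
        refine (enorm_integral_le_lintegral_enorm _).trans (le_of_eq ?_)
        simp only [enorm_mul]
    _ ≤ (∫⁻ ξ in S, ‖(tens m ξ : ℂ) * A ξ‖ₑ ^ 2) ^ (1 / 2 : ℝ) *
          (∫⁻ ξ in S, ‖B ξ‖ₑ ^ 2) ^ (1 / 2 : ℝ) := by
        refine lintegral_mul_le_sqrt ?_ hBm.enorm.restrict
        exact (AEStronglyMeasurable.mul (integrable_tens hm hc).ofReal.1 hAm).enorm.restrict
    _ ≤ (NNReal.sqrt C₁ * (C₂ * dnorm p h)) *
          (NNReal.sqrt (Real.pi / c).toNNReal * (∫⁻ z, ‖f z‖ₑ ^ 2) ^ (1 / 2 : ℝ)) := by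
        gcongr
        · refine rpow_half_le_of_le_sq ((setLIntegral_le_lintegral _ _).trans (hA2.trans ?_))
          rw [mul_pow (NNReal.sqrt C₁ : ℝ≥0∞), ← ENNReal.coe_pow, NNReal.sq_sqrt]
          exact le_refl _
        · refine rpow_half_le_of_le_sq (hB2.trans ?_)
          rw [mul_pow, ← ENNReal.coe_pow, NNReal.sq_sqrt, ← ENNReal.rpow_natCast,
            ← ENNReal.rpow_mul]
          norm_num
          exact le_refl _
    _ = _ := by push_cast; ring

/-- A rapidly decaying space-time weight. -/
def errKer {n : ℕ} (t : ℝ) (x : Eucl n) : ℝ≥0∞ :=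
  ENNReal.ofReal (((1 + |t| + ‖x‖) ^ (2 * n + 2))⁻¹)

lemma measurable_errKer {n : ℕ} {α : Type*} [MeasurableSpace α] {T : α → ℝ} {x : α → Eucl n}
    (hT : Measurable T) (hx : Measurable x) : Measurable fun a => errKer (T a) (x a) := by
  unfold errKer
  fun_prop

lemma errKer_mul_errKer_le {n : ℕ} {t t' a d : ℝ} {x x' : Eucl n} (hd : |d| ≤ ‖x - x'‖)
    (ha : 0 ≤ a) (hax : a ≤ |t| + ‖x‖) :
    errKer t x * errKer t' x' ≤
      wt n d * ENNReal.ofReal ((1 + a) ^ (-((n : ℝ) + 2))) := by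
  unfold errKer wt
  rw [← ENNReal.ofReal_mul (by positivity), ← ENNReal.ofReal_mul (by positivity)]
  refine ENNReal.ofReal_le_ofReal ?_
  set α := 1 + |t| + ‖x‖ with hα
  set β := 1 + |t'| + ‖x'‖ with hβ
  have h1 : ‖x - x'‖ ≤ ‖x‖ + ‖x'‖ := norm_sub_le _ _
  have hx := norm_nonneg x
  have hx' := norm_nonneg x'
  have ht := abs_nonneg t
  have ht' := abs_nonneg t'
  have hα1 : 1 ≤ α := by linarith
  have hβ1 : 1 ≤ β := by linarith
  have hαβ : 1 + |d| ≤ α * β := by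
    nlinarith [mul_nonneg (sub_nonneg.2 hα1) (sub_nonneg.2 hβ1)]
  have hd0 := abs_nonneg d
  have e1 : ((1 + |d|) ^ n)⁻¹ ≤ (1 + |d|) ^ (-((n : ℝ) / 2)) := by
    rw [← Real.rpow_natCast, ← Real.rpow_neg (by positivity)]
    refine Real.rpow_le_rpow_of_exponent_le (by linarith) ?_
    have : (0 : ℝ) ≤ n := by positivity
    linarith
  have e2 : (1 + a) ^ (-((n : ℝ) + 2)) = ((1 + a) ^ (n + 2))⁻¹ := by
    rw [Real.rpow_neg (by positivity), ← Real.rpow_natCast]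
    push_cast
    rfl
  rw [e2]
  refine le_trans ?_ (mul_le_mul_of_nonneg_right e1 (by positivity))
  rw [← mul_inv, ← mul_inv]
  refine inv_anti₀ (by positivity) ?_
  calc (1 + |d|) ^ n * (1 + a) ^ (n + 2) ≤ (α * β) ^ n * α ^ (n + 2) := by
        gcongr
        linarith
    _ = α ^ (2 * n + 2) * β ^ n := by
        rw [mul_pow, show 2 * n + 2 = n + (n + 2) by omega, pow_add α n (n + 2), mul_right_comm]
    _ ≤ α ^ (2 * n + 2) * β ^ (2 * n + 2) := by
        gcongr
        omega

lemma isAddHaarMeasure_slab {n : ℕ} (e : Eucl n) :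
    (volume : Measure (ℝ × hyperplane e)).IsAddHaarMeasure := by
  rw [Measure.volume_eq_prod]
  infer_instance

lemma exists_lintegral_errKer_mul_le {n : ℕ} {e : Eucl n} (he : ‖e‖ = 1) :
    ∃ C : ℝ≥0, ∀ (t t' d r : ℝ) (x x' : Eucl n), |d| ≤ ‖x - x'‖ →
      ∫⁻ z : ℝ × hyperplane e, errKer (t - z.1) (x - slab e (r, z.2)) *
        errKer (t' - z.1) (x' - slab e (r, z.2)) ≤ C * wt n d := by
  have := isAddHaarMeasure_slab e
  have hfin : ∫⁻ z : ℝ × hyperplane e, ENNReal.ofReal ((1 + ‖z‖) ^ (-((n : ℝ) + 2))) < ∞ := by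
    refine finite_integral_one_add_norm ?_
    have h1 : Module.finrank ℝ (hyperplane e) ≤ n := by
      have := Submodule.finrank_le (hyperplane e)
      simpa using this
    have h2 : Module.finrank ℝ (ℝ × hyperplane e) ≤ n + 1 := by
      rw [Module.finrank_prod, Module.finrank_self]
      omega
    have h3 : (Module.finrank ℝ (ℝ × hyperplane e) : ℝ) ≤ n + 1 := by exact_mod_cast h2
    linarith
  refine ⟨(∫⁻ z : ℝ × hyperplane e, ENNReal.ofReal ((1 + ‖z‖) ^ (-((n : ℝ) + 2)))).toNNReal, ?_⟩
  intro t t' d r x x' hd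
  rw [ENNReal.coe_toNNReal hfin.ne]
  set z₀ : ℝ × hyperplane e := (t, (unslab e x).2) with hz₀
  calc ∫⁻ z : ℝ × hyperplane e, errKer (t - z.1) (x - slab e (r, z.2)) *
        errKer (t' - z.1) (x' - slab e (r, z.2))
      ≤ ∫⁻ z : ℝ × hyperplane e, wt n d *
          ENNReal.ofReal ((1 + ‖z - z₀‖) ^ (-((n : ℝ) + 2))) := by
        refine lintegral_mono fun z => errKer_mul_errKer_le ?_ (norm_nonneg _) ?_
        · simpa using hd
        · have hv : ‖z.2 - (unslab e x).2‖ ≤ ‖x - slab e (r, z.2)‖ := by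
            have h1 : (unslab e (slab e (r, z.2))).2 = z.2 := by rw [unslab_slab he]
            rw [norm_sub_rev, ← h1, h1]
            calc ‖(unslab e x).2 - z.2‖
                = ‖(hyperplane e).orthogonalProjectionOnto (x - slab e (r, z.2))‖ := by
                  rw [map_sub]
                  congr 2
                  exact h1.symm
              _ ≤ _ := Submodule.norm_orthogonalProjectionOnto_apply_le _ _
          rw [Prod.norm_def, max_le_iff]
          refine ⟨?_, ?_⟩
          · simp only [hz₀, Prod.fst_sub, Real.norm_eq_abs, abs_sub_comm z.1]
            linarith [norm_nonneg (x - slab e (r, z.2))]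
          · exact hv.trans (by linarith [abs_nonneg (t - z.1)])
    _ = wt n d * ∫⁻ z : ℝ × hyperplane e,
          ENNReal.ofReal ((1 + ‖z - z₀‖) ^ (-((n : ℝ) + 2))) := by
        rw [lintegral_const_mul']
        exact ENNReal.ofReal_ne_top
    _ = _ := by
        rw [lintegral_sub_right_eq_self
          (fun z : ℝ × hyperplane e => ENNReal.ofReal ((1 + ‖z‖) ^ (-((n : ℝ) + 2)))) z₀, mul_comm]

/-- The rapidly decaying part of the linearized bilinear estimate on a hyperplane slice. -/
lemma exists_lintegral_errKer_slice_le {n : ℕ} (hn : 2 ≤ n) {p : ℝ} (hp : 3 ≤ n → 2 ≤ p)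
    (hp2 : n = 2 → 3 ≤ p) {e : Eucl n} (he : ‖e‖ = 1) :
    ∃ C : ℝ≥0, ∀ (h : ℝ → ℂ) (T : ℝ → ℝ) (x : ℝ → Eucl n), Measurable h →
      IsCurve T x → ∀ (r : ℝ) (f : ℝ × hyperplane e → ℂ), AEStronglyMeasurable f →
      ∫⁻ w : ℝ × (ℝ × hyperplane e), ‖h w.1‖ₑ * ‖f w.2‖ₑ *
        errKer (T w.1 - w.2.1) (x w.1 - slab e (r, w.2.2)) ≤
        C * dnorm p h * (∫⁻ z, ‖f z‖ₑ ^ 2) ^ (1 / 2 : ℝ) := by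
  obtain ⟨C₁, hC₁⟩ := exists_lintegral_errKer_mul_le he
  obtain ⟨C₂, hC₂⟩ := exists_lintegral_wt_le hn hp hp2
  refine ⟨NNReal.sqrt C₁ * C₂, fun h T x hh hTx r f hf => ?_⟩
  have hsl := continuous_slab e
  have hTm := hTx.measT
  have hxm := hTx.measx
  set E : ℝ → ℝ × hyperplane e → ℝ≥0∞ :=
    fun ρ z => errKer (T ρ - z.1) (x ρ - slab e (r, z.2)) with hE
  have hEm : Measurable (fun w : ℝ × (ℝ × hyperplane e) => E w.1 w.2) :=
    measurable_errKer (by fun_prop)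
      ((hxm.comp measurable_fst).sub (hsl.measurable.comp (by fun_prop)))
  have hgm : Measurable (fun w : ℝ × (ℝ × hyperplane e) => ‖h w.1‖ₑ * E w.1 w.2) :=
    (hh.enorm.comp measurable_fst).mul hEm
  have hGm : Measurable (fun z => ∫⁻ ρ, ‖h ρ‖ₑ * E ρ z) := hgm.lintegral_prod_left'
  have hsq : ∫⁻ z, (∫⁻ ρ, ‖h ρ‖ₑ * E ρ z) ^ 2 ≤ C₁ * (C₂ * dnorm p h) ^ 2 := by
    calc ∫⁻ z, (∫⁻ ρ, ‖h ρ‖ₑ * E ρ z) ^ 2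
        = ∫⁻ z, ∫⁻ ρ : ℝ × ℝ, (‖h ρ.1‖ₑ * E ρ.1 z) * (‖h ρ.2‖ₑ * E ρ.2 z) := by
          refine lintegral_congr fun z => ?_
          have : Measurable (fun ρ => ‖h ρ‖ₑ * E ρ z) :=
            hgm.comp (measurable_id.prodMk measurable_const)
          rw [Measure.volume_eq_prod, lintegral_prod_mul this.aemeasurable this.aemeasurable, sq]
      _ = ∫⁻ ρ : ℝ × ℝ, ∫⁻ z, (‖h ρ.1‖ₑ * E ρ.1 z) * (‖h ρ.2‖ₑ * E ρ.2 z) := by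
          rw [lintegral_lintegral_swap]
          refine Measurable.aemeasurable ?_
          have h1 : Measurable (fun w : (ℝ × hyperplane e) × (ℝ × ℝ) =>
              ‖h w.2.1‖ₑ * E w.2.1 w.1) :=
            hgm.comp ((by fun_prop : Measurable (fun w : (ℝ × hyperplane e) × (ℝ × ℝ) =>
              (w.2.1, w.1))))
          have h2 : Measurable (fun w : (ℝ × hyperplane e) × (ℝ × ℝ) =>
              ‖h w.2.2‖ₑ * E w.2.2 w.1) :=
            hgm.comp ((by fun_prop : Measurable (fun w : (ℝ × hyperplane e) × (ℝ × ℝ) =>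
              (w.2.2, w.1))))
          exact h1.mul h2
      _ ≤ ∫⁻ ρ : ℝ × ℝ, C₁ * (‖h ρ.1‖ₑ * ‖h ρ.2‖ₑ * wt n (ρ.1 - ρ.2)) := by
          refine lintegral_mono fun ρ => ?_
          calc ∫⁻ z, (‖h ρ.1‖ₑ * E ρ.1 z) * (‖h ρ.2‖ₑ * E ρ.2 z)
              = ∫⁻ z, ‖h ρ.1‖ₑ * ‖h ρ.2‖ₑ * (E ρ.1 z * E ρ.2 z) := by
                exact lintegral_congr fun z => mul_mul_mul_comm _ _ _ _
            _ = ‖h ρ.1‖ₑ * ‖h ρ.2‖ₑ * ∫⁻ z, E ρ.1 z * E ρ.2 z := by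
                rw [lintegral_const_mul']
                exact ENNReal.mul_ne_top enorm_ne_top enorm_ne_top
            _ ≤ ‖h ρ.1‖ₑ * ‖h ρ.2‖ₑ * (C₁ * wt n (ρ.1 - ρ.2)) := by
                gcongr
                exact hC₁ _ _ _ _ _ _ (hTx.sep _ _)
            _ = _ := mul_left_comm _ _ _
      _ = C₁ * ∫⁻ ρ : ℝ × ℝ, ‖h ρ.1‖ₑ * ‖h ρ.2‖ₑ * wt n (ρ.1 - ρ.2) :=
          lintegral_const_mul' _ _ ENNReal.coe_ne_top
      _ ≤ C₁ * (C₂ * dnorm p h) ^ 2 := by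
          gcongr
          exact hC₂ (fun ρ => ‖h ρ‖ₑ) hh.enorm
  calc ∫⁻ w : ℝ × (ℝ × hyperplane e), ‖h w.1‖ₑ * ‖f w.2‖ₑ * E w.1 w.2
      = ∫⁻ z, ∫⁻ ρ, ‖h ρ‖ₑ * ‖f z‖ₑ * E ρ z := by
        rw [Measure.volume_eq_prod, lintegral_prod_symm]
        exact ((hh.enorm.comp measurable_fst).aemeasurable.mul hf.comp_snd.enorm).mul
          hEm.aemeasurable
    _ = ∫⁻ z, (∫⁻ ρ, ‖h ρ‖ₑ * E ρ z) * ‖f z‖ₑ := by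
        refine lintegral_congr fun z => ?_
        rw [← lintegral_mul_const' _ _ enorm_ne_top]
        exact lintegral_congr fun ρ => mul_right_comm _ _ _
    _ ≤ (∫⁻ z, (∫⁻ ρ, ‖h ρ‖ₑ * E ρ z) ^ 2) ^ (1 / 2 : ℝ) * (∫⁻ z, ‖f z‖ₑ ^ 2) ^ (1 / 2 : ℝ) :=
        lintegral_mul_le_sqrt hGm.aemeasurable hf.enorm
    _ ≤ (NNReal.sqrt C₁ * (C₂ * dnorm p h)) * (∫⁻ z, ‖f z‖ₑ ^ 2) ^ (1 / 2 : ℝ) := by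
        gcongr
        refine rpow_half_le_of_le_sq (hsq.trans ?_)
        rw [mul_pow (NNReal.sqrt C₁ : ℝ≥0∞), ← ENNReal.coe_pow, NNReal.sq_sqrt]
    _ = _ := by simp only [ENNReal.coe_mul, mul_assoc]

/-- The signed indicator for which `∫_0^t g = ∫ ret t s * g s`. -/
def ret (t s : ℝ) : ℝ := (if 0 < s ∧ s ≤ t then 1 else 0) - (if t < s ∧ s ≤ 0 then 1 else 0)

lemma measurable_ret {α : Type*} [MeasurableSpace α] {T S : α → ℝ}
    (hT : Measurable T) (hS : Measurable S) : Measurable fun a => ret (T a) (S a) := by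
  unfold ret
  refine Measurable.sub (Measurable.ite ?_ measurable_const measurable_const)
    (Measurable.ite ?_ measurable_const measurable_const)
  · exact (measurableSet_lt measurable_const hS).inter (measurableSet_le hS hT)
  · exact (measurableSet_lt hT hS).inter (measurableSet_le hS measurable_const)

lemma abs_ret_le (t s : ℝ) : |ret t s| ≤ 1 := by
  unfold ret
  split_ifs with h1 h2 <;> norm_num

lemma ret_eq (t s : ℝ) :
    (ret t s : ℂ) = (if s ≤ t then 1 else 0) - (if 0 < s then 0 else 1) := by
  unfold ret
  by_cases h2 : 0 < s <;> by_cases h3 : s ≤ t <;> simp [h2, h3, not_le.1, not_lt.1]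

lemma continuous_ker {n : ℕ} (ε : Fin n → ℝ) {m : Fin n → ℝ → ℝ} (hm : ∀ k, Smooth (m k))
    (hc : ∀ k, HasCompactSupport (m k)) :
    Continuous fun w : ℝ × Eucl n => ker ε m w.1 w.2 := by
  simp only [ker_eq]
  refine continuous_of_dominated (bound := fun ξ => ‖tens m ξ‖) ?_ ?_
    (integrable_tens hm hc).norm ?_
  · intro w
    exact ((measurable_ph ε measurable_const measurable_const measurable_id).aestronglyMeasurable
      ).mul (integrable_tens hm hc).ofReal.1
  · intro w
    refine Eventually.of_forall fun ξ => ?_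
    rw [norm_mul, norm_ph, one_mul, Complex.norm_real]
  · refine Eventually.of_forall fun ξ => ?_
    unfold ph
    fun_prop

lemma measurable_ker {n : ℕ} (ε : Fin n → ℝ) {m : Fin n → ℝ → ℝ} (hm : ∀ k, Smooth (m k))
    (hc : ∀ k, HasCompactSupport (m k)) {α : Type*} [MeasurableSpace α] {T : α → ℝ}
    {x : α → Eucl n} (hT : Measurable T) (hx : Measurable x) :
    Measurable fun a => ker ε m (T a) (x a) := by
  have h := (continuous_ker ε hm hc).measurable
  have h2 : Measurable fun a => (T a, x a) := hT.prodMk hx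
  simpa only [Function.comp_def] using h.comp h2

lemma ker_bounded {n : ℕ} (hn : 0 < n) (ε : Fin n → ℝ)
    (hε : ∀ i, ε i = 1 ∨ ε i = -1) {m : Fin n → ℝ → ℝ} (hm : ∀ k, Smooth (m k))
    (hc : ∀ k, HasCompactSupport (m k)) : ∃ C : ℝ, 0 ≤ C ∧ ∀ t x, ‖ker ε m t x‖ ≤ C := by
  obtain ⟨C, hC0, hC⟩ := exists_norm_ker_le hn ε hε m hm hc
  refine ⟨C, hC0, fun t x => (hC t x).trans (mul_le_of_le_one_right hC0 ?_)⟩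
  refine Real.rpow_le_one_of_one_le_of_nonpos (by linarith [norm_nonneg x]) ?_
  rw [neg_nonpos]
  positivity

set_option maxHeartbeats 400000 in
/-- The retarded linearized bilinear estimate on a hyperplane slice. -/
lemma exists_enorm_integral_ret_slice_le {n : ℕ} (hn : 2 ≤ n) {p : ℝ} (hp : 3 ≤ n → 2 ≤ p)
    (hp2 : n = 2 → 3 ≤ p) (ε : Fin n → ℝ) (hε : ∀ i, ε i = 1 ∨ ε i = -1)
    (m : Fin n → ℝ → ℝ) (hm : ∀ k, Smooth (m k)) (hc : ∀ k, HasCompactSupport (m k))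
    (i : Fin n) {e : Eucl n} (he : e = EuclideanSpace.single i (1 : ℝ)) {s c : ℝ}
    (hs : s = 1 ∨ s = -1) (hc0 : 0 < c) (hsupp : ∀ ξ ∈ tsupport (m i), c ≤ s * ξ) :
    ∃ C : ℝ≥0, ∀ (h : ℝ → ℂ) (T : ℝ → ℝ) (x : ℝ → Eucl n), Measurable h → Integrable h →
      IsCurve T x → ∀ (r : ℝ) (f : ℝ × hyperplane e → ℂ), Integrable f → MemLp f 2 →
      ‖∫ w : ℝ × (ℝ × hyperplane e), h w.1 * f w.2 * ((ret (T w.1) w.2.1 : ℂ) *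
        ker ε m (T w.1 - w.2.1) (x w.1 - slab e (r, w.2.2)))‖ₑ ≤
        C * dnorm p h * (∫⁻ z, ‖f z‖ₑ ^ 2) ^ (1 / 2 : ℝ) := by
  have he1 : ‖e‖ = 1 := by simp [he]
  have hp1 : 1 < p := by
    rcases hn.eq_or_lt with h | h
    · linarith [hp2 h.symm]
    · linarith [hp h]
  obtain ⟨C₁, hC₁⟩ := exists_enorm_integral_ker_slice_le hn hp hp2 ε hε m hm hc i he hs hc0 hsupp
  obtain ⟨C₂, hC₂⟩ := exists_lintegral_errKer_slice_le hn hp hp2 he1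
  obtain ⟨C₃, hC₃0, hC₃⟩ :=
    exists_norm_ker_wrongSign_le (2 * n + 2) ε hε m hm hc i s c hc0 hs hsupp
  obtain ⟨C₄, hC₄0, hC₄⟩ := ker_bounded (by omega) ε hε hm hc
  refine ⟨C₁ + C₁ + C₃.toNNReal * C₂, fun h T x hh hhi hTx r f hf hf2 => ?_⟩
  have hTm := hTx.measT
  have hxm := hTx.measx
  have hsl := continuous_slab e
  set A : Set ℝ := {ρ | 0 < s * ε i * (x ρ i - r)} with hA
  have hxi : Measurable fun ρ => x ρ i := by fun_prop
  have hAm : MeasurableSet A := measurableSet_lt measurable_const (by fun_prop)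
  set P : Set (ℝ × hyperplane e) := {z | 0 < z.1} with hP
  have hPm : MeasurableSet P := measurableSet_lt measurable_const measurable_fst
  set K : ℝ × (ℝ × hyperplane e) → ℂ := fun w =>
    ker ε m (T w.1 - w.2.1) (x w.1 - slab e (r, w.2.2)) with hK
  have hxs : Measurable fun w : ℝ × (ℝ × hyperplane e) => x w.1 - slab e (r, w.2.2) :=
    (hxm.comp measurable_fst).sub (hsl.measurable.comp (by fun_prop))
  have hKm : Measurable K := measurable_ker ε hm hc (by fun_prop) hxs
  have hKb : ∀ w, ‖K w‖ ≤ C₄ := fun w => hC₄ _ _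
  have hIntg : ∀ {h' : ℝ → ℂ} {f' : ℝ × hyperplane e → ℂ}, Integrable h' → Integrable f' →
      Integrable (fun w : ℝ × (ℝ × hyperplane e) => h' w.1 * f' w.2 * K w) := fun h1 h2 =>
    (h1.mul_prod h2).mul_bdd (c := C₄) hKm.aestronglyMeasurable (Eventually.of_forall hKb)
  have hfP := hf.indicator hPm
  have hfP' := hf.indicator hPm.compl
  have hhA := hhi.indicator hAm
  have hhA' := hhi.indicator hAm.compl
  set D : ℝ × (ℝ × hyperplane e) → ℂ := fun w =>
    (if w.2.1 ≤ T w.1 then 1 else 0) - (if w.1 ∈ A then 1 else 0) with hD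
  have hDm : Measurable D := by
    refine Measurable.sub (Measurable.ite ?_ measurable_const measurable_const)
      (Measurable.ite ?_ measurable_const measurable_const)
    · exact measurableSet_le (by fun_prop) (by fun_prop)
    · exact measurable_fst hAm
  have hDb : ∀ w, ‖D w‖ ≤ 1 := by
    intro w
    simp only [hD]
    split_ifs <;> norm_num
  have hDK : ∀ w, ‖D w * K w‖ₑ ≤ C₃.toNNReal *
      errKer (T w.1 - w.2.1) (x w.1 - slab e (r, w.2.2)) := by
    intro w
    by_cases hw : s * ε i * (T w.1 - w.2.1) * (x w.1 - slab e (r, w.2.2)) i ≤ 0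
    · have h1 := hC₃ _ _ hw
      rw [enorm_mul]
      calc ‖D w‖ₑ * ‖K w‖ₑ ≤ 1 * ‖K w‖ₑ := by
            gcongr
            rw [← ofReal_norm]
            exact (ENNReal.ofReal_le_ofReal (hDb w)).trans (by simp)
        _ ≤ _ := by
            rw [one_mul, ← ofReal_norm]
            refine (ENNReal.ofReal_le_ofReal h1).trans ?_
            rw [ENNReal.ofReal_mul hC₃0]
            rfl
    · have hz : D w = 0 := by
        have h2 : (x w.1 - slab e (r, w.2.2)) i = x w.1 i - r := by
          have h3 : (w.2.2 : Eucl n) i = 0 := by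
            rw [← coord_eq_inner, ← he, inner_hyperplane]
          simp [slab, h3, he]
        rw [h2, not_le, mul_right_comm] at hw
        simp only [hD, hA]
        by_cases hwA : w.1 ∈ A
        · have h4 : 0 < T w.1 - w.2.1 := by
            by_contra hne
            exact absurd hw (not_lt.2 (mul_nonpos_of_nonneg_of_nonpos (le_of_lt hwA)
              (not_lt.1 hne)))
          rw [if_pos (by linarith), if_pos hwA, sub_self]
        · have h4 : T w.1 - w.2.1 < 0 := by
            by_contra hne
            exact absurd hw (not_lt.2 (mul_nonpos_of_nonpos_of_nonneg (not_lt.1 hwA)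
              (not_lt.1 hne)))
          rw [if_neg (by linarith), if_neg hwA, sub_self]
      rw [hz, zero_mul, enorm_zero]
      exact zero_le
  have hID : Integrable (fun w : ℝ × (ℝ × hyperplane e) => h w.1 * f w.2 * K w * D w) :=
    (hIntg hhi hf).mul_bdd (c := 1) hDm.aestronglyMeasurable (Eventually.of_forall hDb)
  have hsplit : ∀ w : ℝ × (ℝ × hyperplane e), h w.1 * f w.2 * ((ret (T w.1) w.2.1 : ℂ) * K w) =
      A.indicator h w.1 * P.indicator f w.2 * K w - Aᶜ.indicator h w.1 * Pᶜ.indicator f w.2 * K w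
        + h w.1 * f w.2 * K w * D w := by
    intro w
    rw [ret_eq]
    simp only [hD, Set.indicator, Set.mem_compl_iff]
    by_cases h1 : w.1 ∈ A <;> by_cases h2 : w.2 ∈ P
    · rw [if_pos h1, if_pos h2, if_pos (show 0 < w.2.1 from h2), if_neg (not_not.2 h1),
        if_neg (not_not.2 h2), if_pos h1]
      ring
    · rw [if_pos h1, if_neg h2, if_neg (show ¬ 0 < w.2.1 from h2), if_neg (not_not.2 h1),
        if_pos h2, if_pos h1]
      ring
    · rw [if_neg h1, if_pos h2, if_pos (show 0 < w.2.1 from h2), if_pos h1,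
        if_neg (not_not.2 h2), if_neg h1]
      ring
    · rw [if_neg h1, if_neg h2, if_neg (show ¬ 0 < w.2.1 from h2), if_pos h1, if_pos h2,
        if_neg h1]
      ring
  have hle : ∀ z, ‖P.indicator f z‖ₑ ≤ ‖f z‖ₑ := fun z => enorm_indicator_le_enorm_self _ _
  have hle' : ∀ z, ‖Pᶜ.indicator f z‖ₑ ≤ ‖f z‖ₑ := fun z => enorm_indicator_le_enorm_self _ _
  have hb1 := hC₁ (A.indicator h) T x (hh.indicator hAm) hhA hTx r _ hfP (hf2.indicator hPm)
  have hb2 := hC₁ (Aᶜ.indicator h) T x (hh.indicator hAm.compl) hhA' hTx r _ hfP'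
    (hf2.indicator hPm.compl)
  have hb3 : ‖∫ w : ℝ × (ℝ × hyperplane e), h w.1 * f w.2 * K w * D w‖ₑ ≤
      C₃.toNNReal * (C₂ * dnorm p h * (∫⁻ z, ‖f z‖ₑ ^ 2) ^ (1 / 2 : ℝ)) := by
    calc _ ≤ ∫⁻ w : ℝ × (ℝ × hyperplane e), ‖h w.1 * f w.2 * K w * D w‖ₑ :=
          enorm_integral_le_lintegral_enorm _
      _ ≤ ∫⁻ w : ℝ × (ℝ × hyperplane e), C₃.toNNReal * (‖h w.1‖ₑ * ‖f w.2‖ₑ *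
            errKer (T w.1 - w.2.1) (x w.1 - slab e (r, w.2.2))) := by
          refine lintegral_mono fun w => ?_
          rw [mul_assoc (h w.1 * f w.2), mul_comm (K w), enorm_mul, enorm_mul, mul_left_comm]
          gcongr
          exact hDK w
      _ ≤ _ := by
          rw [lintegral_const_mul' _ _ ENNReal.coe_ne_top]
          gcongr
          exact hC₂ h T x hh hTx r f hf.1
  rw [integral_congr_ae (Eventually.of_forall hsplit), integral_add (by exact (hIntg hhA hfP).sub (hIntg hhA' hfP')) hID,
    integral_sub (hIntg hhA hfP) (hIntg hhA' hfP')]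
  calc _ ≤ (‖∫ w : ℝ × (ℝ × hyperplane e), A.indicator h w.1 * P.indicator f w.2 * K w‖ₑ +
        ‖∫ w : ℝ × (ℝ × hyperplane e), Aᶜ.indicator h w.1 * Pᶜ.indicator f w.2 * K w‖ₑ) +
        ‖∫ w : ℝ × (ℝ × hyperplane e), h w.1 * f w.2 * K w * D w‖ₑ :=
        (enorm_add_le _ _).trans (by gcongr; exact enorm_sub_le)
    _ ≤ (C₁ * dnorm p h * (∫⁻ z, ‖f z‖ₑ ^ 2) ^ (1 / 2 : ℝ) +
          C₁ * dnorm p h * (∫⁻ z, ‖f z‖ₑ ^ 2) ^ (1 / 2 : ℝ)) +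
        C₃.toNNReal * (C₂ * dnorm p h * (∫⁻ z, ‖f z‖ₑ ^ 2) ^ (1 / 2 : ℝ)) := by
        gcongr
        · refine hb1.trans ?_
          gcongr
          · exact dnorm_mono hp1 fun r => enorm_indicator_le_enorm_self _ _
          · exact hle _
        · refine hb2.trans ?_
          gcongr
          · exact dnorm_mono hp1 fun r => enorm_indicator_le_enorm_self _ _
          · exact hle' _
    _ = _ := by push_cast; ring

/-- The retarded potential with tensor frequency cutoff `m`. -/
def retPot {n : ℕ} (ε : Fin n → ℝ) (m : Fin n → ℝ → ℝ) (G : ℝ × Eucl n → ℂ) (t : ℝ)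
    (x : Eucl n) : ℂ :=
  ∫ q : ℝ × Eucl n, G q * ((ret t q.1 : ℂ) * ker ε m (t - q.1) (x - q.2))

/-- Space-time in slab coordinates. -/
def slabT {n : ℕ} (e : Eucl n) (w : ℝ × (ℝ × hyperplane e)) : ℝ × Eucl n :=
  (w.2.1, slab e (w.1, w.2.2))

lemma measurePreserving_slabT {n : ℕ} {e : Eucl n} (he : ‖e‖ = 1) :
    MeasurePreserving (slabT e) := by
  have h1 : MeasurePreserving (fun w : ℝ × (ℝ × hyperplane e) => (w.2.1, (w.1, w.2.2))) := by
    have a := (volume_preserving_prodAssoc (α₁ := ℝ) (β₁ := ℝ) (γ₁ := hyperplane e)).symm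
    have b : MeasurePreserving (Prod.map (Prod.swap : ℝ × ℝ → ℝ × ℝ) (id : hyperplane e → _)) :=
      Measure.measurePreserving_swap.prod (MeasurePreserving.id _)
    have c := volume_preserving_prodAssoc (α₁ := ℝ) (β₁ := ℝ) (γ₁ := hyperplane e)
    exact c.comp (b.comp a)
  have h2 : MeasurePreserving (Prod.map (id : ℝ → ℝ) (slab e)) :=
    (MeasurePreserving.id _).prod (measurePreserving_slab he)
  exact h2.comp h1

lemma innerQ_two {n : ℕ} (e : Eucl n) (G : ℝ × Eucl n → ℂ) (r : ℝ) :
    innerQ 2 e G r = (∫⁻ z, ‖G (slabT e (r, z))‖ₑ ^ 2) ^ (1 / 2 : ℝ) := by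
  unfold innerQ
  rw [eLpNorm_eq_lintegral_rpow_enorm_toReal (by norm_num) (by norm_num)]
  simp [slabT, slab]

lemma aniNorm_one_two {n : ℕ} (e : Eucl n) (G : ℝ × Eucl n → ℂ) :
    aniNorm 1 2 e G = ∫⁻ r, (∫⁻ z, ‖G (slabT e (r, z))‖ₑ ^ 2) ^ (1 / 2 : ℝ) := by
  unfold aniNorm
  rw [if_neg ENNReal.one_ne_top]
  simp [innerQ_two]

lemma memLp_two_of_integrable_of_bounded {α : Type*} [MeasurableSpace α] {μ : Measure α}
    {f : α → ℂ} {M : ℝ} (hf : Integrable f μ) (hM : ∀ a, ‖f a‖ ≤ M) : MemLp f 2 μ :=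
  (memLp_two_iff_integrable_sq_norm hf.1).2 <| by
    simp only [sq]
    exact hf.norm.mul_bdd (c := M) hf.1.norm (Eventually.of_forall fun a => by simpa using hM a)

lemma exists_enorm_integral_mul_retPot_le {n : ℕ} (hn : 2 ≤ n) {p : ℝ} (hp : 3 ≤ n → 2 ≤ p)
    (hp2 : n = 2 → 3 ≤ p) (ε : Fin n → ℝ) (hε : ∀ i, ε i = 1 ∨ ε i = -1)
    (m : Fin n → ℝ → ℝ) (hm : ∀ k, Smooth (m k)) (hc : ∀ k, HasCompactSupport (m k))
    (i : Fin n) {e : Eucl n} (he : e = EuclideanSpace.single i (1 : ℝ)) {s c : ℝ}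
    (hs : s = 1 ∨ s = -1) (hc0 : 0 < c) (hsupp : ∀ ξ ∈ tsupport (m i), c ≤ s * ξ) :
    ∃ C : ℝ≥0, ∀ (h : ℝ → ℂ) (T : ℝ → ℝ) (x : ℝ → Eucl n), Measurable h → Integrable h →
      IsCurve T x → ∀ (G : ℝ × Eucl n → ℂ) (M : ℝ), Continuous G → Integrable G →
      (∀ q, ‖G q‖ ≤ M) →
      ‖∫ ρ, h ρ * retPot ε m G (T ρ) (x ρ)‖ₑ ≤ C * dnorm p h * aniNorm 1 2 e G := by
  obtain ⟨C, hC⟩ :=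
    exists_enorm_integral_ret_slice_le hn hp hp2 ε hε m hm hc i he hs hc0 hsupp
  obtain ⟨C₄, hC₄0, hC₄⟩ := ker_bounded (by omega) ε hε hm hc
  refine ⟨C, fun h T x hh hhi hTx G M hG hGi hGM => ?_⟩
  have he1 : ‖e‖ = 1 := by simp [he]
  have hTm := hTx.measT
  have hxm := hTx.measx
  have hsl := continuous_slab e
  have hΦ := measurePreserving_slabT he1
  set K : ℝ → ℝ × Eucl n → ℂ := fun ρ q =>
    (ret (T ρ) q.1 : ℂ) * ker ε m (T ρ - q.1) (x ρ - q.2) with hK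
  have hKm : Measurable (fun w : ℝ × (ℝ × Eucl n) => K w.1 w.2) :=
    (Complex.measurable_ofReal.comp (measurable_ret (by fun_prop) (by fun_prop))).mul
      (measurable_ker ε hm hc (by fun_prop) (by fun_prop))
  have hKb : ∀ ρ q, ‖K ρ q‖ ≤ C₄ := fun ρ q => by
    rw [hK, norm_mul, Complex.norm_real, Real.norm_eq_abs]
    calc _ ≤ 1 * C₄ := by gcongr; exacts [abs_ret_le _ _, hC₄ _ _]
      _ = C₄ := one_mul _
  have hIntg : Integrable (fun w : ℝ × (ℝ × Eucl n) => h w.1 * G w.2 * K w.1 w.2)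
      (volume.prod volume) :=
    (hhi.mul_prod hGi).mul_bdd (c := C₄) hKm.aestronglyMeasurable
      (Eventually.of_forall fun w => hKb _ _)
  set J : ℝ × Eucl n → ℂ := fun q => ∫ ρ, h ρ * G q * K ρ q with hJ
  have hJi : Integrable J := hIntg.integral_prod_right
  have hJΦ : Integrable (fun w => J (slabT e w)) := hΦ.integrable_comp_of_integrable hJi
  have hGΦ : Integrable (fun w => G (slabT e w)) := hΦ.integrable_comp_of_integrable hGi
  have hGΦ' : ∀ᵐ r, Integrable (fun z => G (slabT e (r, z))) := hGΦ.prod_right_ae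
  have hslT : Continuous (slabT e) := by unfold slabT; fun_prop
  have e1 : ∫ ρ, h ρ * retPot ε m G (T ρ) (x ρ) = ∫ r, ∫ z, J (slabT e (r, z)) := by
    calc ∫ ρ, h ρ * retPot ε m G (T ρ) (x ρ) = ∫ ρ, ∫ q, h ρ * G q * K ρ q := by
          refine integral_congr_ae (Eventually.of_forall fun ρ => ?_)
          simp only [retPot]
          rw [← integral_const_mul]
          simp only [hK, mul_assoc]
      _ = ∫ q, J q := integral_integral_swap hIntg
      _ = ∫ w, J (slabT e w) := by
          rw [← hΦ.map_eq, integral_map hΦ.measurable.aemeasurable]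
          rw [hΦ.map_eq]
          exact hJi.1
      _ = _ := by
          rw [Measure.volume_eq_prod, integral_prod]
          exact hJΦ
  have e2 : ∀ᵐ r, ‖∫ z, J (slabT e (r, z))‖ₑ ≤
      C * dnorm p h * (∫⁻ z, ‖G (slabT e (r, z))‖ₑ ^ 2) ^ (1 / 2 : ℝ) := by
    filter_upwards [hGΦ'] with r hr
    have hr2 : MemLp (fun z => G (slabT e (r, z))) 2 :=
      memLp_two_of_integrable_of_bounded hr fun z => hGM _
    refine le_trans (le_of_eq ?_) (hC h T x hh hhi hTx r _ hr hr2)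
    congr 1
    have hKm' : Measurable (fun w : ℝ × (ℝ × hyperplane e) => K w.1 (slabT e (r, w.2))) :=
      hKm.comp (measurable_fst.prodMk (hslT.measurable.comp (by fun_prop)))
    have hIntg' : Integrable (fun w : ℝ × (ℝ × hyperplane e) =>
        h w.1 * G (slabT e (r, w.2)) * K w.1 (slabT e (r, w.2))) (volume.prod volume) :=
      (hhi.mul_prod hr).mul_bdd (c := C₄) hKm'.aestronglyMeasurable
        (Eventually.of_forall fun w => hKb _ _)
    exact (integral_prod_symm _ hIntg').symm
  rw [e1, aniNorm_one_two]
  calc _ ≤ ∫⁻ r, ‖∫ z, J (slabT e (r, z))‖ₑ := enorm_integral_le_lintegral_enorm _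
    _ ≤ ∫⁻ r, C * dnorm p h * (∫⁻ z, ‖G (slabT e (r, z))‖ₑ ^ 2) ^ (1 / 2 : ℝ) :=
        lintegral_mono_ae e2
    _ = _ := by
        refine lintegral_const_mul _ (Measurable.pow_const ?_ _)
        have : Measurable (fun w : ℝ × (ℝ × hyperplane e) => ‖G (slabT e w)‖ₑ ^ 2) :=
          (hG.comp hslT).measurable.enorm.pow_const 2
        exact this.lintegral_prod_right'

lemma le_rpow_of_le_rpow_mul {p : ℝ} (hp : 1 < p) {I B : ℝ≥0∞} (hI : I ≠ ∞)
    (h : I ≤ I ^ (1 - 1 / p) * B) : I ≤ B ^ p := by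
  have hp0 : 0 < p := by linarith
  rcases eq_or_ne I 0 with h0 | h0
  · rw [h0]; exact zero_le
  have h1 : I ^ (1 - 1 / p) ≠ 0 := by
    rw [Ne, ENNReal.rpow_eq_zero_iff]
    tauto
  have h2 : I ^ (1 - 1 / p) ≠ ∞ := ENNReal.rpow_ne_top_of_ne_zero h0 hI
  have h3 : I ^ (1 / p) ≤ B := by
    rw [← ENNReal.mul_le_mul_iff_right h1 h2]
    refine le_trans (le_of_eq ?_) h
    rw [← ENNReal.rpow_add _ _ h0 hI, sub_add_cancel, ENNReal.rpow_one]
  calc I = (I ^ (1 / p)) ^ p := by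
        rw [← ENNReal.rpow_mul, one_div, inv_mul_cancel₀ hp0.ne', ENNReal.rpow_one]
    _ ≤ B ^ p := by gcongr

/-- `L^p` bounds on bounded sets by duality. -/
lemma setLIntegral_rpow_le_of_dual {p : ℝ} (hp : 2 ≤ p) {v : ℝ → ℂ} (hv : Measurable v) {M : ℝ}
    (hM : ∀ ρ, ‖v ρ‖ ≤ M) {B : ℝ≥0∞}
    (hB : ∀ h : ℝ → ℂ, Measurable h → Integrable h → ‖∫ ρ, h ρ * v ρ‖ₑ ≤ dnorm p h * B)
    {S : Set ℝ} (hS : MeasurableSet S) (hS' : volume S ≠ ∞) :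
    ∫⁻ ρ in S, ‖v ρ‖ₑ ^ p ≤ B ^ p := by
  have hp1 : 0 < p - 1 := by linarith
  have hp0 : 0 < p := by linarith
  have hM0 : 0 ≤ M := (norm_nonneg _).trans (hM 0)
  set g : ℝ → ℝ := S.indicator fun ρ => ‖v ρ‖ ^ p with hg
  set h : ℝ → ℂ := S.indicator fun ρ => starRingEnd ℂ (v ρ) * ((‖v ρ‖ ^ (p - 2) : ℝ) : ℂ) with hh
  have hhm : Measurable h := by
    refine Measurable.indicator ?_ hS
    exact (Complex.continuous_conj.measurable.comp hv).mul
      (Complex.measurable_ofReal.comp (hv.norm.pow_const _))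
  have hvp : ∀ ρ, ‖v ρ‖ * ‖v ρ‖ ^ (p - 2) = ‖v ρ‖ ^ (p - 1) := by
    intro ρ
    rcases eq_or_ne ‖v ρ‖ 0 with h0 | h0
    · rw [h0, zero_mul, Real.zero_rpow hp1.ne']
    · rw [show p - 1 = 1 + (p - 2) by ring, Real.rpow_add (lt_of_le_of_ne (norm_nonneg _) h0.symm),
        Real.rpow_one]
  have hvp' : ∀ ρ, ‖v ρ‖ * ‖v ρ‖ ^ (p - 1) = ‖v ρ‖ ^ p := by
    intro ρ
    rcases eq_or_ne ‖v ρ‖ 0 with h0 | h0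
    · rw [h0, zero_mul, Real.zero_rpow hp0.ne']
    · conv_rhs => rw [show p = 1 + (p - 1) by ring]
      rw [Real.rpow_add (lt_of_le_of_ne (norm_nonneg _) h0.symm), Real.rpow_one]
  have hhn : ∀ ρ, ‖h ρ‖ = S.indicator (fun ρ => ‖v ρ‖ ^ (p - 1)) ρ := by
    intro ρ
    by_cases hρ : ρ ∈ S
    · simp only [hh, Set.indicator_of_mem hρ, norm_mul, RCLike.norm_conj, Complex.norm_real]
      rw [Real.norm_of_nonneg (by positivity), hvp]
    · simp only [hh, Set.indicator_of_notMem hρ, norm_zero]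
  have hbdd : ∀ {u : ℝ → ℝ} {q : ℝ}, 0 ≤ q → u = S.indicator (fun ρ => ‖v ρ‖ ^ q) →
      Integrable u := by
    intro u q hq hu
    rw [hu]
    refine IntegrableOn.integrable_indicator ?_ hS
    refine Measure.integrableOn_of_bounded (M := M ^ q) hS' ?_ ?_
    · exact (hv.norm.pow_const _).aestronglyMeasurable
    · refine Eventually.of_forall fun ρ => ?_
      rw [Real.norm_of_nonneg (by positivity)]
      exact Real.rpow_le_rpow (norm_nonneg _) (hM ρ) hq
  have hhi : Integrable h :=
    (integrable_norm_iff hhm.aestronglyMeasurable).1 (hbdd hp1.le (funext hhn))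
  have hgi : Integrable g := hbdd hp0.le rfl
  have hg0 : 0 ≤ g := fun ρ => Set.indicator_nonneg (fun ρ _ => by positivity) ρ
  have hen : ∀ ρ, ‖v ρ‖ₑ ^ p = ENNReal.ofReal (‖v ρ‖ ^ p) := fun ρ => by
    rw [← ofReal_norm, ENNReal.ofReal_rpow_of_nonneg (norm_nonneg _) hp0.le]
  have hI : ∫⁻ ρ in S, ‖v ρ‖ₑ ^ p = ∫⁻ ρ, ENNReal.ofReal (g ρ) := by
    rw [← lintegral_indicator hS]
    refine lintegral_congr fun ρ => ?_
    by_cases hρ : ρ ∈ S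
    · simp only [hg, Set.indicator_of_mem hρ, hen]
    · simp only [hg, Set.indicator_of_notMem hρ, ENNReal.ofReal_zero]
  have hIfin : ∫⁻ ρ in S, ‖v ρ‖ₑ ^ p ≠ ∞ := by
    rw [hI, lintegral_ofReal_eq_enorm_integral hgi hg0]
    exact enorm_ne_top
  have hd : dnorm p h = (∫⁻ ρ in S, ‖v ρ‖ₑ ^ p) ^ (1 - 1 / p) := by
    unfold dnorm
    congr 1
    rw [← lintegral_indicator hS]
    refine lintegral_congr fun ρ => ?_
    rw [← ofReal_norm, hhn]
    by_cases hρ : ρ ∈ S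
    · simp only [Set.indicator_of_mem hρ]
      rw [ENNReal.ofReal_rpow_of_nonneg (by positivity) (by positivity), hen,
        ← Real.rpow_mul (norm_nonneg _), mul_div_cancel₀ _ hp1.ne']
    · simp only [Set.indicator_of_notMem hρ, ENNReal.ofReal_zero]
      exact ENNReal.zero_rpow_of_pos (by positivity)
  refine le_rpow_of_le_rpow_mul (by linarith) hIfin ?_
  have := hB h hhm hhi
  rw [hd] at this
  refine le_trans (le_of_eq ?_) this
  rw [hI, lintegral_ofReal_eq_enorm_integral hgi hg0]
  congr 1
  refine integral_congr_ae (Eventually.of_forall fun ρ => ?_)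
  by_cases hρ : ρ ∈ S
  · simp only [hg, hh, Set.indicator_of_mem hρ]
    rw [mul_right_comm, mul_comm (starRingEnd ℂ (v ρ)), Complex.mul_conj, Complex.normSq_eq_norm_sq,
      ← Complex.ofReal_mul, sq, mul_assoc, hvp, hvp']
  · simp only [hg, hh, Set.indicator_of_notMem hρ, zero_mul, Complex.ofReal_zero]

/-- Measurable selection of a maximizer among finitely many points. -/
lemma exists_measurable_argmax {α β : Type*} [MeasurableSpace α] [MeasurableSpace β]
    {g : α → β → ℝ≥0∞} (hg : Measurable fun w : α × β => g w.1 w.2) (z : ℕ → β) (N : ℕ) :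
    ∃ y : α → β, Measurable y ∧ ∀ a, ∀ k ≤ N, g a (z k) ≤ g a (y a) := by
  induction N with
  | zero =>
    exact ⟨fun _ => z 0, measurable_const, fun a k hk => by rw [Nat.le_zero.1 hk]⟩
  | succ N ih =>
    obtain ⟨y, hy, hyk⟩ := ih
    classical
    have h1 : Measurable fun a => g a (y a) := hg.comp (measurable_id.prodMk hy)
    have h2 : Measurable fun a => g a (z (N + 1)) := hg.comp (measurable_id.prodMk measurable_const)
    refine ⟨fun a => if g a (y a) < g a (z (N + 1)) then z (N + 1) else y a,
      Measurable.ite (measurableSet_lt h1 h2) measurable_const hy, fun a k hk => ?_⟩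
    dsimp only
    split_ifs with hlt
    · rcases Nat.le_succ_iff.1 hk with h | h
      · exact (hyk a k h).trans hlt.le
      · rw [h]
    · rcases Nat.le_succ_iff.1 hk with h | h
      · exact hyk a k h
      · rw [h]
        exact not_lt.1 hlt

/-- Maximal function bounds follow from linearized bounds. -/
lemma lintegral_iSup_rpow_le_of_linearized {n : ℕ} {p : ℝ} (hp : 2 ≤ p) {e : Eucl n} (he : ‖e‖ = 1)
    {V : ℝ × Eucl n → ℂ} (hV : Continuous V) {M : ℝ} (hM : ∀ q, ‖V q‖ ≤ M) {B : ℝ≥0∞}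
    (hB : ∀ (h : ℝ → ℂ) (T : ℝ → ℝ) (x : ℝ → Eucl n), Measurable h → Integrable h →
      IsCurve T x → ‖∫ ρ, h ρ * V (T ρ, x ρ)‖ₑ ≤ dnorm p h * B) :
    ∫⁻ ρ, (⨆ z, ‖V (slabT e (ρ, z))‖ₑ) ^ p ≤ B ^ p := by
  have hp0 : 0 < p := by linarith
  have hslT : Continuous (slabT e) := by
    have := continuous_slab e
    unfold slabT; fun_prop
  set g : ℝ → ℝ × hyperplane e → ℝ≥0∞ := fun ρ z => ‖V (slabT e (ρ, z))‖ₑ with hg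
  have hgc : Continuous fun w : ℝ × (ℝ × hyperplane e) => g w.1 w.2 := (hV.comp hslT).enorm
  set z : ℕ → ℝ × hyperplane e := TopologicalSpace.denseSeq _ with hz
  set F : ℕ → ℝ → ℝ≥0∞ := fun N =>
    (Set.Icc (-(N : ℝ)) N).indicator fun ρ => ⨆ k, ⨆ _ : k ≤ N, g ρ (z k) ^ p with hF
  have hgk : ∀ k, Measurable fun ρ => g ρ (z k) ^ p := fun k =>
    (hgc.measurable.comp (measurable_id.prodMk measurable_const)).pow_const p
  have hFm : ∀ N, Measurable (F N) := fun N =>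
    (Measurable.iSup fun k => Measurable.iSup fun _ => hgk k).indicator measurableSet_Icc
  have hFmono : Monotone F := by
    intro N N' hN ρ
    have hN' : (N : ℝ) ≤ N' := by exact_mod_cast hN
    refine (Set.indicator_le_indicator_of_subset (Set.Icc_subset_Icc (neg_le_neg hN') hN')
      (fun _ => zero_le) ρ).trans ?_
    refine Set.indicator_le_indicator ?_
    exact iSup_mono fun k => iSup_mono' fun hk => ⟨hk.trans hN, le_rfl⟩
  have hFint : ∀ N, ∫⁻ ρ, F N ρ ≤ B ^ p := by
    intro N
    obtain ⟨y, hy, hyk⟩ := exists_measurable_argmax hgc.measurable z N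
    have hvm : Measurable fun ρ => V (slabT e (ρ, y ρ)) :=
      (hV.comp hslT).measurable.comp (measurable_id.prodMk hy)
    have hcurve : IsCurve (fun ρ => (y ρ).1) (fun ρ => slab e (ρ, (y ρ).2)) := by
      refine ⟨hy.fst, (continuous_slab e).measurable.comp (measurable_id.prodMk hy.snd), ?_⟩
      intro ρ ρ'
      have h1 : inner ℝ e (slab e (ρ, (y ρ).2) - slab e (ρ', (y ρ').2)) = ρ - ρ' := by
        have h2 := congrArg Prod.fst (unslab_slab he (ρ, (y ρ).2))
        have h3 := congrArg Prod.fst (unslab_slab he (ρ', (y ρ').2))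
        simp only [unslab] at h2 h3
        rw [inner_sub_right, h2, h3]
      rw [← h1]
      exact (abs_real_inner_le_norm _ _).trans (by rw [he, one_mul])
    rw [lintegral_indicator measurableSet_Icc]
    calc _ ≤ ∫⁻ ρ in Set.Icc (-(N : ℝ)) N, ‖V (slabT e (ρ, y ρ))‖ₑ ^ p := by
          refine lintegral_mono fun ρ => iSup₂_le fun k hk => ?_
          gcongr
          exact hyk ρ k hk
      _ ≤ B ^ p := setLIntegral_rpow_le_of_dual hp hvm (fun _ => hM _)
          (fun h hh hhi => hB h _ _ hh hhi hcurve) measurableSet_Icc (by simp)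
  calc ∫⁻ ρ, (⨆ z, g ρ z) ^ p ≤ ∫⁻ ρ, ⨆ N, F N ρ := by
        refine lintegral_mono fun ρ => ?_
        have hk : ∀ k, g ρ (z k) ^ p ≤ ⨆ N, F N ρ := by
          intro k
          obtain ⟨N, hN⟩ := exists_nat_ge (max (k : ℝ) |ρ|)
          refine le_trans ?_ (le_iSup _ N)
          have hρ : ρ ∈ Set.Icc (-(N : ℝ)) N := abs_le.1 ((le_max_right _ _).trans hN)
          have hkN : k ≤ N := by exact_mod_cast (le_max_left _ _).trans hN
          simp only [hF, Set.indicator_of_mem hρ]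
          exact le_iSup₂_of_le k hkN le_rfl
        have hall : ∀ y, g ρ y ≤ (⨆ N, F N ρ) ^ p⁻¹ := by
          have hclosed : IsClosed {y | g ρ y ≤ (⨆ N, F N ρ) ^ p⁻¹} :=
            isClosed_le (hgc.comp (by fun_prop : Continuous fun y => (ρ, y))) continuous_const
          have hsub : Set.range z ⊆ {y | g ρ y ≤ (⨆ N, F N ρ) ^ p⁻¹} := by
            rintro _ ⟨k, rfl⟩
            exact (ENNReal.le_rpow_inv_iff hp0).2 (hk k)
          intro y
          exact hclosed.closure_subset_iff.2 hsub (TopologicalSpace.denseRange_denseSeq _ y)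
        rw [← ENNReal.le_rpow_inv_iff hp0]
        exact iSup_le hall
    _ = ⨆ N, ∫⁻ ρ, F N ρ := lintegral_iSup hFm hFmono
    _ ≤ B ^ p := iSup_le hFint

lemma integrable_retPot {n : ℕ} (hn : 0 < n) (ε : Fin n → ℝ) (hε : ∀ i, ε i = 1 ∨ ε i = -1)
    {m : Fin n → ℝ → ℝ} (hm : ∀ k, Smooth (m k)) (hc : ∀ k, HasCompactSupport (m k))
    {G : ℝ × Eucl n → ℂ} (hG : Integrable G) (t : ℝ) (x : Eucl n) :
    Integrable fun q : ℝ × Eucl n => G q * ((ret t q.1 : ℂ) * ker ε m (t - q.1) (x - q.2)) := by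
  obtain ⟨C, -, hC⟩ := ker_bounded hn ε hε hm hc
  refine hG.mul_bdd (c := 1 * C) ?_ (Eventually.of_forall fun q => ?_)
  · exact ((Complex.measurable_ofReal.comp (measurable_ret (by fun_prop) (by fun_prop))).mul
      (measurable_ker ε hm hc (by fun_prop) (by fun_prop))).aestronglyMeasurable
  · rw [norm_mul, Complex.norm_real, Real.norm_eq_abs]
    gcongr
    exacts [abs_ret_le _ _, hC _ _]

lemma exists_norm_retPot_le {n : ℕ} (hn : 0 < n) (ε : Fin n → ℝ) (hε : ∀ i, ε i = 1 ∨ ε i = -1)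
    {m : Fin n → ℝ → ℝ} (hm : ∀ k, Smooth (m k)) (hc : ∀ k, HasCompactSupport (m k))
    {G : ℝ × Eucl n → ℂ} (hG : Integrable G) :
    ∃ C : ℝ, ∀ t x, ‖retPot ε m G t x‖ ≤ C := by
  obtain ⟨C, -, hC⟩ := ker_bounded hn ε hε hm hc
  refine ⟨∫ q, ‖G q‖ * (1 * C), fun t x => ?_⟩
  refine norm_integral_le_of_norm_le (hG.norm.mul_const _) (Eventually.of_forall fun q => ?_)
  rw [norm_mul, norm_mul, Complex.norm_real, Real.norm_eq_abs]
  gcongr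
  exacts [abs_ret_le _ _, hC _ _]

lemma continuousAt_ret {t s : ℝ} (h : s ≠ t) : ContinuousAt (fun t' => ret t' s) t := by
  rcases lt_or_gt_of_ne h with h | h
  · refine (continuousAt_const (y := ret t s)).congr ?_
    filter_upwards [lt_mem_nhds h] with t' ht'
    simp only [ret, h.le, ht'.le, not_lt.2 h.le, not_lt.2 ht'.le]
  · refine (continuousAt_const (y := ret t s)).congr ?_
    filter_upwards [gt_mem_nhds h] with t' ht'
    simp only [ret, h, ht', not_le.2 h, not_le.2 ht']

lemma continuous_retPot {n : ℕ} (hn : 0 < n) (ε : Fin n → ℝ) (hε : ∀ i, ε i = 1 ∨ ε i = -1)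
    {m : Fin n → ℝ → ℝ} (hm : ∀ k, Smooth (m k)) (hc : ∀ k, HasCompactSupport (m k))
    {G : ℝ × Eucl n → ℂ} (hG : Integrable G) :
    Continuous fun w : ℝ × Eucl n => retPot ε m G w.1 w.2 := by
  obtain ⟨C, -, hC⟩ := ker_bounded hn ε hε hm hc
  rw [continuous_iff_continuousAt]
  rintro ⟨t, x⟩
  refine continuousAt_of_dominated (bound := fun q => ‖G q‖ * (1 * C)) ?_ ?_
    (hG.norm.mul_const _) ?_
  · exact Eventually.of_forall fun w => (integrable_retPot hn ε hε hm hc hG w.1 w.2).1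
  · refine Eventually.of_forall fun w => Eventually.of_forall fun q => ?_
    rw [norm_mul, norm_mul, Complex.norm_real, Real.norm_eq_abs]
    gcongr
    exacts [abs_ret_le _ _, hC _ _]
  · have h1 : ∀ᵐ s : ℝ, s ≠ t := by
      rw [ae_iff]
      simp
    have h2 : ∀ᵐ q : ℝ × Eucl n, q.1 ≠ t := Measure.quasiMeasurePreserving_fst.ae h1
    filter_upwards [h2] with q hq
    have hr : ContinuousAt (fun w : ℝ × Eucl n => (ret w.1 q.1 : ℂ)) (t, x) :=
      (Complex.continuous_ofReal.continuousAt).comp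
        (ContinuousAt.comp (f := Prod.fst) (g := fun t' => ret t' q.1) (continuousAt_ret hq)
          continuousAt_fst)
    have hk : Continuous fun w : ℝ × Eucl n => ker ε m (w.1 - q.1) (w.2 - q.2) := by
      have h3 : Continuous fun w : ℝ × Eucl n => (w.1 - q.1, w.2 - q.2) := by fun_prop
      simpa only [Function.comp_def] using (continuous_ker ε hm hc).comp h3
    exact continuousAt_const.mul (hr.mul hk.continuousAt)

/-- A smooth cutoff equal to one on `[-2, 2]`. -/
def cutoffTwo : ContDiffBump (0 : ℝ) := ⟨2, 3, by norm_num, by norm_num⟩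

/-- A smooth partition of `[-2, 2]` into a neighbourhood of the origin and two half lines. -/
def linePart (c : ℝ) (k : Fin 3) (ξ : ℝ) : ℝ :=
  (![1 - Real.smoothTransition (ξ / c - 1) - Real.smoothTransition (-ξ / c - 1),
    Real.smoothTransition (ξ / c - 1), Real.smoothTransition (-ξ / c - 1)] k) * cutoffTwo ξ

lemma smooth_linePart (c : ℝ) (k : Fin 3) : Smooth (linePart c k) := by
  have h1 : ContDiff ℝ ((⊤ : ℕ∞) : WithTop ℕ∞) fun ξ => Real.smoothTransition (ξ / c - 1) :=
    Real.smoothTransition.contDiff.comp (by fun_prop)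
  have h2 : ContDiff ℝ ((⊤ : ℕ∞) : WithTop ℕ∞) fun ξ => Real.smoothTransition (-ξ / c - 1) :=
    Real.smoothTransition.contDiff.comp (by fun_prop)
  have h3 : ContDiff ℝ ((⊤ : ℕ∞) : WithTop ℕ∞) fun ξ => cutoffTwo ξ := cutoffTwo.contDiff
  fin_cases k
  · exact (((contDiff_const (c := (1 : ℝ))).sub h1).sub h2).mul h3
  · exact h1.mul h3
  · exact h2.mul h3

lemma hasCompactSupport_linePart (c : ℝ) (k : Fin 3) : HasCompactSupport (linePart c k) :=
  cutoffTwo.hasCompactSupport.mul_left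

lemma sum_linePart (c : ℝ) {ξ : ℝ} (hξ : |ξ| ≤ 2) : ∑ k, linePart c k ξ = 1 := by
  have h : cutoffTwo ξ = 1 := cutoffTwo.one_of_mem_closedBall (by simpa [cutoffTwo] using hξ)
  simp only [Fin.sum_univ_three, linePart, h, Matrix.cons_val, mul_one]
  ring

lemma linePart_zero_eq_zero {c ξ : ℝ} (hc : 0 < c) (hξ : 2 * c ≤ |ξ|) : linePart c 0 ξ = 0 := by
  rcases le_total 0 ξ with h | h
  · rw [abs_of_nonneg h] at hξ
    have h1 : Real.smoothTransition (ξ / c - 1) = 1 :=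
      Real.smoothTransition.one_of_one_le (by rw [le_sub_iff_add_le, le_div_iff₀ hc]; linarith)
    have h2 : Real.smoothTransition (-ξ / c - 1) = 0 :=
      Real.smoothTransition.zero_of_nonpos (by
        rw [sub_nonpos, div_le_one hc]; linarith)
    simp [linePart, h1, h2]
  · rw [abs_of_nonpos h] at hξ
    have h1 : Real.smoothTransition (-ξ / c - 1) = 1 :=
      Real.smoothTransition.one_of_one_le (by rw [le_sub_iff_add_le, le_div_iff₀ hc]; linarith)
    have h2 : Real.smoothTransition (ξ / c - 1) = 0 :=
      Real.smoothTransition.zero_of_nonpos (by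
        rw [sub_nonpos, div_le_one hc]; linarith)
    simp [linePart, h1, h2]

lemma le_of_mem_tsupport_linePart {c : ℝ} (hc : 0 < c) {k : Fin 3} (hk : k ≠ 0) :
    ∃ s : ℝ, (s = 1 ∨ s = -1) ∧ ∀ ξ ∈ tsupport (linePart c k), c ≤ s * ξ := by
  have key : ∀ s : ℝ, (∀ ξ, s * ξ < c → linePart c k ξ = 0) →
      ∀ ξ ∈ tsupport (linePart c k), c ≤ s * ξ := by
    intro s hs ξ hξ
    have hcl : IsClosed {ξ : ℝ | c ≤ s * ξ} := isClosed_le (by fun_prop) (by fun_prop)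
    refine closure_minimal (fun ξ hξ => ?_) hcl hξ
    by_contra h
    exact hξ (hs ξ (not_le.1 h))
  have hz : ∀ y : ℝ, y < c → Real.smoothTransition (y / c - 1) = 0 := fun y hy =>
    Real.smoothTransition.zero_of_nonpos (by rw [sub_nonpos, div_le_one hc]; exact hy.le)
  fin_cases k
  · exact absurd rfl hk
  · exact ⟨1, Or.inl rfl, key 1 fun ξ hξ => by
      have := hz ξ (by linarith)
      simp [linePart, this]⟩
  · exact ⟨-1, Or.inr rfl, key (-1) fun ξ hξ => by
      have := hz (-ξ) (by linarith)
      simp [linePart, this]⟩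

/-- A partition of unity on the annulus into tensor products, each localized away from the origin
in one of the coordinates. -/
lemma exists_tens_partition {n : ℕ} (hn : 0 < n) :
    ∃ (A : Finset (Fin n → Fin 3)) (m : (Fin n → Fin 3) → Fin n → ℝ → ℝ) (c : ℝ), 0 < c ∧
      (∀ a k, Smooth (m a k)) ∧ (∀ a k, HasCompactSupport (m a k)) ∧
      (∀ a ∈ A, ∃ (i : Fin n) (s : ℝ), (s = 1 ∨ s = -1) ∧ ∀ ξ ∈ tsupport (m a i), c ≤ s * ξ) ∧
      ∀ ξ : Eucl n, 1 / 2 ≤ ‖ξ‖ → ‖ξ‖ ≤ 2 → ∑ a ∈ A, tens (m a) ξ = 1 := by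
  have hn' : (1 : ℝ) ≤ n := by exact_mod_cast hn
  have hc : 0 < 1 / (4 * (n : ℝ)) := by positivity
  classical
  refine ⟨Finset.univ.erase (fun _ => 0), fun a k => linePart (1 / (4 * (n : ℝ))) (a k),
    1 / (4 * (n : ℝ)), hc, fun a k => smooth_linePart _ _, fun a k => hasCompactSupport_linePart _ _,
    ?_, ?_⟩
  · intro a ha
    have h1 : ∃ i, a i ≠ 0 := by
      by_contra! h
      exact Finset.ne_of_mem_erase ha (funext h)
    obtain ⟨i, hi⟩ := h1
    obtain ⟨s, hs, h⟩ := le_of_mem_tsupport_linePart hc hi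
    exact ⟨i, s, hs, h⟩
  · intro ξ h1 h2
    have hz : tens (fun k => linePart (1 / (4 * (n : ℝ))) 0) ξ = 0 := by
      obtain ⟨i, hi⟩ : ∃ i, 2 * (1 / (4 * (n : ℝ))) ≤ |ξ i| := by
        obtain ⟨i, hi⟩ := exists_abs_coord_max hn ξ
        refine ⟨i, ?_⟩
        rw [mul_one_div, div_le_iff₀ (by positivity)]
        linarith
      exact Finset.prod_eq_zero (Finset.mem_univ i) (linePart_zero_eq_zero hc hi)
    have hone : ∀ k, |ξ k| ≤ 2 := fun k => (PiLp.norm_apply_le ξ k).trans h2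
    have hs := Finset.add_sum_erase Finset.univ
      (fun a : Fin n → Fin 3 => tens (fun k => linePart (1 / (4 * (n : ℝ))) (a k)) ξ)
      (Finset.mem_univ fun _ => 0)
    rw [hz, zero_add] at hs
    rw [hs]
    have hp := Finset.prod_univ_sum (fun _ : Fin n => (Finset.univ : Finset (Fin 3)))
      (fun k a => linePart (1 / (4 * (n : ℝ))) a (ξ k))
    rw [Fintype.piFinset_univ] at hp
    unfold tens
    rw [← hp]
    exact Finset.prod_eq_one fun k _ => sum_linePart _ (hone k)

lemma exists_lintegral_iSup_sum_retPot_le {n : ℕ} (hn : 2 ≤ n) {p : ℝ} (hp : 3 ≤ n → 2 ≤ p)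
    (hp2 : n = 2 → 3 ≤ p) (ε : Fin n → ℝ) (hε : ∀ i, ε i = 1 ∨ ε i = -1) {ι : Type*}
    (A : Finset ι) (m : ι → Fin n → ℝ → ℝ) {c : ℝ} (hc0 : 0 < c) (hm : ∀ a k, Smooth (m a k))
    (hc : ∀ a k, HasCompactSupport (m a k))
    (hsupp : ∀ a ∈ A, ∃ (i : Fin n) (s : ℝ), (s = 1 ∨ s = -1) ∧
      ∀ ξ ∈ tsupport (m a i), c ≤ s * ξ) :
    ∃ C : ℝ≥0, ∀ (G : ℝ × Eucl n → ℂ) (M : ℝ), Continuous G → Integrable G →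
      (∀ q, ‖G q‖ ≤ M) → ∀ e' : Eucl n, ‖e'‖ = 1 →
      ∫⁻ ρ, (⨆ z, ‖∑ a ∈ A, retPot ε (m a) G (slabT e' (ρ, z)).1 (slabT e' (ρ, z)).2‖ₑ) ^ p ≤
        (C * sphSup (fun e => aniNorm 1 2 e G)) ^ p := by
  have hp' : 2 ≤ p := by
    rcases Nat.lt_or_ge 2 n with h | h
    · exact hp h
    · linarith [hp2 (by omega)]
  have h1 : ∀ a ∈ A, ∃ C : ℝ≥0, ∀ (h : ℝ → ℂ) (T : ℝ → ℝ) (x : ℝ → Eucl n), Measurable h →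
      Integrable h → IsCurve T x → ∀ (G : ℝ × Eucl n → ℂ) (M : ℝ), Continuous G → Integrable G →
      (∀ q, ‖G q‖ ≤ M) → ‖∫ ρ, h ρ * retPot ε (m a) G (T ρ) (x ρ)‖ₑ ≤
        dnorm p h * (C * sphSup (fun e => aniNorm 1 2 e G)) := by
    intro a ha
    obtain ⟨i, s, hs, h⟩ := hsupp a ha
    obtain ⟨C, hC⟩ :=
      exists_enorm_integral_mul_retPot_le hn hp hp2 ε hε (m a) (hm a) (hc a) i rfl hs hc0 h
    refine ⟨C, fun h T x hh hhi hTx G M hG hGi hGM => ?_⟩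
    refine (hC h T x hh hhi hTx G M hG hGi hGM).trans ?_
    rw [mul_comm (C : ℝ≥0∞), mul_assoc]
    gcongr
    exact le_iSup₂_of_le (EuclideanSpace.single i (1 : ℝ)) (by simp) le_rfl
  choose! C hC using h1
  refine ⟨∑ a ∈ A, C a, fun G M hG hGi hGM e' he' => ?_⟩
  have hn0 : 0 < n := by omega
  have hb : ∀ a, ∃ N : ℝ, ∀ t x, ‖retPot ε (m a) G t x‖ ≤ N := fun a =>
    exists_norm_retPot_le hn0 ε hε (hm a) (hc a) hGi
  choose N hN using hb
  have hcont : ∀ a, Continuous fun w : ℝ × Eucl n => retPot ε (m a) G w.1 w.2 := fun a =>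
    continuous_retPot hn0 ε hε (hm a) (hc a) hGi
  refine lintegral_iSup_rpow_le_of_linearized hp' he'
    (V := fun w => ∑ a ∈ A, retPot ε (m a) G w.1 w.2) (M := ∑ a ∈ A, N a)
    (continuous_finsetSum _ fun a _ => hcont a) (fun q => norm_sum_le_of_le _ fun a _ => hN a _ _) ?_
  intro h T x hh hhi hTx
  have hTm := hTx.measT
  have hxm := hTx.measx
  have hi : ∀ a ∈ A, Integrable fun ρ => h ρ * retPot ε (m a) G (T ρ) (x ρ) := fun a _ => by
    refine hhi.mul_bdd (c := N a) (Measurable.aestronglyMeasurable ?_)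
      (Eventually.of_forall fun ρ => hN a _ _)
    have h2 : Measurable fun ρ => (T ρ, x ρ) := hTm.prodMk hxm
    simpa only [Function.comp_def] using (hcont a).measurable.comp h2
  simp only [Finset.mul_sum]
  rw [integral_finsetSum _ hi]
  calc _ ≤ ∑ a ∈ A, ‖∫ ρ, h ρ * retPot ε (m a) G (T ρ) (x ρ)‖ₑ := enorm_sum_le _ _
    _ ≤ ∑ a ∈ A, dnorm p h * (C a * sphSup (fun e => aniNorm 1 2 e G)) :=
        Finset.sum_le_sum fun a ha => hC a ha h T x hh hhi hTx G M hG hGi hGM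
    _ = _ := by
        rw [← Finset.mul_sum, ← Finset.sum_mul]
        congr 2
        push_cast
        rfl

lemma ph_sub {n : ℕ} (ε : Fin n → ℝ) (t : ℝ) (x y ξ : Eucl n) :
    ph ε t (x - y) ξ = ph ε t x ξ * cexp (((-2 * Real.pi * inner ℝ y ξ : ℝ) : ℂ) * I) := by
  rw [ph, ph, ← Complex.exp_add, inner_sub_left]
  congr 1
  push_cast
  ring

lemma ph_smul {n : ℕ} (ε : Fin n → ℝ) {l : ℝ} (hl : l ≠ 0) (t : ℝ) (x ξ : Eucl n) :
    ph ε t x (l⁻¹ • ξ) = ph ε ((l ^ 2)⁻¹ * t) (l⁻¹ • x) ξ := by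
  have h : quadSym ε (l⁻¹ • ξ) = (l ^ 2)⁻¹ * quadSym ε ξ := by
    simp only [quadSym, Finset.mul_sum, PiLp.smul_apply, smul_eq_mul]
    refine Finset.sum_congr rfl fun i _ => ?_
    field_simp
  rw [ph, ph, h, inner_smul_left, inner_smul_right]
  congr 4
  ring

/-- Convolution with the kernel is a Fourier multiplier. -/
lemma integral_mul_ker {n : ℕ} (ε : Fin n → ℝ) {m : Fin n → ℝ → ℝ} (hm : ∀ k, Smooth (m k))
    (hc : ∀ k, HasCompactSupport (m k)) {g : Eucl n → ℂ} (hg : Integrable g) (t : ℝ) (x : Eucl n) :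
    ∫ y, g y * ker ε m t (x - y) = ∫ ξ, ph ε t x ξ * (tens m ξ : ℂ) * 𝓕 g ξ := by
  have hIntg : Integrable (fun w : Eucl n × Eucl n =>
      g w.1 * (tens m w.2 : ℂ) * ph ε t (x - w.1) w.2) (volume.prod volume) := by
    refine (hg.mul_prod (integrable_tens hm hc).ofReal).mul_bdd (c := 1) ?_
      (Eventually.of_forall fun w => (norm_ph _ _ _ _).le)
    exact (measurable_ph ε (by fun_prop) (by fun_prop) (by fun_prop)).aestronglyMeasurable
  calc ∫ y, g y * ker ε m t (x - y)
      = ∫ y, ∫ ξ, g y * (tens m ξ : ℂ) * ph ε t (x - y) ξ := by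
        refine integral_congr_ae (Eventually.of_forall fun y => ?_)
        simp only [ker_eq]
        rw [← integral_const_mul]
        refine integral_congr_ae (Eventually.of_forall fun ξ => ?_)
        simp only
        ring
    _ = ∫ ξ, ∫ y, g y * (tens m ξ : ℂ) * ph ε t (x - y) ξ := integral_integral_swap hIntg
    _ = _ := by
        refine integral_congr_ae (Eventually.of_forall fun ξ => ?_)
        simp only
        rw [Real.fourier_eq', ← integral_const_mul]
        refine integral_congr_ae (Eventually.of_forall fun y => ?_)
        simp only [ph_sub, smul_eq_mul]
        ring

lemma fourier_comp_smul {n : ℕ} {l : ℝ} (hl : 0 < l) (g : Eucl n → ℂ) (ξ : Eucl n) :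
    𝓕 (fun y => g (l⁻¹ • y)) ξ = ((l ^ n : ℝ) : ℂ) * 𝓕 g (l • ξ) := by
  rw [Real.fourier_eq', Real.fourier_eq']
  have h := Measure.integral_comp_smul (volume : Measure (Eucl n))
    (fun v => cexp (((-2 * Real.pi * inner ℝ v (l • ξ) : ℝ) : ℂ) * I) • g v) l⁻¹
  rw [finrank_euclideanSpace_fin, abs_of_pos (by positivity), inv_pow, inv_inv] at h
  rw [← Complex.real_smul, ← h]
  refine integral_congr_ae (Eventually.of_forall fun v => ?_)
  simp only
  rw [inner_smul_left, inner_smul_right, conj_trivial, inv_mul_cancel_left₀ hl.ne']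

/-- A frequency localized function is reproduced by the rescaled kernels of a partition. -/
lemma sum_integral_mul_ker {n : ℕ} (ε : Fin n → ℝ) {ι : Type*} (A : Finset ι)
    (m : ι → Fin n → ℝ → ℝ) (hm : ∀ a k, Smooth (m a k)) (hc : ∀ a k, HasCompactSupport (m a k))
    (hA : ∀ ξ : Eucl n, 1 / 2 ≤ ‖ξ‖ → ‖ξ‖ ≤ 2 → ∑ a ∈ A, tens (m a) ξ = 1) {l : ℝ} (hl : 0 < l)
    {g : Eucl n → ℂ} (hg : Integrable g)
    (hg' : ∀ ξ, 𝓕 g ξ ≠ 0 → l / 2 ≤ ‖ξ‖ ∧ ‖ξ‖ ≤ 2 * l) (t : ℝ) (x : Eucl n) :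
    ∑ a ∈ A, ∫ y, g (l⁻¹ • y) * ker ε (m a) t (x - y) =
      ∫ ξ, ph ε ((l ^ 2)⁻¹ * t) (l⁻¹ • x) ξ * 𝓕 g ξ := by
  have hgl : Integrable fun y => g (l⁻¹ • y) := hg.comp_smul (inv_ne_zero hl.ne')
  have hcont : Continuous (𝓕 fun y => g (l⁻¹ • y)) :=
    VectorFourier.fourierIntegral_continuous Real.continuous_fourierChar
      (by exact continuous_inner) hgl
  have hi : ∀ a ∈ A, Integrable fun ξ =>
      ph ε t x ξ * (tens (m a) ξ : ℂ) * 𝓕 (fun y => g (l⁻¹ • y)) ξ := by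
    intro a _
    refine Integrable.mul_bdd (c := ∫ y, ‖g (l⁻¹ • y)‖) ?_ hcont.aestronglyMeasurable
      (Eventually.of_forall fun ξ => VectorFourier.norm_fourierIntegral_le_integral_norm ..)
    refine (integrable_tens (hm a) (hc a)).ofReal.bdd_mul (c := 1) ?_
      (Eventually.of_forall fun ξ => (norm_ph _ _ _ _).le)
    exact (measurable_ph ε measurable_const measurable_const measurable_id).aestronglyMeasurable
  calc _ = ∑ a ∈ A, ∫ ξ, ph ε t x ξ * (tens (m a) ξ : ℂ) * 𝓕 (fun y => g (l⁻¹ • y)) ξ :=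
        Finset.sum_congr rfl fun a _ => integral_mul_ker ε (hm a) (hc a) hgl t x
    _ = ∫ ξ, ∑ a ∈ A, ph ε t x ξ * (tens (m a) ξ : ℂ) * 𝓕 (fun y => g (l⁻¹ • y)) ξ :=
        (integral_finsetSum _ hi).symm
    _ = ∫ ξ, ((l ^ n : ℝ) : ℂ) *
          (ph ε ((l ^ 2)⁻¹ * t) (l⁻¹ • x) (l • ξ) * 𝓕 g (l • ξ)) := by
        refine integral_congr_ae (Eventually.of_forall fun ξ => ?_)
        simp only
        rw [← ph_smul ε hl.ne', inv_smul_smul₀ hl.ne', fourier_comp_smul hl]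
        by_cases h0 : 𝓕 g (l • ξ) = 0
        · simp [h0]
        · obtain ⟨h1, h2⟩ := hg' _ h0
          rw [norm_smul, Real.norm_of_nonneg hl.le] at h1 h2
          have h3 := hA ξ (by nlinarith) (by nlinarith)
          have h4 : ∑ a ∈ A, (tens (m a) ξ : ℂ) = 1 := by exact_mod_cast h3
          rw [← Finset.sum_mul, ← Finset.mul_sum, h4]
          ring
    _ = _ := by
        rw [integral_const_mul]
        have h := Measure.integral_comp_smul (volume : Measure (Eucl n))
          (fun ξ => ph ε ((l ^ 2)⁻¹ * t) (l⁻¹ • x) ξ * 𝓕 g ξ) l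
        rw [finrank_euclideanSpace_fin, abs_of_pos (by positivity)] at h
        rw [h, Complex.real_smul, ← mul_assoc, ← Complex.ofReal_mul,
          mul_inv_cancel₀ (by positivity), Complex.ofReal_one, one_mul]

lemma norm_iteratedFDeriv_slice_le {n : ℕ} (F : SchwartzMap (ℝ × Eucl n) ℂ) (s : ℝ) (l : ℕ)
    (y : Eucl n) :
    ‖iteratedFDeriv ℝ l (fun y => F (s, y)) y‖ ≤ ‖iteratedFDeriv ℝ l F (s, y)‖ := by
  have hg : ContDiff ℝ l fun z => F ((s, (0 : Eucl n)) + z) :=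
    (F.smooth l).comp (contDiff_const.add contDiff_id)
  have h1 : (fun y => F (s, y)) =
      (fun z => F ((s, (0 : Eucl n)) + z)) ∘ ContinuousLinearMap.inr ℝ ℝ (Eucl n) := by
    ext y
    simp
  rw [h1, ContinuousLinearMap.iteratedFDeriv_comp_right _ hg y le_rfl]
  refine (ContinuousMultilinearMap.norm_compContinuousLinearMap_le _ _).trans ?_
  rw [iteratedFDeriv_comp_add_left]
  have h2 : (s, (0 : Eucl n)) + ContinuousLinearMap.inr ℝ ℝ (Eucl n) y = (s, y) := by simp
  rw [h2]
  refine mul_le_of_le_one_right (norm_nonneg _) (Finset.prod_le_one (fun _ _ => norm_nonneg _)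
    fun _ _ => ContinuousLinearMap.norm_inr_le_one ℝ ℝ (Eucl n))

lemma pow_mul_norm_iteratedFDeriv_slice_le {n : ℕ} (F : SchwartzMap (ℝ × Eucl n) ℂ) (s : ℝ)
    (k l : ℕ) (y : Eucl n) :
    ‖y‖ ^ k * ‖iteratedFDeriv ℝ l (fun y => F (s, y)) y‖ ≤ SchwartzMap.seminorm ℝ k l F := by
  refine le_trans ?_ (SchwartzMap.le_seminorm ℝ k l F (s, y))
  gcongr
  · exact norm_snd_le (s, y)
  · exact norm_iteratedFDeriv_slice_le F s l y

/-- A time slice of a Schwartz function. -/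
def slice {n : ℕ} (F : SchwartzMap (ℝ × Eucl n) ℂ) (s : ℝ) : SchwartzMap (Eucl n) ℂ where
  toFun y := F (s, y)
  smooth' := (F.smooth ⊤).comp (contDiff_const.prodMk contDiff_id)
  decay' k l := ⟨_, pow_mul_norm_iteratedFDeriv_slice_le F s k l⟩

lemma slice_coe {n : ℕ} (F : SchwartzMap (ℝ × Eucl n) ℂ) (s : ℝ) :
    ⇑(slice F s) = fun y => F (s, y) := rfl

lemma exists_norm_fourier_slice_le {n : ℕ} (F : SchwartzMap (ℝ × Eucl n) ℂ) :
    ∃ C : ℝ, 0 ≤ C ∧ ∀ s ξ, ‖𝓕 (fun y => F (s, y)) ξ‖ ≤ C * (1 + ‖ξ‖) ^ (-(n + 1 : ℝ)) := by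
  obtain ⟨N, D, hD⟩ : ∃ (N : Finset (ℕ × ℕ)) (D : ℝ≥0), ∀ f : SchwartzMap (Eucl n) ℂ,
      ((Finset.Iic (n + 1, 0)).sup fun m => SchwartzMap.seminorm ℂ m.1 m.2) (𝓕 f) ≤
        D * (N.sup fun m => SchwartzMap.seminorm ℂ m.1 m.2) f := by
    have hcont : Continuous (((Finset.Iic ((n + 1, 0) : ℕ × ℕ)).sup
        (schwartzSeminormFamily ℂ (Eucl n) ℂ)).comp
        (FourierTransform.fourierCLM ℂ (SchwartzMap (Eucl n) ℂ)).toLinearMap) := by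
      have h1 : Continuous (fun x => ((Finset.Iic ((n + 1, 0) : ℕ × ℕ)).sup
          (schwartzSeminormFamily ℂ (Eucl n) ℂ)) x) :=
        Seminorm.continuous_finsetSup fun i _ =>
          (schwartz_withSeminorms ℂ (Eucl n) ℂ).continuous_seminorm i
      exact h1.comp (FourierTransform.fourierCLM ℂ (SchwartzMap (Eucl n) ℂ)).continuous
    obtain ⟨N, D, -, h⟩ := Seminorm.bound_of_continuous
      (schwartz_withSeminorms ℂ (Eucl n) ℂ) _ hcont
    exact ⟨N, D, fun f => h f⟩
  have hS : ∀ s, (N.sup fun m => SchwartzMap.seminorm ℂ m.1 m.2) (slice F s) ≤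
      ∑ m ∈ N, SchwartzMap.seminorm ℝ m.1 m.2 F := by
    intro s
    refine Seminorm.finset_sup_apply_le (Finset.sum_nonneg fun _ _ => apply_nonneg _ _)
      fun m hm => ?_
    refine le_trans ?_ (Finset.single_le_sum (f := fun m : ℕ × ℕ => SchwartzMap.seminorm ℝ m.1 m.2 F)
      (fun _ _ => apply_nonneg _ _) hm)
    exact SchwartzMap.seminorm_le_bound ℂ _ _ _ (apply_nonneg _ _)
      (pow_mul_norm_iteratedFDeriv_slice_le F s m.1 m.2)
  refine ⟨2 ^ (n + 1) * (D * ∑ m ∈ N, SchwartzMap.seminorm ℝ m.1 m.2 F), ?_, fun s ξ => ?_⟩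
  · have := Finset.sum_nonneg (s := N) fun (m : ℕ × ℕ) _ =>
      apply_nonneg (SchwartzMap.seminorm ℝ m.1 m.2) F
    positivity
  have h := SchwartzMap.one_add_le_sup_seminorm_apply (𝕜 := ℂ) (m := (n + 1, 0)) (k := n + 1)
    (n := 0) le_rfl le_rfl (𝓕 (slice F s)) ξ
  rw [norm_iteratedFDeriv_zero, SchwartzMap.fourier_coe, slice_coe] at h
  rw [Real.rpow_neg (by positivity), ← div_eq_mul_inv, le_div_iff₀ (by positivity), mul_comm]
  have h3 : (1 + ‖ξ‖) ^ (n + 1 : ℝ) = (1 + ‖ξ‖) ^ (n + 1) := by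
    rw [← Real.rpow_natCast]
    push_cast
    rfl
  rw [h3]
  refine h.trans ?_
  gcongr
  refine (hD _).trans ?_
  gcongr
  exact hS s

lemma exists_norm_schwartz_le {n : ℕ} (F : SchwartzMap (ℝ × Eucl n) ℂ) :
    ∃ C : ℝ, 0 ≤ C ∧ ∀ s y,
      ‖F (s, y)‖ ≤ C * ((1 + ‖s‖) ^ (-2 : ℝ) * (1 + ‖y‖) ^ (-(n + 1 : ℝ))) := by
  refine ⟨2 ^ (n + 3) * ((Finset.Iic (n + 3, 0)).sup fun m => SchwartzMap.seminorm ℝ m.1 m.2) F,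
    by positivity, fun s y => ?_⟩
  have h := SchwartzMap.one_add_le_sup_seminorm_apply (𝕜 := ℝ) (m := (n + 3, 0)) (k := n + 3)
    (n := 0) le_rfl le_rfl F (s, y)
  rw [norm_iteratedFDeriv_zero] at h
  rw [Real.rpow_neg (by positivity), Real.rpow_neg (by positivity), ← mul_inv, ← div_eq_mul_inv,
    le_div_iff₀ (by positivity), mul_comm]
  refine le_trans ?_ h
  have h3 : (1 + ‖y‖) ^ (n + 1 : ℝ) = (1 + ‖y‖) ^ (n + 1) := by
    rw [← Real.rpow_natCast]
    push_cast
    rfl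
  have h4 : (1 + ‖s‖) ^ (2 : ℝ) = (1 + ‖s‖) ^ 2 := by
    rw [← Real.rpow_natCast]
    norm_num
  rw [h3, h4, pow_add _ n 3, show (1 + ‖(s, y)‖) ^ n * (1 + ‖(s, y)‖) ^ 3 =
    (1 + ‖(s, y)‖) ^ 2 * (1 + ‖(s, y)‖) ^ (n + 1) by ring]
  gcongr
  · exact norm_fst_le (s, y)
  · exact norm_snd_le (s, y)

lemma integrable_one_add_norm_eucl (n : ℕ) :
    Integrable fun y : Eucl n => (1 + ‖y‖) ^ (-(n + 1 : ℝ)) :=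
  integrable_one_add_norm (by rw [finrank_euclideanSpace_fin]; linarith)

lemma continuous_fourier_slice {n : ℕ} (F : SchwartzMap (ℝ × Eucl n) ℂ) :
    Continuous fun w : ℝ × Eucl n => 𝓕 (fun y => F (w.1, y)) w.2 := by
  obtain ⟨C, hC, h⟩ := exists_norm_schwartz_le F
  simp only [Real.fourier_eq']
  refine continuous_of_dominated (bound := fun y => C * (1 + ‖y‖) ^ (-(n + 1 : ℝ)))
    (fun w => ?_) (fun w => Eventually.of_forall fun y => ?_)
    ((integrable_one_add_norm_eucl n).const_mul C) (Eventually.of_forall fun y => ?_)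
  · exact Continuous.aestronglyMeasurable (by fun_prop)
  · rw [norm_smul, norm_exp_ofReal_mul_I, one_mul]
    refine (h w.1 y).trans (mul_le_mul_of_nonneg_left ?_ hC)
    refine mul_le_of_le_one_left (by positivity) ?_
    exact Real.rpow_le_one_of_one_le_of_nonpos (by linarith [norm_nonneg w.1]) (by norm_num)
  · fun_prop

/-- The symbol of the Littlewood–Paley projection. -/
def psiSym {n : ℕ} (χ : ℝ → ℝ) (j : ℤ) (ξ : Eucl n) : ℂ :=
  (psiR χ ((2 : ℝ) ^ (-j) * ‖ξ‖) : ℂ)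

lemma psiR_eq_zero {χ : ℝ → ℝ} (hχ : IsBump χ) {s : ℝ} (h : |s| ≤ 1 / 2 ∨ 2 ≤ |s|) :
    psiR χ s = 0 := by
  rcases h with h | h
  · rw [psiR, hχ.one _ (by rw [abs_abs]; linarith),
      hχ.one _ (by rw [abs_mul, abs_abs, abs_two]; linarith), sub_self]
  · rw [psiR, hχ.supp _ (by rwa [abs_abs]),
      hχ.supp _ (by rw [abs_mul, abs_abs, abs_two]; linarith), sub_self]

lemma psiSym_ne_zero {n : ℕ} {χ : ℝ → ℝ} (hχ : IsBump χ) {j : ℤ} {ξ : Eucl n}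
    (h : psiSym χ j ξ ≠ 0) : (2 : ℝ) ^ j / 2 ≤ ‖ξ‖ ∧ ‖ξ‖ ≤ 2 * (2 : ℝ) ^ j := by
  have hl : (0 : ℝ) < 2 ^ j := by positivity
  have h1 : |(2 : ℝ) ^ (-j) * ‖ξ‖| = ‖ξ‖ / 2 ^ j := by
    rw [abs_of_nonneg (by positivity), zpow_neg, div_eq_inv_mul]
  by_contra hcon
  refine h ?_
  rw [psiSym, psiR_eq_zero hχ, Complex.ofReal_zero]
  rw [h1, div_le_iff₀ hl, le_div_iff₀ hl]
  by_contra! h2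
  exact hcon ⟨by linarith [h2.1], by linarith [h2.2]⟩

lemma contDiff_psiSym {n : ℕ} {χ : ℝ → ℝ} (hχ : IsBump χ) (j : ℤ) :
    ContDiff ℝ ((⊤ : ℕ∞) : WithTop ℕ∞) (psiSym χ j : Eucl n → ℂ) := by
  have hs : ContDiff ℝ ((⊤ : ℕ∞) : WithTop ℕ∞) χ := contDiff_infty.2 hχ.smooth
  rw [contDiff_iff_contDiffAt]
  intro ξ
  rcases eq_or_ne ξ 0 with rfl | hξ
  · have h0 : (psiSym χ j : Eucl n → ℂ) =ᶠ[𝓝 0] fun _ => 0 := by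
      filter_upwards [Metric.ball_mem_nhds (0 : Eucl n)
        (show (0 : ℝ) < 2 ^ j / 2 by positivity)] with η hη
      by_contra h
      have := (psiSym_ne_zero hχ h).1
      rw [mem_ball_zero_iff] at hη
      linarith
    exact contDiffAt_const.congr_of_eventuallyEq h0
  · have h1 : (psiSym χ j : Eucl n → ℂ) = fun ξ =>
        ((χ ((2 : ℝ) ^ (-j) * ‖ξ‖) - χ (2 * ((2 : ℝ) ^ (-j) * ‖ξ‖)) : ℝ) : ℂ) := by
      ext η
      rw [psiSym, psiR, abs_of_nonneg (by positivity)]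
    rw [h1]
    have hn : ContDiffAt ℝ ((⊤ : ℕ∞) : WithTop ℕ∞) (fun η : Eucl n => (2 : ℝ) ^ (-j) * ‖η‖) ξ :=
      contDiffAt_const.mul (contDiffAt_norm ℝ hξ)
    exact Complex.ofRealCLM.contDiff.contDiffAt.comp ξ
      ((hs.contDiffAt.comp ξ hn).sub (hs.contDiffAt.comp ξ (contDiffAt_const.mul hn)))

lemma hasCompactSupport_psiSym {n : ℕ} {χ : ℝ → ℝ} (hχ : IsBump χ) (j : ℤ) :
    HasCompactSupport (psiSym χ j : Eucl n → ℂ) := by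
  refine HasCompactSupport.of_support_subset_isCompact
    (isCompact_closedBall 0 (2 * (2 : ℝ) ^ j)) fun ξ hξ => ?_
  rw [mem_closedBall_zero_iff]
  exact (psiSym_ne_zero hχ hξ).2

/-- A Schwartz function times the Littlewood–Paley symbol. -/
def locSym {n : ℕ} {χ : ℝ → ℝ} (hχ : IsBump χ) (j : ℤ) (f : SchwartzMap (Eucl n) ℂ) :
    SchwartzMap (Eucl n) ℂ :=
  HasCompactSupport.toSchwartzMap (f := fun ξ => psiSym χ j ξ * f ξ)
    (hasCompactSupport_psiSym hχ j).mul_right ((contDiff_psiSym hχ j).mul (f.smooth ⊤))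

/-- The convolution kernel of the Littlewood–Paley projection. -/
def psiKer {n : ℕ} {χ : ℝ → ℝ} (hχ : IsBump χ) (j : ℤ) : SchwartzMap (Eucl n) ℂ :=
  𝓕⁻ ((hasCompactSupport_psiSym hχ j).toSchwartzMap (contDiff_psiSym hχ j))

lemma projT_eq_locSym {n : ℕ} {χ : ℝ → ℝ} (hχ : IsBump χ) (j : ℤ)
    (F : SchwartzMap (ℝ × Eucl n) ℂ) (s : ℝ) :
    (fun y => projT χ j (fun q => F q) (s, y)) =
      ⇑(𝓕⁻ (locSym hχ j (𝓕 (slice F s))) : SchwartzMap (Eucl n) ℂ) := by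
  rw [SchwartzMap.fourierInv_coe]
  ext y
  simp only [projT, proj, mulOp]
  congr 1

lemma fourier_projT {n : ℕ} {χ : ℝ → ℝ} (hχ : IsBump χ) (j : ℤ)
    (F : SchwartzMap (ℝ × Eucl n) ℂ) (s : ℝ) (ξ : Eucl n) :
    𝓕 (fun y => projT χ j (fun q => F q) (s, y)) ξ =
      psiSym χ j ξ * 𝓕 (fun y => F (s, y)) ξ := by
  rw [projT_eq_locSym hχ, ← SchwartzMap.fourier_coe, FourierTransform.fourier_fourierInv_eq]
  change psiSym χ j ξ * (𝓕 (slice F s)) ξ = _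
  rw [SchwartzMap.fourier_coe]
  rfl

lemma projT_eq_integral {n : ℕ} {χ : ℝ → ℝ} (hχ : IsBump χ) (j : ℤ)
    (F : SchwartzMap (ℝ × Eucl n) ℂ) (s : ℝ) (y : Eucl n) :
    projT χ j (fun q => F q) (s, y) = ∫ y', F (s, y') * psiKer hχ j (y - y') := by
  have hsm : ContDiff ℝ ((⊤ : ℕ∞) : WithTop ℕ∞) fun ξ : Eucl n =>
      psiSym χ j ξ * cexp (((2 * Real.pi * inner ℝ ξ y : ℝ) : ℂ) * I) := by
    refine (contDiff_psiSym hχ j).mul (Complex.contDiff_exp.comp ?_)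
    refine ContDiff.mul (Complex.ofRealCLM.contDiff.comp ?_) contDiff_const
    exact contDiff_const.mul (contDiff_id.inner ℝ contDiff_const)
  have h := SchwartzMap.integral_fourier_mul_eq (slice F s)
    (HasCompactSupport.toSchwartzMap ((hasCompactSupport_psiSym hχ j).mul_right) hsm)
  rw [SchwartzMap.fourier_coe] at h
  simp only [SchwartzMap.fourier_coe] at h
  have h1 : projT χ j (fun q => F q) (s, y) = ∫ ξ, 𝓕 (slice F s) ξ *
      (psiSym χ j ξ * cexp (((2 * Real.pi * inner ℝ ξ y : ℝ) : ℂ) * I)) := by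
    simp only [projT, proj, mulOp]
    rw [Real.fourierInv_eq']
    refine integral_congr_ae (Eventually.of_forall fun ξ => ?_)
    simp only [SchwartzMap.fourier_coe, slice_coe, smul_eq_mul, psiSym]
    ring
  rw [h1]
  refine Eq.trans ?_ (h.trans ?_)
  · rfl
  refine integral_congr_ae (Eventually.of_forall fun y' => ?_)
  simp only [psiKer, SchwartzMap.fourierInv_coe, slice_coe]
  congr 1
  rw [Real.fourier_eq', Real.fourierInv_eq']
  refine integral_congr_ae (Eventually.of_forall fun ξ => ?_)
  simp only [HasCompactSupport.toSchwartzMap_toFun, smul_eq_mul, inner_sub_right, Pi.mul_apply]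
  rw [mul_left_comm, ← Complex.exp_add, mul_comm]
  congr 2
  push_cast
  ring

lemma integrable_projT_slice {n : ℕ} {χ : ℝ → ℝ} (hχ : IsBump χ) (j : ℤ)
    (F : SchwartzMap (ℝ × Eucl n) ℂ) (s : ℝ) :
    Integrable fun y => projT χ j (fun q => F q) (s, y) := by
  rw [projT_eq_locSym hχ]
  exact SchwartzMap.integrable _

lemma continuous_projT {n : ℕ} {χ : ℝ → ℝ} (hχ : IsBump χ) (j : ℤ)
    (F : SchwartzMap (ℝ × Eucl n) ℂ) : Continuous (projT χ j fun q => F q) := by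
  obtain ⟨C, hC, h⟩ := exists_norm_schwartz_le F
  obtain ⟨K, hK0, hK⟩ := (psiKer (n := n) hχ j).decay 0 0
  simp only [pow_zero, one_mul, norm_iteratedFDeriv_zero] at hK
  have he : (projT χ j fun q => F q) =
      fun w : ℝ × Eucl n => ∫ y', F (w.1, y') * psiKer hχ j (w.2 - y') := by
    ext w
    exact projT_eq_integral hχ j F w.1 w.2
  rw [he]
  refine continuous_of_dominated (bound := fun y => C * (1 + ‖y‖) ^ (-(n + 1 : ℝ)) * K)
    (fun w => ?_) (fun w => Eventually.of_forall fun y => ?_)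
    (((integrable_one_add_norm_eucl n).const_mul C).mul_const K) (Eventually.of_forall fun y => ?_)
  · exact Continuous.aestronglyMeasurable (by fun_prop)
  · rw [norm_mul]
    refine mul_le_mul ?_ (hK _) (norm_nonneg _) (by positivity)
    refine (h w.1 y).trans (mul_le_mul_of_nonneg_left ?_ hC)
    refine mul_le_of_le_one_left (by positivity) ?_
    exact Real.rpow_le_one_of_one_le_of_nonpos (by linarith [norm_nonneg w.1]) (by norm_num)
  · fun_prop

lemma exists_norm_projT_le {n : ℕ} {χ : ℝ → ℝ} (hχ : IsBump χ) (j : ℤ)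
    (F : SchwartzMap (ℝ × Eucl n) ℂ) : ∃ (C : ℝ) (h : Eucl n → ℝ), 0 ≤ C ∧ Integrable h ∧
      (∃ M, ∀ y, h y ≤ M) ∧
      ∀ s y, 0 ≤ h y ∧ ‖projT χ j (fun q => F q) (s, y)‖ ≤ C * ((1 + ‖s‖) ^ (-2 : ℝ) * h y) := by
  obtain ⟨C, hC, h⟩ := exists_norm_schwartz_le F
  obtain ⟨K, hK0, hK⟩ := (psiKer (n := n) hχ j).decay 0 0
  simp only [pow_zero, one_mul, norm_iteratedFDeriv_zero] at hK
  set w : Eucl n → ℝ := fun y => (1 + ‖y‖) ^ (-(n + 1 : ℝ)) with hw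
  have hw0 : ∀ y, 0 ≤ w y := fun y => by positivity
  have hwi : Integrable w := integrable_one_add_norm_eucl n
  have hKi : Integrable fun y => ‖psiKer (n := n) hχ j y‖ :=
    (SchwartzMap.integrable (psiKer hχ j)).norm
  have hKc : Continuous fun y => ‖psiKer (n := n) hχ j y‖ := (psiKer hχ j).continuous.norm
  have hi : ∀ y, Integrable fun y' => w y' * ‖psiKer hχ j (y - y')‖ := fun y => by
    refine hwi.mul_bdd (c := K) (Continuous.aestronglyMeasurable (by fun_prop))
      (Eventually.of_forall fun y' => ?_)
    rw [norm_norm]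
    exact hK _
  refine ⟨C, fun y => ∫ y', w y' * ‖psiKer hχ j (y - y')‖, hC, ?_, ⟨∫ y', w y' * K, fun y => ?_⟩,
    fun s y => ⟨?_, ?_⟩⟩
  · exact hwi.integrable_convolution (ContinuousLinearMap.mul ℝ ℝ) hKi
  · exact integral_mono (hi y) (hwi.mul_const K) fun y' =>
      mul_le_mul_of_nonneg_left (hK _) (hw0 _)
  · exact integral_nonneg fun y' => mul_nonneg (hw0 _) (norm_nonneg _)
  · rw [projT_eq_integral hχ, ← integral_const_mul, ← integral_const_mul]
    refine norm_integral_le_of_norm_le (((hi y).const_mul _).const_mul C)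
      (Eventually.of_forall fun y' => ?_)
    rw [norm_mul]
    refine (mul_le_mul_of_nonneg_right (h s y') (norm_nonneg _)).trans_eq ?_
    ring

lemma integrable_one_add_norm_real : Integrable fun s : ℝ => (1 + ‖s‖) ^ (-2 : ℝ) :=
  integrable_one_add_norm (by simp)

lemma integrable_projT {n : ℕ} {χ : ℝ → ℝ} (hχ : IsBump χ) (j : ℤ)
    (F : SchwartzMap (ℝ × Eucl n) ℂ) : Integrable (projT χ j fun q => F q) := by
  obtain ⟨C, h, -, hi, -, hb⟩ := exists_norm_projT_le hχ j F
  refine Integrable.mono' ((integrable_one_add_norm_real.mul_prod hi).const_mul C)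
    (continuous_projT hχ j F).aestronglyMeasurable (Eventually.of_forall fun w => ?_)
  exact (hb w.1 w.2).2

lemma exists_bound_projT {n : ℕ} {χ : ℝ → ℝ} (hχ : IsBump χ) (j : ℤ)
    (F : SchwartzMap (ℝ × Eucl n) ℂ) : ∃ M, ∀ q, ‖projT χ j (fun q => F q) q‖ ≤ M := by
  obtain ⟨C, h, hC, -, ⟨M, hM⟩, hb⟩ := exists_norm_projT_le hχ j F
  refine ⟨C * M, fun q => (hb q.1 q.2).2.trans (mul_le_mul_of_nonneg_left ?_ hC)⟩
  refine (mul_le_of_le_one_left (hb q.1 q.2).1 ?_).trans (hM q.2)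
  exact Real.rpow_le_one_of_one_le_of_nonpos (by linarith [norm_nonneg q.1]) (by norm_num)

lemma ret_of_nonneg {t : ℝ} (ht : 0 ≤ t) (s : ℝ) :
    ret t s = (Set.Ioc 0 t).indicator (fun _ => 1) s := by
  have h : ¬ (t < s ∧ s ≤ 0) := fun h => by linarith [h.1, h.2]
  simp only [ret, if_neg h, sub_zero, Set.indicator, Set.mem_Ioc]

lemma ret_of_nonpos {t : ℝ} (ht : t ≤ 0) (s : ℝ) :
    ret t s = -(Set.Ioc t 0).indicator (fun _ => 1) s := by
  have h : ¬ (0 < s ∧ s ≤ t) := fun h => by linarith [h.1, h.2]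
  simp only [ret, if_neg h, zero_sub, Set.indicator, Set.mem_Ioc]

lemma integrable_ret (t : ℝ) : Integrable (ret t) := by
  rcases le_total 0 t with ht | ht
  · rw [funext (ret_of_nonneg ht)]
    exact (integrable_indicator_iff measurableSet_Ioc).2 (integrableOn_const (by simp))
  · rw [funext (ret_of_nonpos ht)]
    exact ((integrable_indicator_iff measurableSet_Ioc).2 (integrableOn_const (by simp))).neg

lemma intervalIntegral_eq_integral_ret (t : ℝ) (f : ℝ → ℂ) :
    ∫ s in (0 : ℝ)..t, f s = ∫ s, (ret t s : ℂ) * f s := by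
  rcases le_total 0 t with ht | ht
  · rw [intervalIntegral.integral_of_le ht, ← integral_indicator measurableSet_Ioc]
    refine integral_congr_ae (Eventually.of_forall fun s => ?_)
    simp only [ret_of_nonneg ht, Set.indicator]
    split_ifs <;> simp
  · rw [intervalIntegral.integral_of_ge ht, ← integral_indicator measurableSet_Ioc,
      ← integral_neg]
    refine integral_congr_ae (Eventually.of_forall fun s => ?_)
    simp only [ret_of_nonpos ht, Set.indicator]
    split_ifs <;> simp

lemma ret_smul {c : ℝ} (hc : 0 < c) (t s : ℝ) : ret t (c⁻¹ * s) = ret (c * t) s := by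
  have h1 : 0 < c⁻¹ * s ↔ 0 < s := by
    rw [mul_pos_iff_of_pos_left (by positivity)]
  have h2 : c⁻¹ * s ≤ t ↔ s ≤ c * t := inv_mul_le_iff₀ hc
  have h3 : t < c⁻¹ * s ↔ c * t < s := lt_inv_mul_iff₀ hc
  have h4 : c⁻¹ * s ≤ 0 ↔ s ≤ 0 := by
    rw [← not_lt, h1, not_lt]
  simp only [ret, h1, h2, h3, h4]

lemma ph_eq {n : ℕ} (ε : Fin n → ℝ) (t : ℝ) (x ξ : Eucl n) :
    ph ε t x ξ = cexp (((2 * Real.pi * inner ℝ ξ x : ℝ) : ℂ) * I) *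
      cexp (-I * t * quadSym ε ξ) := by
  rw [ph, ← Complex.exp_add, real_inner_comm]
  congr 1
  push_cast
  ring

/-- The spatial Fourier transform of the retarded integral. -/
def duhamelFourier {n : ℕ} (ε : Fin n → ℝ) (F : SchwartzMap (ℝ × Eucl n) ℂ) (t : ℝ)
    (ξ : Eucl n) : ℂ :=
  ∫ s, (ret t s : ℂ) * (cexp (-I * (t - s : ℝ) * quadSym ε ξ) * 𝓕 (fun y => F (s, y)) ξ)

lemma norm_cexp_quadSym {n : ℕ} (ε : Fin n → ℝ) (t : ℝ) (ξ : Eucl n) :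
    ‖cexp (-I * t * quadSym ε ξ)‖ = 1 := by
  rw [Complex.norm_exp]
  simp

lemma integrable_duhamelFourier_kernel {n : ℕ} (ε : Fin n → ℝ) (F : SchwartzMap (ℝ × Eucl n) ℂ)
    (t : ℝ) : Integrable (fun w : ℝ × Eucl n => (ret t w.1 : ℂ) *
      (cexp (-I * (t - w.1 : ℝ) * quadSym ε w.2) * 𝓕 (fun y => F (w.1, y)) w.2))
      (volume.prod volume) := by
  obtain ⟨C, hC, h⟩ := exists_norm_fourier_slice_le F
  refine Integrable.mono' ((integrable_ret t).norm.mul_prod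
    ((integrable_one_add_norm_eucl n).const_mul C)) ?_ (Eventually.of_forall fun w => ?_)
  · refine AEStronglyMeasurable.mul ?_ (Continuous.aestronglyMeasurable ?_)
    · exact (Complex.measurable_ofReal.comp
        (measurable_ret measurable_const measurable_fst)).aestronglyMeasurable
    · exact Continuous.mul (by fun_prop) (continuous_fourier_slice F)
  · rw [norm_mul, norm_mul, norm_cexp_quadSym, one_mul, Complex.norm_real]
    exact mul_le_mul_of_nonneg_left (h _ _) (norm_nonneg _)

lemma integrable_duhamelFourier {n : ℕ} (ε : Fin n → ℝ) (F : SchwartzMap (ℝ × Eucl n) ℂ)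
    (t : ℝ) : Integrable (duhamelFourier ε F t) :=
  (integrable_duhamelFourier_kernel ε F t).integral_prod_right

lemma continuous_duhamelFourier {n : ℕ} (ε : Fin n → ℝ) (F : SchwartzMap (ℝ × Eucl n) ℂ)
    (t : ℝ) : Continuous (duhamelFourier ε F t) := by
  obtain ⟨C, hC, h⟩ := exists_norm_fourier_slice_le F
  refine continuous_of_dominated (bound := fun s => ‖ret t s‖ * C)
    (fun ξ => ?_) (fun ξ => Eventually.of_forall fun s => ?_)
    ((integrable_ret t).norm.mul_const C) (Eventually.of_forall fun s => ?_)
  · refine AEStronglyMeasurable.mul ?_ (Continuous.aestronglyMeasurable ?_)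
    · exact (Complex.measurable_ofReal.comp
        (measurable_ret measurable_const measurable_id)).aestronglyMeasurable
    · refine Continuous.mul (by fun_prop) ?_
      simpa only [Function.comp_def, id] using (continuous_fourier_slice F).comp
        (continuous_id.prodMk (continuous_const (y := ξ)))
  · rw [norm_mul, norm_mul, norm_cexp_quadSym, one_mul, Complex.norm_real]
    refine mul_le_mul_of_nonneg_left ((h _ _).trans (mul_le_of_le_one_right hC ?_)) (norm_nonneg _)
    exact Real.rpow_le_one_of_one_le_of_nonpos (by linarith [norm_nonneg ξ])
      (by linarith [n.cast_nonneg (α := ℝ)])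
  · refine continuous_const.mul (Continuous.mul (by fun_prop) ?_)
    simpa only [Function.comp_def, id] using (continuous_fourier_slice F).comp
      ((continuous_const (y := s)).prodMk continuous_id)

lemma integral_ret_ph {n : ℕ} (ε : Fin n → ℝ) (F : SchwartzMap (ℝ × Eucl n) ℂ) {b : Eucl n → ℂ}
    (hb : Continuous b) {M : ℝ} (hM : ∀ ξ, ‖b ξ‖ ≤ M) (t : ℝ) (x : Eucl n) :
    ∫ s, (ret t s : ℂ) * ∫ ξ, ph ε (t - s) x ξ * (b ξ * 𝓕 (fun y => F (s, y)) ξ) =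
      𝓕⁻ (fun ξ => b ξ * duhamelFourier ε F t ξ) x := by
  have hi : Integrable (fun w : ℝ × Eucl n =>
      cexp (((2 * Real.pi * inner ℝ w.2 x : ℝ) : ℂ) * I) * b w.2 * ((ret t w.1 : ℂ) *
      (cexp (-I * (t - w.1 : ℝ) * quadSym ε w.2) * 𝓕 (fun y => F (w.1, y)) w.2)))
      (volume.prod volume) := by
    refine (integrable_duhamelFourier_kernel ε F t).bdd_mul (c := M)
      (Continuous.aestronglyMeasurable (by fun_prop)) (Eventually.of_forall fun w => ?_)
    rw [norm_mul, norm_exp_ofReal_mul_I, one_mul]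
    exact hM _
  rw [Real.fourierInv_eq']
  calc _ = ∫ s, ∫ ξ, cexp (((2 * Real.pi * inner ℝ ξ x : ℝ) : ℂ) * I) * b ξ * ((ret t s : ℂ) *
        (cexp (-I * (t - s : ℝ) * quadSym ε ξ) * 𝓕 (fun y => F (s, y)) ξ)) := by
        refine integral_congr_ae (Eventually.of_forall fun s => ?_)
        simp only
        rw [← integral_const_mul]
        refine integral_congr_ae (Eventually.of_forall fun ξ => ?_)
        simp only [ph_eq]
        ring
    _ = _ := integral_integral_swap hi
    _ = _ := by
        refine integral_congr_ae (Eventually.of_forall fun ξ => ?_)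
        simp only
        rw [integral_const_mul, duhamelFourier, smul_eq_mul, mul_assoc]

lemma duhamel_eq_fourierInv {n : ℕ} (ε : Fin n → ℝ) (F : SchwartzMap (ℝ × Eucl n) ℂ) (t : ℝ)
    (x : Eucl n) : duhamel ε (fun q => F q) (t, x) = 𝓕⁻ (duhamelFourier ε F t) x := by
  have h := integral_ret_ph ε F (b := fun _ => 1) continuous_const (M := 1) (by simp) t x
  simp only [one_mul] at h
  change _ = 𝓕⁻ (fun ξ => duhamelFourier ε F t ξ) x
  rw [← h, duhamel, intervalIntegral_eq_integral_ret]
  refine integral_congr_ae (Eventually.of_forall fun s => ?_)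
  simp only [prop, mulOp]
  rw [Real.fourierInv_eq']
  congr 1
  refine integral_congr_ae (Eventually.of_forall fun ξ => ?_)
  simp only [ph_eq, smul_eq_mul, Complex.ofReal_sub]
  ring

lemma projT_duhamel_eq {n : ℕ} (ε : Fin n → ℝ) (χ : ℝ → ℝ) (j : ℤ)
    (F : SchwartzMap (ℝ × Eucl n) ℂ) (t : ℝ) (x : Eucl n) :
    projT χ j (fun q => -I * duhamel ε (fun q' => F q') q) (t, x) =
      -I * 𝓕⁻ (fun ξ => psiSym χ j ξ * 𝓕 (𝓕⁻ (duhamelFourier ε F t)) ξ) x := by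
  have h1 : ∀ ξ, 𝓕 (fun y => -I * duhamel ε (fun q' => F q') (t, y)) ξ =
      -I * 𝓕 (𝓕⁻ (duhamelFourier ε F t)) ξ := by
    intro ξ
    rw [Real.fourier_eq', Real.fourier_eq', ← integral_const_mul]
    refine integral_congr_ae (Eventually.of_forall fun y => ?_)
    simp only [duhamel_eq_fourierInv, smul_eq_mul]
    ring
  simp only [projT, proj, mulOp]
  rw [Real.fourierInv_eq', Real.fourierInv_eq', ← integral_const_mul]
  refine integral_congr_ae (Eventually.of_forall fun ξ => ?_)
  simp only [h1, smul_eq_mul, psiSym]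
  ring

lemma fourier_eq_zero_of_not_integrable {n : ℕ} {f : Eucl n → ℂ} (hf : ¬ Integrable f)
    (ξ : Eucl n) : 𝓕 f ξ = 0 := by
  rw [Real.fourier_eq]
  refine integral_undef fun h => hf ?_
  exact (Real.fourierIntegral_convergent_iff ξ).1 h

lemma norm_projT_duhamel_le {n : ℕ} (ε : Fin n → ℝ) (χ : ℝ → ℝ) (j : ℤ)
    (F : SchwartzMap (ℝ × Eucl n) ℂ) (t : ℝ) (x : Eucl n) :
    ‖projT χ j (fun q => -I * duhamel ε (fun q' => F q') q) (t, x)‖ ≤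
      ‖𝓕⁻ (fun ξ => psiSym χ j ξ * duhamelFourier ε F t ξ) x‖ := by
  rw [projT_duhamel_eq, norm_mul, norm_neg, Complex.norm_I, one_mul]
  by_cases hi : Integrable (𝓕⁻ (duhamelFourier ε F t))
  · rw [(continuous_duhamelFourier ε F t).fourier_fourierInv_eq (integrable_duhamelFourier ε F t)]
    have h2 : 𝓕 (duhamelFourier ε F t) = fun v => 𝓕⁻ (duhamelFourier ε F t) (-v) := by
      ext v
      rw [Real.fourierInv_eq_fourier_neg, neg_neg]
    rw [h2]
    exact hi.comp_neg
  · simp only [fourier_eq_zero_of_not_integrable hi, mul_zero]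
    have h0 : 𝓕⁻ (fun _ : Eucl n => (0 : ℂ)) x = 0 := by
      rw [Real.fourierInv_eq']
      simp
    rw [h0, norm_zero]
    exact norm_nonneg _

/-- Parabolic rescaling of a space-time function. -/
def rescale {n : ℕ} (l : ℝ) (G : ℝ × Eucl n → ℂ) (q : ℝ × Eucl n) : ℂ :=
  G ((l ^ 2)⁻¹ * q.1, l⁻¹ • q.2)

lemma fourierInv_psiSym_mul_duhamelFourier {n : ℕ} (hn : 0 < n) (ε : Fin n → ℝ)
    (hε : ∀ i, ε i = 1 ∨ ε i = -1) {ι : Type*} (A : Finset ι)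
    (m : ι → Fin n → ℝ → ℝ) (hm : ∀ a k, Smooth (m a k)) (hc : ∀ a k, HasCompactSupport (m a k))
    (hA : ∀ ξ : Eucl n, 1 / 2 ≤ ‖ξ‖ → ‖ξ‖ ≤ 2 → ∑ a ∈ A, tens (m a) ξ = 1)
    {χ : ℝ → ℝ} (hχ : IsBump χ) (j : ℤ) (F : SchwartzMap (ℝ × Eucl n) ℂ)
    (hG : Integrable (rescale ((2 : ℝ) ^ j) (projT χ j fun q => F q))) (t : ℝ) (x : Eucl n) :
    𝓕⁻ (fun ξ => psiSym χ j ξ * duhamelFourier ε F t ξ) x =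
      (((((2 : ℝ) ^ j) ^ 2)⁻¹ : ℝ) : ℂ) * ∑ a ∈ A,
        retPot ε (m a) (rescale ((2 : ℝ) ^ j) (projT χ j fun q => F q)) (((2 : ℝ) ^ j) ^ 2 * t)
          ((2 : ℝ) ^ j • x) := by
  set l : ℝ := (2 : ℝ) ^ j with hl_def
  have hl : 0 < l := by positivity
  set G := projT χ j fun q => F q with hG_def
  obtain ⟨M, hM⟩ := (hasCompactSupport_psiSym (n := n) hχ j).exists_bound_of_continuous
    (contDiff_psiSym hχ j).continuous
  rw [← integral_ret_ph ε F (contDiff_psiSym hχ j).continuous hM]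
  set H : ℝ → ℂ := fun s => (ret t s : ℂ) *
    ∫ ξ, ph ε (t - s) x ξ * (psiSym χ j ξ * 𝓕 (fun y => F (s, y)) ξ) with hH
  have hsub := Measure.integral_comp_smul (volume : Measure ℝ) H (l ^ 2)⁻¹
  rw [Module.finrank_self, pow_one, inv_inv, abs_of_pos (by positivity)] at hsub
  have hs : ∀ s, H ((l ^ 2)⁻¹ • s) = ∑ a ∈ A, ∫ y, rescale l G (s, y) *
      ((ret (l ^ 2 * t) s : ℂ) * ker ε (m a) (l ^ 2 * t - s) (l • x - y)) := by
    intro s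
    have h1 := sum_integral_mul_ker ε A m hm hc hA hl
      (integrable_projT_slice hχ j F ((l ^ 2)⁻¹ * s)) (fun ξ hξ => by
        rw [fourier_projT hχ] at hξ
        exact psiSym_ne_zero hχ (left_ne_zero_of_mul hξ)) (l ^ 2 * t - s) (l • x)
    rw [inv_smul_smul₀ hl.ne', mul_sub, inv_mul_cancel_left₀ (by positivity)] at h1
    simp only [fourier_projT hχ] at h1
    simp only [hH, smul_eq_mul, ret_smul (show 0 < l ^ 2 by positivity)]
    rw [← h1, Finset.mul_sum]
    refine Finset.sum_congr rfl fun a _ => ?_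
    rw [← integral_const_mul]
    refine integral_congr_ae (Eventually.of_forall fun y => ?_)
    simp only [rescale, hG_def]
    ring
  have hfin : ∑ a ∈ A, retPot ε (m a) (rescale l G) (l ^ 2 * t) (l • x) =
      ((l ^ 2 : ℝ) : ℂ) * ∫ s, H s := by
    rw [← Complex.real_smul, ← hsub]
    simp only [hs]
    rw [integral_finsetSum]
    · refine Finset.sum_congr rfl fun a _ => ?_
      rw [retPot]
      exact integral_prod _ (integrable_retPot hn ε hε (hm a) (hc a) hG _ _)
    · intro a _
      exact (integrable_retPot hn ε hε (hm a) (hc a) hG _ _).integral_prod_left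
  rw [hfin, ← mul_assoc, ← Complex.ofReal_mul, inv_mul_cancel₀ (by positivity), Complex.ofReal_one,
    one_mul]

lemma lintegral_comp_smul {E : Type*} [NormedAddCommGroup E] [NormedSpace ℝ E]
    [FiniteDimensional ℝ E] [MeasurableSpace E] [BorelSpace E] (μ : Measure E)
    [μ.IsAddHaarMeasure] (f : E → ℝ≥0∞) {c : ℝ} (hc : 0 < c) :
    ∫⁻ x, f (c • x) ∂μ = ENNReal.ofReal (c ^ Module.finrank ℝ E)⁻¹ * ∫⁻ x, f x ∂μ := by
  rw [← (measurableEmbedding_const_smul₀ hc.ne').lintegral_map,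
    Measure.map_addHaar_smul μ hc.ne', lintegral_smul_measure, abs_of_pos (by positivity),
    smul_eq_mul]

lemma tp_add (a b : ℝ) : tp (a + b) = tp a * tp b := by
  rw [tp, tp, tp, Real.rpow_add two_pos, ENNReal.ofReal_mul (by positivity)]

lemma tp_ne_top (a : ℝ) : tp a ≠ ∞ := ENNReal.ofReal_ne_top

lemma tp_rpow (a b : ℝ) : tp a ^ b = tp (a * b) := by
  rw [tp, tp, ENNReal.ofReal_rpow_of_pos (by positivity), ← Real.rpow_mul two_pos.le]

lemma ofReal_zpow_pow (j : ℤ) (k : ℕ) : ENNReal.ofReal (((2 : ℝ) ^ j) ^ k) = tp (j * k) := by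
  rw [tp, Real.rpow_mul two_pos.le, Real.rpow_intCast, Real.rpow_natCast]

lemma ofReal_zpow_pow_inv (j : ℤ) (k : ℕ) :
    ENNReal.ofReal (((2 : ℝ) ^ j) ^ k)⁻¹ = tp (-(j * k)) := by
  rw [tp, Real.rpow_neg two_pos.le, Real.rpow_mul two_pos.le, Real.rpow_intCast,
    Real.rpow_natCast]

lemma finrank_hyperplane {n : ℕ} (hn : 0 < n) {e : Eucl n} (he : ‖e‖ = 1) :
    Module.finrank ℝ (hyperplane e) = n - 1 := by
  have : Fact (Module.finrank ℝ (Eucl n) = (n - 1) + 1) :=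
    ⟨by rw [finrank_euclideanSpace_fin]; omega⟩
  exact Submodule.finrank_orthogonal_span_singleton (by rintro rfl; simp at he)

lemma continuous_rescale {n : ℕ} (l : ℝ) {G : ℝ × Eucl n → ℂ} (hG : Continuous G) :
    Continuous (rescale l G) := by
  unfold rescale
  fun_prop

lemma integrable_rescale {n : ℕ} {l : ℝ} (hl : 0 < l) {G : ℝ × Eucl n → ℂ} (hG : Integrable G) :
    Integrable (rescale l G) := by
  set L : (ℝ × Eucl n) ≃ₗ[ℝ] (ℝ × Eucl n) :=
    (LinearEquiv.smulOfNeZero ℝ ℝ (l ^ 2)⁻¹ (by positivity)).prodCongr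
      (LinearEquiv.smulOfNeZero ℝ (Eucl n) l⁻¹ (by positivity)) with hL
  have hdet : LinearMap.det (L : (ℝ × Eucl n) →ₗ[ℝ] (ℝ × Eucl n)) ≠ 0 :=
    (LinearEquiv.isUnit_det' L).ne_zero
  have hmap := Measure.map_linearMap_addHaar_eq_smul_addHaar
    ((volume : Measure ℝ).prod (volume : Measure (Eucl n))) hdet
  have hG' : Integrable G (Measure.map (L : (ℝ × Eucl n) →ₗ[ℝ] (ℝ × Eucl n)) volume) := by
    rw [Measure.volume_eq_prod, hmap]
    exact hG.smul_measure ENNReal.ofReal_ne_top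
  exact hG'.comp_measurable (by exact L.toContinuousLinearEquiv.continuous.measurable)

lemma rescale_slabT {n : ℕ} (l : ℝ) (G : ℝ × Eucl n → ℂ) (e : Eucl n) (r t : ℝ)
    (v : hyperplane e) :
    rescale l G (slabT e (r, (t, v))) = G (slabT e (l⁻¹ • r, ((l ^ 2)⁻¹ • t, l⁻¹ • v))) := by
  simp [rescale, slabT, slab, smul_smul]

lemma aniNorm_rescale {n : ℕ} (hn : 0 < n) (j : ℤ) {G : ℝ × Eucl n → ℂ} (hG : Continuous G)
    {e : Eucl n} (he : ‖e‖ = 1) :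
    aniNorm 1 2 e (rescale ((2 : ℝ) ^ j) G) = tp (j * ((n + 3) / 2)) * aniNorm 1 2 e G := by
  set l : ℝ := (2 : ℝ) ^ j with hl_def
  have hl : 0 < l := by positivity
  have hcs : Continuous (slabT e) := by
    unfold slabT
    exact Continuous.prodMk (by fun_prop) ((continuous_slab e).comp (by fun_prop))
  have hcont : ∀ r, Continuous fun z : ℝ × hyperplane e => G (slabT e (r, z)) := fun r =>
    hG.comp (hcs.comp (by fun_prop))
  have hin : ∀ r, ∫⁻ z, ‖rescale l G (slabT e (r, z))‖ₑ ^ 2 =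
      tp (j * (n + 1)) * ∫⁻ z, ‖G (slabT e (l⁻¹ • r, z))‖ₑ ^ 2 := by
    intro r
    have hm1 : AEMeasurable fun z : ℝ × hyperplane e => ‖rescale l G (slabT e (r, z))‖ₑ ^ 2 := by
      have := (continuous_rescale l hG).comp (hcs.comp (by fun_prop :
        Continuous fun z : ℝ × hyperplane e => (r, z)))
      simp only [Function.comp_def] at this
      exact (this.enorm.measurable.pow_const 2).aemeasurable
    have hm2 : AEMeasurable fun z : ℝ × hyperplane e => ‖G (slabT e (l⁻¹ • r, z))‖ₑ ^ 2 := by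
      have := hcont (l⁻¹ • r)
      fun_prop
    rw [Measure.volume_eq_prod, lintegral_prod _ hm1, lintegral_prod _ hm2]
    simp only [rescale_slabT]
    have h1 : ∀ t : ℝ, ∫⁻ v : hyperplane e,
        ‖G (slabT e (l⁻¹ • r, ((l ^ 2)⁻¹ • t, l⁻¹ • v)))‖ₑ ^ 2 =
        tp (j * (n - 1)) * ∫⁻ v : hyperplane e,
          ‖G (slabT e (l⁻¹ • r, ((l ^ 2)⁻¹ • t, v)))‖ₑ ^ 2 := by
      intro t
      rw [lintegral_comp_smul volume (fun v : hyperplane e =>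
        ‖G (slabT e (l⁻¹ • r, ((l ^ 2)⁻¹ • t, v)))‖ₑ ^ 2) (inv_pos.2 hl), finrank_hyperplane hn he,
        inv_pow, inv_inv, ofReal_zpow_pow, Nat.cast_sub hn, Nat.cast_one]
    simp only [h1]
    rw [lintegral_const_mul' _ _ (tp_ne_top _),
      lintegral_comp_smul volume (fun t : ℝ => ∫⁻ v : hyperplane e,
        ‖G (slabT e (l⁻¹ • r, (t, v)))‖ₑ ^ 2) (inv_pos.2 (pow_pos hl 2)), Module.finrank_self,
      pow_one, inv_inv, ofReal_zpow_pow, ← mul_assoc, ← tp_add]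
    congr 2
    push_cast
    ring
  rw [aniNorm_one_two, aniNorm_one_two]
  simp only [hin]
  simp only [ENNReal.mul_rpow_of_nonneg _ _ (show (0 : ℝ) ≤ 1 / 2 by norm_num), tp_rpow]
  rw [lintegral_const_mul' _ _ (tp_ne_top _),
    lintegral_comp_smul volume (fun r : ℝ =>
      (∫⁻ z, ‖G (slabT e (r, z))‖ₑ ^ 2) ^ (1 / 2 : ℝ)) (inv_pos.2 hl), Module.finrank_self,
    pow_one, inv_inv, ← mul_assoc]
  congr 1
  rw [← pow_one l, ofReal_zpow_pow, ← tp_add]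
  congr 1
  push_cast
  ring

lemma sphSup_rescale_le {n : ℕ} (hn : 0 < n) (j : ℤ) {G : ℝ × Eucl n → ℂ} (hG : Continuous G) :
    sphSup (fun e => aniNorm 1 2 e (rescale ((2 : ℝ) ^ j) G)) ≤
      tp (j * ((n + 3) / 2)) * sphSup (fun e => aniNorm 1 2 e G) := by
  refine iSup₂_le fun e he => ?_
  simp only [aniNorm_rescale hn j hG he]
  refine mul_le_mul_right ?_ _
  exact le_iSup₂ (f := fun (e : Eucl n) (_ : ‖e‖ = 1) => aniNorm 1 2 e G) e he

lemma innerQ_top_le {n : ℕ} {e : Eucl n} {u w : ℝ × Eucl n → ℂ} {l : ℝ} {c : ℝ≥0∞}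
    (h : ∀ t x, ‖u (t, x)‖ₑ ≤ c * ‖w (l ^ 2 * t, l • x)‖ₑ) (r : ℝ) :
    innerQ ∞ e u r ≤ c * ⨆ z, ‖w (slabT e (l • r, z))‖ₑ := by
  rw [innerQ, eLpNorm_exponent_top, eLpNormEssSup]
  refine essSup_le_of_ae_le _ (Eventually.of_forall fun z => (h _ _).trans ?_)
  refine mul_le_mul_right ?_ _
  refine le_iSup_of_le (l ^ 2 * z.1, l • z.2) (le_of_eq ?_)
  simp [slabT, slab, smul_smul]

lemma aniNorm_top_le {n : ℕ} {p : ℝ} (hp : 0 < p) {e : Eucl n} {u w : ℝ × Eucl n → ℂ} (j : ℤ)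
    {c : ℝ≥0∞} (hc : c ≠ ∞)
    (h : ∀ t x, ‖u (t, x)‖ₑ ≤ c * ‖w (((2 : ℝ) ^ j) ^ 2 * t, (2 : ℝ) ^ j • x)‖ₑ) :
    aniNorm (ENNReal.ofReal p) ∞ e u ≤
      c * tp (-(j / p)) * (∫⁻ r, (⨆ z, ‖w (slabT e (r, z))‖ₑ) ^ p) ^ (1 / p) := by
  have hl : (0 : ℝ) < 2 ^ j := by positivity
  rw [aniNorm, if_neg ENNReal.ofReal_ne_top, ENNReal.toReal_ofReal hp.le]
  calc _ ≤ (∫⁻ r, (c * ⨆ z, ‖w (slabT e ((2 : ℝ) ^ j • r, z))‖ₑ) ^ p) ^ (1 / p) := by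
        gcongr with r
        exact innerQ_top_le h r
    _ = _ := by
        simp only [ENNReal.mul_rpow_of_nonneg _ _ hp.le]
        rw [lintegral_const_mul' _ _ (ENNReal.rpow_ne_top_of_nonneg hp.le hc),
          lintegral_comp_smul volume (fun r => (⨆ z, ‖w (slabT e (r, z))‖ₑ) ^ p) hl,
          Module.finrank_self, ofReal_zpow_pow_inv, ← mul_assoc,
          ENNReal.mul_rpow_of_nonneg _ _ (by positivity),
          ENNReal.mul_rpow_of_nonneg _ _ (by positivity), ← ENNReal.rpow_mul,
          mul_one_div_cancel hp.ne', ENNReal.rpow_one, tp_rpow]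
        congr 3
        push_cast
        ring

end DNLS

/-- maximal function estimate for the retarded term
`2^{-(n/2-1/p)j}‖P_j u‖_{L^{p,∞}_{e'}} ≤ C 2^{-j/2} sup_e ‖P_j F‖_{L^{1,2}_e}`
for `u(t) = -i∫_0^t W_±(t-s)F(s)ds`. -/
theorem duhamel_maximal_function
    (n : ℕ) (hn : 2 ≤ n) (ε : Fin n → ℝ) (hε : ∀ i, ε i = 1 ∨ ε i = -1)
    (χ : ℝ → ℝ) (hχ : IsBump χ)
    (p : ℝ) (hp : 3 ≤ n → 2 ≤ p) (hp2 : n = 2 → 3 ≤ p) :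
    ∃ C : ℝ, 0 < C ∧ ∀ (F : SchwartzMap (ℝ × Eucl n) ℂ) (j : ℤ) (e' : Eucl n), ‖e'‖ = 1 →
      tp (-(((n : ℝ) / 2 - 1 / p)) * j) *
        aniNorm (ENNReal.ofReal p) ∞ e'
          (projT χ j (fun q => -Complex.I * duhamel ε (fun q' => F q') q))
      ≤ ENNReal.ofReal C * tp (-(j : ℝ) / 2) *
          sphSup (fun e => aniNorm 1 2 e (projT χ j (fun q => F q))) := by
  have hn0 : 0 < n := by omega
  have hp0 : 0 < p := by
    rcases hn.eq_or_lt with h | h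
    · linarith [hp2 h.symm]
    · linarith [hp h]
  obtain ⟨A, m, c, hc0, hm, hc, hsupp, hA⟩ := exists_tens_partition hn0
  obtain ⟨C, hC⟩ := exists_lintegral_iSup_sum_retPot_le hn hp hp2 ε hε A m hc0 hm hc hsupp
  refine ⟨C + 1, by positivity, fun F j e' he' => ?_⟩
  set G := projT χ j fun q => F q with hG_def
  have hGc : Continuous G := continuous_projT hχ j F
  have hGi : Integrable (rescale ((2 : ℝ) ^ j) G) :=
    integrable_rescale (by positivity) (integrable_projT hχ j F)
  obtain ⟨M, hM⟩ := exists_bound_projT hχ j F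
  set S := sphSup (fun e => aniNorm 1 2 e G) with hS
  set w : ℝ × Eucl n → ℂ := fun q => ∑ a ∈ A,
    retPot ε (m a) (rescale ((2 : ℝ) ^ j) G) q.1 q.2 with hw
  have hpt : ∀ t x, ‖projT χ j (fun q => -I * duhamel ε (fun q' => F q') q) (t, x)‖ₑ ≤
      tp (-(j * (2 : ℕ))) * ‖w (((2 : ℝ) ^ j) ^ 2 * t, (2 : ℝ) ^ j • x)‖ₑ := by
    intro t x
    have h1 := norm_projT_duhamel_le ε χ j F t x
    rw [fourierInv_psiSym_mul_duhamelFourier hn0 ε hε A m hm hc hA hχ j F hGi, norm_mul,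
      Complex.norm_real, Real.norm_of_nonneg (by positivity)] at h1
    rw [← ofReal_norm, ← ofReal_norm, ← ofReal_zpow_pow_inv, ← ENNReal.ofReal_mul (by positivity)]
    exact ENNReal.ofReal_le_ofReal h1
  have hmain : (∫⁻ r, (⨆ z, ‖w (slabT e' (r, z))‖ₑ) ^ p) ^ (1 / p) ≤
      C * (tp (j * ((n + 3) / 2)) * S) := by
    refine (ENNReal.rpow_le_rpow (hC _ M (continuous_rescale _ hGc) hGi (fun q => hM _) e' he')
      (by positivity)).trans ?_
    rw [← ENNReal.rpow_mul, mul_one_div_cancel hp0.ne', ENNReal.rpow_one]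
    exact mul_le_mul_right (sphSup_rescale_le hn0 j hGc) _
  calc _ ≤ tp (-(((n : ℝ) / 2 - 1 / p)) * j) * (tp (-(j * (2 : ℕ))) * tp (-(j / p)) *
        (C * (tp (j * ((n + 3) / 2)) * S))) :=
        mul_le_mul_right ((aniNorm_top_le hp0 j (tp_ne_top _) hpt).trans
          (mul_le_mul_right hmain _)) _
    _ = C * tp (-(j : ℝ) / 2) * S := by
        have h2 : tp (-(j : ℝ) / 2) = tp (-(((n : ℝ) / 2 - 1 / p)) * j) *
            (tp (-(j * (2 : ℕ))) * tp (-(j / p)) * tp (j * ((n + 3) / 2))) := by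
          rw [← tp_add, ← tp_add, ← tp_add]
          congr 1
          push_cast
          field_simp
          ring
        rw [h2]
        ring
    _ ≤ _ := by
        gcongr
        rw [← ENNReal.ofReal_coe_nnreal]
        exact ENNReal.ofReal_le_ofReal (by simp)
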